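/- If Y = Y_apr (every point of Y lies on an almost principal closed orbit), then Y is G-saturated. In particular, a closed orbit Gv is G-saturated if and only if it is almost principal. -/

import Mathlib

/-!
Common framework: a "compact Lie group / complex reductive group acting on a
finite-dimensional module" is modelled as a subgroup of invertible `n × n`
matrices over `𝕜 = ℝ` or `ℂ` acting on `Fin n → 𝕜` by `Matrix.mulVec`.
Polynomial functions on the module are `MvPolynomial (Fin n) 𝕜`.
-/

set_option synthInstance.maxHeartbeats 1000000
set_option maxHeartbeats 1000000

noncomputable section

open MvPolynomial

namespace ZPaper

variable (𝕜 : Type) [RCLike 𝕜] (n : ℕ)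

/-- The zero set of a family of polynomials. -/
def zeroSet (S : Set (MvPolynomial (Fin n) 𝕜)) : Set (Fin n → 𝕜) :=
  {v | ∀ p ∈ S, eval v p = 0}

/-- A subset of `𝕜ⁿ` is algebraic if it is the zero set of a family of polynomials. -/
def IsAlgebraicSet (X : Set (Fin n → 𝕜)) : Prop :=
  ∃ S : Set (MvPolynomial (Fin n) 𝕜), X = zeroSet 𝕜 n S

/-- The vanishing ideal `I(X)` of a subset `X ⊆ 𝕜ⁿ`. -/
def vanishingIdeal (X : Set (Fin n → 𝕜)) : Ideal (MvPolynomial (Fin n) 𝕜) where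
  carrier := {p | ∀ x ∈ X, eval x p = 0}
  zero_mem' := by intro x _; simp
  add_mem' := by intro a b ha hb x hx; simp [ha x hx, hb x hx]
  smul_mem' := by intro c p hp x hx; simp [smul_eq_mul, hp x hx]

/-- The Zariski closure of a subset of `𝕜ⁿ`. -/
def zclosure (A : Set (Fin n → 𝕜)) : Set (Fin n → 𝕜) :=
  zeroSet 𝕜 n (vanishingIdeal 𝕜 n A : Set (MvPolynomial (Fin n) 𝕜))

/-- `A` is Zariski dense in `X`: every polynomial vanishing on `A` vanishes on `X`. -/
def ZDenseIn (A X : Set (Fin n → 𝕜)) : Prop :=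
  ∀ p : MvPolynomial (Fin n) 𝕜, (∀ a ∈ A, eval a p = 0) → ∀ x ∈ X, eval x p = 0

/-- A set of matrices is a subgroup of `GL_n(𝕜)`. -/
def IsMatSubgroup (G : Set (Matrix (Fin n) (Fin n) 𝕜)) : Prop :=
  (1 : Matrix (Fin n) (Fin n) 𝕜) ∈ G ∧ (∀ a ∈ G, ∀ b ∈ G, a * b ∈ G) ∧
    ∀ a ∈ G, IsUnit a ∧ a⁻¹ ∈ G

/-- `X` is a `G`-stable subset of `𝕜ⁿ`. -/
def Stabilizes (G : Set (Matrix (Fin n) (Fin n) 𝕜)) (X : Set (Fin n → 𝕜)) : Prop :=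
  ∀ g ∈ G, ∀ x ∈ X, Matrix.mulVec g x ∈ X

/-- A polynomial is `G`-invariant. -/
def Invariant (G : Set (Matrix (Fin n) (Fin n) 𝕜)) (p : MvPolynomial (Fin n) 𝕜) : Prop :=
  ∀ g ∈ G, ∀ v : Fin n → 𝕜, eval (Matrix.mulVec g v) p = eval v p

/-- `I_G(X)`: the ideal generated by the `G`-invariant polynomials vanishing on `X`,
i.e. by `I(X)^G = I(X) ∩ 𝕜[V]^G`. -/
def invariantIdeal (G : Set (Matrix (Fin n) (Fin n) 𝕜)) (X : Set (Fin n → 𝕜)) :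
    Ideal (MvPolynomial (Fin n) 𝕜) :=
  Ideal.span {p | Invariant 𝕜 n G p ∧ ∀ x ∈ X, eval x p = 0}

/-- `X` is `G`-reduced: `I_G(X) = I(X)`. -/
def IsGReduced (G : Set (Matrix (Fin n) (Fin n) 𝕜)) (X : Set (Fin n → 𝕜)) : Prop :=
  invariantIdeal 𝕜 n G X = vanishingIdeal 𝕜 n X

/-- `X` is almost `G`-reduced: `√I_G(X) = I(X)`. -/
def IsAlmostGReduced (G : Set (Matrix (Fin n) (Fin n) 𝕜)) (X : Set (Fin n → 𝕜)) : Prop :=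
  (invariantIdeal 𝕜 n G X).radical = vanishingIdeal 𝕜 n X

/-- The orbit `G·v`. -/
def orbit (G : Set (Matrix (Fin n) (Fin n) 𝕜)) (v : Fin n → 𝕜) : Set (Fin n → 𝕜) :=
  (fun g => Matrix.mulVec g v) '' G

/-- The isotropy group `G_v`. -/
def isotropy (G : Set (Matrix (Fin n) (Fin n) 𝕜)) (v : Fin n → 𝕜) :
    Set (Matrix (Fin n) (Fin n) 𝕜) :=
  {g ∈ G | Matrix.mulVec g v = v}

/-- Matrix exponential. -/
def mexp (A : Matrix (Fin n) (Fin n) 𝕜) : Matrix (Fin n) (Fin n) 𝕜 :=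
  ∑' k : ℕ, ((k.factorial : 𝕜)⁻¹) • A ^ k

/-- The Lie algebra of a matrix group: matrices whose one-parameter subgroup lies in `G`. -/
def lieAlgebra (G : Set (Matrix (Fin n) (Fin n) 𝕜)) : Set (Matrix (Fin n) (Fin n) 𝕜) :=
  {A | ∀ t : 𝕜, mexp 𝕜 n (t • A) ∈ G}

/-- The tangent space `T_v(G·v)` to the orbit, i.e. `𝔤·v`. -/
def orbitTangent (G : Set (Matrix (Fin n) (Fin n) 𝕜)) (v : Fin n → 𝕜) :
    Submodule 𝕜 (Fin n → 𝕜) :=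
  Submodule.span 𝕜 ((fun A => Matrix.mulVec A v) '' lieAlgebra 𝕜 n G)

/-- `N` is a `G_v`-stable complement to `T_v(G·v)` in `𝕜ⁿ` (a slice at `v`). -/
def IsSliceComplement (G : Set (Matrix (Fin n) (Fin n) 𝕜)) (v : Fin n → 𝕜)
    (N : Submodule 𝕜 (Fin n → 𝕜)) : Prop :=
  IsCompl (orbitTangent 𝕜 n G v) N ∧
    ∀ g ∈ isotropy 𝕜 n G v, ∀ x ∈ N, Matrix.mulVec g x ∈ N

/-- The image of `H` in `GL(N)` is trivial. -/
def ActsTriviallyOn (H : Set (Matrix (Fin n) (Fin n) 𝕜))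
    (N : Submodule 𝕜 (Fin n → 𝕜)) : Prop :=
  ∀ g ∈ H, ∀ x ∈ N, Matrix.mulVec g x = x

/-- The image of `H` in `GL(N)` is finite. -/
def HasFiniteImageOn (H : Set (Matrix (Fin n) (Fin n) 𝕜))
    (N : Submodule 𝕜 (Fin n → 𝕜)) : Prop :=
  Set.Finite ((fun g => fun x : N => Matrix.mulVec g (x : Fin n → 𝕜)) '' H)

/-- The orbit `G·v` is (Zariski) closed. -/
def HasClosedOrbit (G : Set (Matrix (Fin n) (Fin n) 𝕜)) (v : Fin n → 𝕜) : Prop :=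
  zclosure 𝕜 n (orbit 𝕜 n G v) ⊆ orbit 𝕜 n G v

/-- `v` lies on a principal orbit: `G·v` is closed and the isotropy group acts trivially on
some (hence any) slice at `v`. -/
def IsPrincipalPt (G : Set (Matrix (Fin n) (Fin n) 𝕜)) (v : Fin n → 𝕜) : Prop :=
  HasClosedOrbit 𝕜 n G v ∧
    ∃ N, IsSliceComplement 𝕜 n G v N ∧ ActsTriviallyOn 𝕜 n (isotropy 𝕜 n G v) N

/-- `v` lies on an almost principal orbit. -/
def IsAlmostPrincipalPt (G : Set (Matrix (Fin n) (Fin n) 𝕜)) (v : Fin n → 𝕜) : Prop :=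
  HasClosedOrbit 𝕜 n G v ∧
    ∃ N, IsSliceComplement 𝕜 n G v N ∧ HasFiniteImageOn 𝕜 n (isotropy 𝕜 n G v) N

/-- The set of principal points `V_pr`. -/
def prPoints (G : Set (Matrix (Fin n) (Fin n) 𝕜)) : Set (Fin n → 𝕜) :=
  {v | IsPrincipalPt 𝕜 n G v}

/-- The set of almost principal points `V_apr`. -/
def aprPoints (G : Set (Matrix (Fin n) (Fin n) 𝕜)) : Set (Fin n → 𝕜) :=
  {v | IsAlmostPrincipalPt 𝕜 n G v}

/-- `π⁻¹(π(Y))`: all points that the invariants cannot separate from `Y`. -/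
def saturation (G : Set (Matrix (Fin n) (Fin n) 𝕜)) (Y : Set (Fin n → 𝕜)) :
    Set (Fin n → 𝕜) :=
  {v | ∃ y ∈ Y, ∀ p, Invariant 𝕜 n G p → eval v p = eval y p}

/-- `Y` is `G`-saturated: `Y = π⁻¹(π(Y))`. -/
def IsSaturated (G : Set (Matrix (Fin n) (Fin n) 𝕜)) (Y : Set (Fin n → 𝕜)) : Prop :=
  Y = saturation 𝕜 n G Y

/-- The fiber `π⁻¹(π(v))` of the quotient morphism. -/
def piFiber (G : Set (Matrix (Fin n) (Fin n) 𝕜)) (v : Fin n → 𝕜) : Set (Fin n → 𝕜) :=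
  {u | ∀ p, Invariant 𝕜 n G p → eval u p = eval v p}

/-- The invariant ring `𝕜[V]^G` as a subalgebra of `𝕜[V]`. -/
def invariantSubalgebra (G : Set (Matrix (Fin n) (Fin n) 𝕜)) :
    Subalgebra 𝕜 (MvPolynomial (Fin n) 𝕜) where
  carrier := {p | Invariant 𝕜 n G p}
  mul_mem' := by intro a b ha hb g hg v; simp [ha g hg v, hb g hg v]
  one_mem' := by intro g hg v; simp
  add_mem' := by intro a b ha hb g hg v; simp [ha g hg v, hb g hg v]
  zero_mem' := by intro g hg v; simp
  algebraMap_mem' := by intro r g hg v; simp [MvPolynomial.algebraMap_eq]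

/-- The representation is cofree: `𝕜[V]` is a free module over `𝕜[V]^G`. -/
def IsCofree (G : Set (Matrix (Fin n) (Fin n) 𝕜)) : Prop :=
  Module.Free ↥(invariantSubalgebra 𝕜 n G) (MvPolynomial (Fin n) 𝕜)

/-- The vanishing ideal of `π(Y)` in `𝕜[V//G] = 𝕜[V]^G`. -/
def quotVanishingIdeal (G : Set (Matrix (Fin n) (Fin n) 𝕜)) (Y : Set (Fin n → 𝕜)) :
    Ideal ↥(invariantSubalgebra 𝕜 n G) where
  carrier := {p | ∀ y ∈ Y, eval y (p : MvPolynomial (Fin n) 𝕜) = 0}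
  zero_mem' := by intro y hy; simp
  add_mem' := by intro a b ha hb y hy; simp [ha y hy, hb y hy]
  smul_mem' := by intro c p hp y hy; simp [smul_eq_mul, hp y hy]

/-- The module is stable: there is a nonempty Zariski-open set of points with closed orbit. -/
def IsStableModule (G : Set (Matrix (Fin n) (Fin n) 𝕜)) : Prop :=
  ∃ U : Set (Fin n → 𝕜), U.Nonempty ∧ IsAlgebraicSet 𝕜 n Uᶜ ∧
    ∀ v ∈ U, HasClosedOrbit 𝕜 n G v

/-- `G` is Zariski closed in `GL_n(𝕜)`. -/
def IsZClosedInGL (G : Set (Matrix (Fin n) (Fin n) 𝕜)) : Prop :=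
  ∃ P : Set (MvPolynomial (Fin n × Fin n) 𝕜),
    G = {g | IsUnit g ∧ ∀ p ∈ P, eval (fun ij => g ij.1 ij.2) p = 0}

/-- `G` is a (linearly) reductive algebraic group: a Zariski closed subgroup of `GL_n`
containing a Zariski-dense compact subgroup (the unitarian trick characterization). -/
def IsReductiveGroup (G : Set (Matrix (Fin n) (Fin n) 𝕜)) : Prop :=
  IsMatSubgroup 𝕜 n G ∧ IsZClosedInGL 𝕜 n G ∧
    ∃ K : Set (Matrix (Fin n) (Fin n) 𝕜), K ⊆ G ∧ IsCompact K ∧ IsMatSubgroup 𝕜 n K ∧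
      ∀ p : MvPolynomial (Fin n × Fin n) 𝕜,
        (∀ k ∈ K, eval (fun ij => k ij.1 ij.2) p = 0) →
          ∀ g ∈ G, eval (fun ij => g ij.1 ij.2) p = 0

/-- The isotropy groups of `v` and `w` are conjugate in `G`. -/
def ConjIsotropy (G : Set (Matrix (Fin n) (Fin n) 𝕜)) (v w : Fin n → 𝕜) : Prop :=
  ∃ g ∈ G, isotropy 𝕜 n G w = (fun h => g * h * g⁻¹) '' isotropy 𝕜 n G v

/-- The (Luna) stratum of `V` determined by a point `v` with closed orbit: the inverse image
under `π` of the set of closed orbits with isotropy group conjugate to `G_v`. -/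
def stratumOf (G : Set (Matrix (Fin n) (Fin n) 𝕜)) (v : Fin n → 𝕜) : Set (Fin n → 𝕜) :=
  {u | ∃ w, HasClosedOrbit 𝕜 n G w ∧ w ∈ zclosure 𝕜 n (orbit 𝕜 n G u) ∧
    ConjIsotropy 𝕜 n G v w}

/-- Dimension of (the Zariski closure of) a subset of `𝕜ⁿ`, as the Krull dimension of its
coordinate ring. -/
def adim (X : Set (Fin n → 𝕜)) : WithBot ℕ∞ :=
  ringKrullDim (MvPolynomial (Fin n) 𝕜 ⧸ vanishingIdeal 𝕜 n X)

/-- A nonempty algebraic set with prime vanishing ideal, i.e. an irreducible algebraic set. -/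
def IsIrredAlg (Z : Set (Fin n → 𝕜)) : Prop :=
  IsAlgebraicSet 𝕜 n Z ∧ Z.Nonempty ∧ (vanishingIdeal 𝕜 n Z).IsPrime

/-- `Z` is an irreducible component of `Y`. -/
def IsIrredComponentOf (Y Z : Set (Fin n → 𝕜)) : Prop :=
  IsIrredAlg 𝕜 n Z ∧ Z ⊆ Y ∧
    ∀ Z', IsIrredAlg 𝕜 n Z' → Z ⊆ Z' → Z' ⊆ Y → Z' = Z

/-- The rank at `v` of the differential of `f = (f_1, …, f_d) : V → 𝕜^d`. -/
def jacRank {d : ℕ} (f : Fin d → MvPolynomial (Fin n) 𝕜) (v : Fin n → 𝕜) : ℕ :=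
  (Matrix.of fun (i : Fin d) (j : Fin n) => eval v (pderiv j (f i))).rank

/-- A polynomial is `H`-invariant as a function on the submodule `N`. -/
def InvariantOn (H : Set (Matrix (Fin n) (Fin n) 𝕜)) (N : Submodule 𝕜 (Fin n → 𝕜))
    (p : MvPolynomial (Fin n) 𝕜) : Prop :=
  ∀ g ∈ H, ∀ x ∈ N, eval (Matrix.mulVec g x) p = eval x p

/-- The null cone of the `H`-module `N`: points of `N` which the `H`-invariant functions on `N`
cannot separate from `0`. -/
def sliceNullCone (H : Set (Matrix (Fin n) (Fin n) 𝕜)) (N : Submodule 𝕜 (Fin n → 𝕜)) :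
    Set (Fin n → 𝕜) :=
  {x | x ∈ N ∧ ∀ p, InvariantOn 𝕜 n H N p → eval x p = eval (0 : Fin n → 𝕜) p}

/-- The `H`-module `N` is coreduced: the vanishing ideal of its null cone in `𝕜[N]` is
generated by `H`-invariant functions.  (Stated in `𝕜[V]`: the vanishing ideal of the null
cone equals the ideal generated by the invariant functions vanishing on it together with the
vanishing ideal of `N`.) -/
def CoreducedOn (H : Set (Matrix (Fin n) (Fin n) 𝕜)) (N : Submodule 𝕜 (Fin n → 𝕜)) : Prop :=
  vanishingIdeal 𝕜 n (sliceNullCone 𝕜 n H N) =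
    Ideal.span ({p | InvariantOn 𝕜 n H N p ∧ ∀ x ∈ sliceNullCone 𝕜 n H N, eval x p = 0} ∪
      {p | ∀ x ∈ (N : Set (Fin n → 𝕜)), eval x p = 0})

/-- Complexification of a real vector. -/
def cVec (w : Fin n → ℝ) : Fin n → ℂ := fun i => (w i : ℂ)

/-- The complexification `G = K_ℂ` of a compact matrix group `K ⊆ GL_n(ℝ)`: the Zariski
closure of `K` in the complex matrices. -/
def complexifiedGroup (K : Set (Matrix (Fin n) (Fin n) ℝ)) :
    Set (Matrix (Fin n) (Fin n) ℂ) :=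
  {g | ∀ p : MvPolynomial (Fin n × Fin n) ℂ,
    (∀ k ∈ K, eval (fun ij => (k ij.1 ij.2 : ℂ)) p = 0) →
      eval (fun ij => g ij.1 ij.2) p = 0}

/-- The complexification `Y = X_ℂ ⊆ ℂⁿ` of `X ⊆ ℝⁿ`: the Zariski closure of `X` in `ℂⁿ`. -/
def complexification (X : Set (Fin n → ℝ)) : Set (Fin n → ℂ) :=
  zclosure ℂ n (cVec n '' X)

end ZPaper

namespace ZPaper

set_option linter.unusedSectionVars false

section Operators

open Filter Topology InnerProductSpace NormedSpace

variable {E : Type*} [NormedAddCommGroup E] [InnerProductSpace ℂ E] [FiniteDimensional ℂ E]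
  [CompleteSpace E]

/-- An eigenvector of an operator is an eigenvector of its exponential. -/
theorem exp_apply_of_eigenvector (X : E →L[ℂ] E) (c : ℂ) (x : E) (h : X x = c • x) :
    exp X x = Complex.exp c • x := by
  have h1 : HasSum (fun k : ℕ => ((k.factorial : ℂ)⁻¹ • X ^ k) x) (exp X x) :=
    (NormedSpace.exp_series_hasSum_exp' (𝕂 := ℂ) X).mapL (ContinuousLinearMap.apply ℂ E x)
  have h2 : HasSum (fun k : ℕ => ((k.factorial : ℂ)⁻¹ • c ^ k) • x) (exp c • x) :=
    (NormedSpace.exp_series_hasSum_exp' (𝕂 := ℂ) c).smul_const x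
  have h3 : ∀ k : ℕ, (X ^ k) x = c ^ k • x := by
    intro k
    induction k with
    | zero => simp
    | succ k ih => rw [pow_succ', mul_apply_eq_comp, ih, map_smul, h, smul_smul, pow_succ]
  rw [Complex.exp_eq_exp_ℂ]
  refine h1.unique ?_
  convert h2 using 2 with k
  simp [h3, smul_smul]

/-- Spectral theorem for a self-adjoint operator and its exponentials. -/
theorem exists_eigenbasis (A : E →L[ℂ] E) (hA : IsSelfAdjoint A) :
    ∃ (b : OrthonormalBasis (Fin (Module.finrank ℂ E)) ℂ E) (l : Fin (Module.finrank ℂ E) → ℝ),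
      (∀ i, |l i| ≤ ‖A‖) ∧ (∀ i, A (b i) = (l i : ℂ) • b i) ∧
      (∀ v i, b.repr (A v) i = l i * b.repr v i) ∧
      ∀ (z : ℂ) v i, b.repr (exp (z • A) v) i = Complex.exp (z * l i) * b.repr v i := by
  have hs : (A : E →ₗ[ℂ] E).IsSymmetric := hA.isSymmetric
  set b := hs.eigenvectorBasis rfl
  set l := hs.eigenvalues rfl
  have hb : ∀ i, A (b i) = (l i : ℂ) • b i := fun i => hs.apply_eigenvectorBasis rfl i
  have key : ∀ (B : E →L[ℂ] E) (m : Fin (Module.finrank ℂ E) → ℂ), (∀ i, B (b i) = m i • b i) →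
      ∀ v i, b.repr (B v) i = m i * b.repr v i := by
    intro B m hB v i
    conv_lhs => rw [← b.sum_repr v]
    rw [map_sum, map_sum]
    simp only [map_smul, hB, OrthonormalBasis.repr_self]
    rw [WithLp.ofLp_sum, Finset.sum_apply, Finset.sum_eq_single i]
    · simp [mul_comm]
    · intro j _ hj
      simp [hj.symm]
    · simp
  refine ⟨b, l, ?_, hb, key A _ hb, ?_⟩
  · intro i
    have h1 := A.le_opNorm (b i)
    rw [hb i, norm_smul, b.norm_eq_one] at h1
    simpa using h1
  · intro z
    refine key _ _ fun i => exp_apply_of_eigenvector _ _ _ ?_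
    rw [smul_apply, hb, smul_smul]

theorem norm_sq_eq_sum_repr {ι : Type*} [Fintype ι] (b : OrthonormalBasis ι ℂ E) (v : E) :
    ‖v‖ ^ 2 = ∑ i, ‖b.repr v i‖ ^ 2 := by
  rw [← b.repr.norm_map v, EuclideanSpace.norm_sq_eq]

theorem inner_eq_sum_repr {ι : Type*} [Fintype ι] (b : OrthonormalBasis ι ℂ E) (v w : E) :
    ⟪v, w⟫_ℂ = ∑ i, b.repr w i * (starRingEnd ℂ) (b.repr v i) := by
  rw [← b.repr.inner_map_map v w, PiLp.inner_apply]
  simp only [RCLike.inner_apply]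

/-- Convexity of the norm along a one-parameter group through a critical vector. -/
theorem norm_le_norm_exp (A : E →L[ℂ] E) (hA : IsSelfAdjoint A) (v : E) (hv : ⟪v, A v⟫_ℂ = 0) :
    ‖v‖ ≤ ‖exp A v‖ ∧ (‖exp A v‖ ≤ ‖v‖ → A v = 0) := by
  obtain ⟨b, l, -, -, hAr, hexp⟩ := exists_eigenbasis A hA
  have h1 : ∑ i, l i * ‖b.repr v i‖ ^ 2 = 0 := by
    rw [inner_eq_sum_repr b] at hv
    simp only [hAr] at hv
    have := congrArg Complex.re hv
    rw [Complex.re_sum, Complex.zero_re] at this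
    rw [← this]
    refine Finset.sum_congr rfl fun i _ => ?_
    rw [mul_assoc, Complex.mul_conj, ← Complex.ofReal_mul, Complex.ofReal_re, Complex.normSq_eq_norm_sq]
  have h2 : ‖exp A v‖ ^ 2 = ∑ i, Real.exp (2 * l i) * ‖b.repr v i‖ ^ 2 := by
    rw [norm_sq_eq_sum_repr b]
    refine Finset.sum_congr rfl fun i _ => ?_
    have := hexp 1 v i
    rw [one_smul, one_mul] at this
    rw [this, norm_mul, Complex.norm_exp, Complex.ofReal_re, mul_pow, ← Real.exp_nat_mul]
    norm_num
  have h3 : ‖exp A v‖ ^ 2 - ‖v‖ ^ 2 =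
      ∑ i, (Real.exp (2 * l i) - 1 - 2 * l i) * ‖b.repr v i‖ ^ 2 := by
    rw [h2, norm_sq_eq_sum_repr b v]
    have : (0 : ℝ) = 2 * ∑ i, l i * ‖b.repr v i‖ ^ 2 := by rw [h1, mul_zero]
    rw [← sub_zero (_ - _), this, Finset.mul_sum, ← Finset.sum_sub_distrib, ← Finset.sum_sub_distrib]
    refine Finset.sum_congr rfl fun i _ => by ring
  have h4 : ∀ i, 0 ≤ (Real.exp (2 * l i) - 1 - 2 * l i) * ‖b.repr v i‖ ^ 2 := fun i =>
    mul_nonneg (by linarith [Real.add_one_le_exp (2 * l i)]) (sq_nonneg _)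
  have h5 := Finset.sum_nonneg fun i (_ : i ∈ Finset.univ) => h4 i
  refine ⟨?_, fun h => ?_⟩
  · rw [← h3] at h5
    exact (sq_le_sq₀ (norm_nonneg _) (norm_nonneg _)).1 (by linarith)
  · have h6 : ∑ i, (Real.exp (2 * l i) - 1 - 2 * l i) * ‖b.repr v i‖ ^ 2 = 0 := by
      refine le_antisymm ?_ h5
      rw [← h3]
      have := (sq_le_sq₀ (norm_nonneg _) (norm_nonneg _)).2 h
      linarith
    rw [Finset.sum_eq_zero_iff_of_nonneg fun i _ => h4 i] at h6
    refine b.repr.injective ?_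
    ext i
    rw [hAr, map_zero]
    by_cases hl : l i = 0
    · simp [hl]
    · have h7 := h6 i (Finset.mem_univ i)
      have h8 : 0 < Real.exp (2 * l i) - 1 - 2 * l i := by
        have := Real.add_one_lt_exp (x := 2 * l i) (by simpa using hl)
        linarith
      have h9 : b.repr v i = 0 := by simpa [h8.ne'] using h7
      simp [h9]

/-- For a critical vector, the imaginary part of `⟪v, exp X v⟫` is small compared with the
displacement `‖exp X v - v‖ ^ 2`. -/
theorem abs_im_inner_exp_le {ε : ℝ} (hε : 0 < ε) : ∃ δ > 0, ∀ (X : E →L[ℂ] E) (v : E),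
    star X = -X → ‖X‖ < δ → ⟪v, X v⟫_ℂ = 0 →
      |Complex.im ⟪v, exp X v⟫_ℂ| ≤ ε * ‖exp X v - v‖ ^ 2 := by
  refine ⟨min 1 ε, lt_min one_pos hε, fun X v hX hXn hv => ?_⟩
  obtain ⟨hX1, hX2⟩ := lt_min_iff.1 hXn
  set A : E →L[ℂ] E := (-Complex.I) • X with hAdef
  have hXA : X = Complex.I • A := by simp [hAdef, smul_smul]
  have hA : IsSelfAdjoint A := by
    rw [IsSelfAdjoint, hAdef, star_smul, hX]
    simp
  have hAn : ‖A‖ = ‖X‖ := by simp [hAdef, norm_smul]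
  obtain ⟨b, l, hl, -, hAr, hexp⟩ := exists_eigenbasis A hA
  have hvA : ⟪v, A v⟫_ℂ = 0 := by
    rw [hAdef, smul_apply, inner_smul_right, hv, mul_zero]
  have h1 : ∑ i, l i * ‖b.repr v i‖ ^ 2 = 0 := by
    rw [inner_eq_sum_repr b] at hvA
    simp only [hAr] at hvA
    have := congrArg Complex.re hvA
    rw [Complex.re_sum, Complex.zero_re] at this
    rw [← this]
    refine Finset.sum_congr rfl fun i _ => ?_
    rw [mul_assoc, Complex.mul_conj, ← Complex.ofReal_mul, Complex.ofReal_re, Complex.normSq_eq_norm_sq]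
  have hr : ∀ i, b.repr (exp X v) i = Complex.exp (l i * Complex.I) * b.repr v i := by
    intro i
    rw [hXA, hexp, mul_comm Complex.I]
  have h2 : Complex.im ⟪v, exp X v⟫_ℂ = ∑ i, (Real.sin (l i) - l i) * ‖b.repr v i‖ ^ 2 := by
    simp only [sub_mul]
    rw [Finset.sum_sub_distrib, h1, sub_zero, inner_eq_sum_repr b, Complex.im_sum]
    refine Finset.sum_congr rfl fun i _ => ?_
    rw [hr, mul_assoc, Complex.mul_conj, Complex.im_mul_ofReal, Complex.exp_ofReal_mul_I_im,
      Complex.normSq_eq_norm_sq]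
  have h3 : ‖exp X v - v‖ ^ 2 = ∑ i, (2 - 2 * Real.cos (l i)) * ‖b.repr v i‖ ^ 2 := by
    rw [norm_sq_eq_sum_repr b]
    refine Finset.sum_congr rfl fun i _ => ?_
    have : b.repr (exp X v - v) i = (Complex.exp (l i * Complex.I) - 1) * b.repr v i := by
      rw [map_sub, PiLp.sub_apply, hr]; ring
    rw [this, norm_mul, mul_pow]
    congr 1
    rw [← Complex.normSq_eq_norm_sq, Complex.normSq_apply, Complex.sub_re, Complex.sub_im,
      Complex.exp_ofReal_mul_I_im, Complex.exp_ofReal_mul_I_re, Complex.one_re, Complex.one_im]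
    have := Real.sin_sq_add_cos_sq (l i)
    nlinarith
  rw [h2, h3, Finset.mul_sum]
  refine (Finset.abs_sum_le_sum_abs _ _).trans (Finset.sum_le_sum fun i _ => ?_)
  rw [abs_mul, abs_of_nonneg (sq_nonneg ‖b.repr v i‖), ← mul_assoc]
  refine mul_le_mul_of_nonneg_right ?_ (sq_nonneg _)
  have hli : |l i| ≤ 1 := (hl i).trans (by rw [hAn]; exact hX1.le)
  have hli' : |l i| ≤ ε := (hl i).trans (by rw [hAn]; exact hX2.le)
  have hs := Real.sin_bound hli
  have hc := Real.cos_bound hli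
  have hpos := abs_nonneg (l i)
  have e2 : (l i) ^ 2 = |l i| ^ 2 := (sq_abs _).symm
  have e3 : |(l i) ^ 3| = |l i| ^ 3 := abs_pow _ _
  have hs' : |Real.sin (l i) - l i| ≤ |l i| ^ 5 / 100 + |l i| ^ 3 / 6 := by
    have : Real.sin (l i) - l i = (Real.sin (l i) - (l i - l i ^ 3 / 6)) + (- (l i ^ 3 / 6)) := by ring
    rw [this]
    refine (abs_add_le _ _).trans (add_le_add hs ?_)
    rw [abs_neg, abs_div, e3]
    norm_num
  have hc' := (abs_le.1 hc).2
  rw [e2] at hc'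
  set x := |l i|
  have h4 : x ^ 4 ≤ x ^ 3 := pow_le_pow_of_le_one hpos hli (by norm_num)
  have h4' : x ^ 5 ≤ x ^ 3 := pow_le_pow_of_le_one hpos hli (by norm_num)
  have h5 : x ^ 3 ≤ ε * x ^ 2 := by
    rw [pow_succ']; exact mul_le_mul_of_nonneg_right hli' (sq_nonneg _)
  have h6 : x ^ 4 ≤ x ^ 2 := pow_le_pow_of_le_one hpos hli (by norm_num)
  have h7 : x ^ 2 / 2 ≤ 2 - 2 * Real.cos (l i) := by nlinarith
  have h8 : ε * (x ^ 2 / 2) ≤ ε * (2 - 2 * Real.cos (l i)) := mul_le_mul_of_nonneg_left h7 hε.le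
  linarith [sq_nonneg x, pow_nonneg hpos 3]

end Operators

section CoreGroup

open Filter Topology InnerProductSpace NormedSpace

variable {E : Type*} [NormedAddCommGroup E] [InnerProductSpace ℂ E] [FiniteDimensional ℂ E]
  [CompleteSpace E]

/-- A self-adjoint group of operators with complex Lie algebra `L`, with the properties of a
complex reductive group in a unitary frame for its maximal compact subgroup. -/
structure IsCoreGroup (𝒢 : Set (E →L[ℂ] E)) (L : Submodule ℂ (E →L[ℂ] E)) : Prop where
  one_mem : 1 ∈ 𝒢
  mul_mem : ∀ g ∈ 𝒢, ∀ h ∈ 𝒢, g * h ∈ 𝒢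
  inv_mem : ∀ g ∈ 𝒢, ∃ g' ∈ 𝒢, g' * g = 1 ∧ g * g' = 1
  star_mem : ∀ g ∈ 𝒢, star g ∈ 𝒢
  mem_lie : ∀ X, X ∈ L ↔ ∀ t : ℂ, exp (t • X) ∈ 𝒢
  near_one : ∀ ε > 0, ∃ δ > 0, ∀ k ∈ 𝒢, star k * k = 1 → ‖k - 1‖ < δ →
    ∃ X ∈ L, star X = -X ∧ ‖X‖ < ε ∧ exp X = k
  polar : ∀ g ∈ 𝒢, ∃ k ∈ 𝒢, ∃ A ∈ L, star k * k = 1 ∧ star A = A ∧ g = k * exp A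
  closed : IsClosed {k | k ∈ 𝒢 ∧ star k * k = 1}

/-- The vector `v` is critical for the norm on its orbit. -/
def IsCritical (L : Submodule ℂ (E →L[ℂ] E)) (v : E) : Prop :=
  ∀ A ∈ L, ⟪v, A v⟫_ℂ = 0

/-- The tangent space at `v` to its orbit. -/
def orbTan (L : Submodule ℂ (E →L[ℂ] E)) (v : E) : Submodule ℂ E :=
  L.map (ContinuousLinearMap.apply ℂ E v).toLinearMap

theorem mem_orbTan {L : Submodule ℂ (E →L[ℂ] E)} {v x : E} :
    x ∈ orbTan L v ↔ ∃ A ∈ L, A v = x := by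
  simp [orbTan]

theorem norm_apply_of_star_mul_self {k : E →L[ℂ] E} (hk : star k * k = 1) (x : E) :
    ‖k x‖ = ‖x‖ := by
  have h : ⟪k x, k x⟫_ℂ = ⟪x, x⟫_ℂ := by
    rw [← ContinuousLinearMap.adjoint_inner_right, ← ContinuousLinearMap.star_eq_adjoint,
      ← mul_apply_eq_comp, hk, one_apply_eq_self]
  rw [inner_self_eq_norm_sq_to_K, inner_self_eq_norm_sq_to_K] at h
  have h2 : ‖k x‖ ^ 2 = ‖x‖ ^ 2 := by exact_mod_cast h
  exact (pow_left_inj₀ (norm_nonneg _) (norm_nonneg _) two_ne_zero).1 h2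

theorem mul_star_self_of_star_mul_self {k : E →L[ℂ] E} (hk : star k * k = 1) :
    k * star k = 1 := by
  have h := (mul_eq_one_comm (a := ((star k : E →L[ℂ] E) : E →ₗ[ℂ] E))
    (b := (k : E →ₗ[ℂ] E))).1 (by ext x; exact congrArg (fun f : E →L[ℂ] E => f x) hk)
  ext x
  exact congrArg (fun f : E →ₗ[ℂ] E => f x) h

theorem hasDerivAt_exp_smul_apply (A : E →L[ℂ] E) (v : E) :
    HasDerivAt (fun t : ℝ => exp (t • A) v) (A v) 0 := by
  have h1 : HasDerivAt (fun t : ℝ => exp (t • A)) A 0 := by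
    simpa using hasDerivAt_exp_smul_const (𝕂 := ℝ) A (0 : ℝ)
  exact ((ContinuousLinearMap.apply ℂ E v).restrictScalars ℝ).hasFDerivAt.comp_hasDerivAt 0 h1

theorem isCompact_unitaryPart {𝒢 : Set (E →L[ℂ] E)} {L : Submodule ℂ (E →L[ℂ] E)}
    (h : IsCoreGroup 𝒢 L) : IsCompact {k | k ∈ 𝒢 ∧ star k * k = 1} := by
  have : ProperSpace (E →L[ℂ] E) := FiniteDimensional.proper ℂ _
  refine Metric.isCompact_of_isClosed_isBounded h.closed ?_
  refine (Metric.isBounded_closedBall (x := (0 : E →L[ℂ] E)) (r := 1)).subset ?_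
  rintro k ⟨-, hk⟩
  rw [mem_closedBall_zero_iff]
  refine ContinuousLinearMap.opNorm_le_bound _ zero_le_one fun x => ?_
  rw [norm_apply_of_star_mul_self hk, one_mul]

namespace IsCoreGroup

variable {𝒢 : Set (E →L[ℂ] E)} {L : Submodule ℂ (E →L[ℂ] E)}

theorem exp_mem (h : IsCoreGroup 𝒢 L) {X : E →L[ℂ] E} (hX : X ∈ L) : exp X ∈ 𝒢 := by
  simpa using (h.mem_lie X).1 hX 1

theorem star_mem_lie (h : IsCoreGroup 𝒢 L) {X : E →L[ℂ] E} (hX : X ∈ L) : star X ∈ L := by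
  rw [h.mem_lie] at hX ⊢
  intro t
  have h1 := h.star_mem _ (hX (star t))
  rwa [NormedSpace.star_exp, star_smul, star_star] at h1

theorem conj_mem_lie (h : IsCoreGroup 𝒢 L) {X g g' : E →L[ℂ] E} (hX : X ∈ L) (hg : g ∈ 𝒢)
    (hg' : g' ∈ 𝒢) (h1 : g' * g = 1) (h2 : g * g' = 1) : g * X * g' ∈ L := by
  rw [h.mem_lie] at hX ⊢
  intro t
  let : NormedAlgebra ℚ (E →L[ℂ] E) := NormedAlgebra.restrictScalars ℚ ℂ _
  have h3 := NormedSpace.exp_units_conj (⟨g, g', h2, h1⟩ : (E →L[ℂ] E)ˣ) (t • X)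
  simp only [Units.inv_mk] at h3
  have h4 : t • (g * X * g') = g * (t • X) * g' := by
    rw [mul_smul_comm, smul_mul_assoc]
  rw [h4, h3]
  exact h.mul_mem _ (h.mul_mem _ hg _ (hX t)) _ hg'

theorem finrank_orbTan_le (h : IsCoreGroup 𝒢 L) {g : E →L[ℂ] E} (hg : g ∈ 𝒢) (v : E) :
    Module.finrank ℂ (orbTan L (g v)) ≤ Module.finrank ℂ (orbTan L v) := by
  obtain ⟨g', hg', h1, h2⟩ := h.inv_mem g hg
  have h3 : orbTan L (g v) ≤ (orbTan L v).map g.toLinearMap := by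
    intro x hx
    obtain ⟨A, hA, rfl⟩ := mem_orbTan.1 hx
    refine ⟨(g' * A * g) v, mem_orbTan.2 ⟨_, h.conj_mem_lie hA hg' hg h2 h1, rfl⟩, ?_⟩
    change (g * (g' * A * g)) v = (A * g) v
    rw [← mul_assoc, ← mul_assoc, h2, one_mul]
  exact (Submodule.finrank_mono h3).trans (Submodule.finrank_map_le _ _)

theorem finrank_orbTan (h : IsCoreGroup 𝒢 L) {g : E →L[ℂ] E} (hg : g ∈ 𝒢) (v : E) :
    Module.finrank ℂ (orbTan L (g v)) = Module.finrank ℂ (orbTan L v) := by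
  refine le_antisymm (h.finrank_orbTan_le hg v) ?_
  obtain ⟨g', hg', h1, h2⟩ := h.inv_mem g hg
  have h3 := h.finrank_orbTan_le hg' (g v)
  rwa [← mul_apply_eq_comp, h1, one_apply_eq_self] at h3

/-- A skew part plus a self-adjoint part decomposition inside `L`. -/
theorem exists_re_im (h : IsCoreGroup 𝒢 L) {A : E →L[ℂ] E} (hA : A ∈ L) :
    ∃ B ∈ L, ∃ C ∈ L, star B = B ∧ star C = C ∧ A = B + Complex.I • C := by
  refine ⟨(2⁻¹ : ℂ) • (A + star A), L.smul_mem _ (L.add_mem hA (h.star_mem_lie hA)),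
    (-Complex.I * 2⁻¹ : ℂ) • (A - star A), L.smul_mem _ (L.sub_mem hA (h.star_mem_lie hA)),
    ?_, ?_, ?_⟩
  · simp [star_smul, add_comm]
  · simp only [star_smul, star_sub, star_star, ← neg_sub A (star A), smul_neg, ← neg_smul]
    congr 1
    simp
  · rw [smul_smul, ← mul_assoc]
    simp only [mul_neg, Complex.I_mul_I, neg_neg, one_mul]
    rw [← smul_add, add_add_sub_cancel, ← two_smul ℂ, smul_smul]
    norm_num

theorem isCritical_of_selfAdjoint (h : IsCoreGroup 𝒢 L) {v : E}
    (hv : ∀ A ∈ L, star A = A → ⟪v, A v⟫_ℂ = 0) : IsCritical L v := by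
  intro A hA
  obtain ⟨B, hB, C, hC, hBs, hCs, rfl⟩ := h.exists_re_im hA
  rw [add_apply, smul_apply, inner_add_right, inner_smul_right, hv B hB hBs,
    hv C hC hCs, mul_zero, add_zero]

theorem inner_eq_re_of_selfAdjoint {A : E →L[ℂ] E} (hA : star A = A) (v : E) :
    ⟪v, A v⟫_ℂ = (Complex.re ⟪v, A v⟫_ℂ : ℂ) := by
  have h1 : (starRingEnd ℂ) ⟪v, A v⟫_ℂ = ⟪v, A v⟫_ℂ := by
    rw [inner_conj_symm]
    conv_lhs => rw [← hA, ContinuousLinearMap.star_eq_adjoint]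
    rw [ContinuousLinearMap.adjoint_inner_left]
  exact (Complex.conj_eq_iff_re.1 h1).symm

/-- A vector of minimal norm in its orbit is critical. -/
theorem isCritical_of_forall_norm_le (h : IsCoreGroup 𝒢 L) {v : E}
    (hv : ∀ g ∈ 𝒢, ‖v‖ ≤ ‖g v‖) : IsCritical L v := by
  refine h.isCritical_of_selfAdjoint fun A hA hAs => ?_
  have h1 := hasDerivAt_exp_smul_apply A v
  have h2 : HasDerivAt (fun t : ℝ => ‖exp (t • A) v‖ ^ 2) (2 * Complex.re ⟪v, A v⟫_ℂ) 0 := by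
    let : InnerProductSpace ℝ E := InnerProductSpace.rclikeToReal ℂ E
    have := h1.norm_sq
    simpa [real_inner_eq_re_inner ℂ] using this
  have h3 : IsLocalMin (fun t : ℝ => ‖exp (t • A) v‖ ^ 2) 0 := by
    refine Filter.Eventually.of_forall fun t => ?_
    have := hv (exp (t • A)) (by
      have := (h.mem_lie A).1 hA (t : ℂ)
      rwa [Complex.coe_smul] at this)
    simp only [zero_smul, exp_zero, one_apply_eq_self]
    gcongr
  have h4 := h3.hasDerivAt_eq_zero h2
  rw [inner_eq_re_of_selfAdjoint hAs]
  have h5 : Complex.re ⟪v, A v⟫_ℂ = 0 := by linarith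
  rw [h5, Complex.ofReal_zero]

/-- Near a critical vector, the imaginary part of `⟪v, k v⟫` is small compared with
`‖k v - v‖ ^ 2`, uniformly over the unitary part of the group. -/
theorem abs_im_inner_le (h : IsCoreGroup 𝒢 L) {v : E} (hv : IsCritical L v) {ε : ℝ} (hε : 0 < ε) :
    ∃ η > 0, ∀ k ∈ 𝒢, star k * k = 1 → ‖k v - v‖ < η →
      |Complex.im ⟪v, k v⟫_ℂ| ≤ ε * ‖k v - v‖ ^ 2 := by
  obtain ⟨δ, hδ, hX⟩ := abs_im_inner_exp_le (E := E) hε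
  obtain ⟨δ', hδ', hk⟩ := h.near_one δ hδ
  by_contra! hcon
  choose k hkG hku hkv hbad using fun m : ℕ => hcon (1 / ((m : ℝ) + 1)) (by positivity)
  obtain ⟨q, ⟨hqG, hqu⟩, φ, hφ, hlim⟩ := (isCompact_unitaryPart h).tendsto_subseq
    (x := k) fun m => ⟨hkG m, hku m⟩
  have hqq := mul_star_self_of_star_mul_self hqu
  have h1 : Tendsto (fun m => k (φ m) v) atTop (𝓝 (q v)) :=
    ((ContinuousLinearMap.apply ℂ E v).continuous.tendsto q).comp hlim
  have h2 : Tendsto (fun m => k (φ m) v) atTop (𝓝 v) := by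
    rw [tendsto_iff_norm_sub_tendsto_zero]
    exact squeeze_zero (fun _ => norm_nonneg _) (fun m => (hkv (φ m)).le)
      (tendsto_one_div_add_atTop_nhds_zero_nat.comp hφ.tendsto_atTop)
  have hqv : q v = v := tendsto_nhds_unique h1 h2
  have hqv' : star q v = v := by
    conv_lhs => rw [← hqv]
    rw [← mul_apply_eq_comp, hqu, one_apply_eq_self]
  have h3 : Tendsto (fun m => k (φ m) * star q) atTop (𝓝 1) := by
    rw [← hqq]; exact hlim.mul_const _
  rw [tendsto_iff_norm_sub_tendsto_zero] at h3
  obtain ⟨m, hm⟩ := (h3.eventually (gt_mem_nhds hδ')).exists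
  obtain ⟨X, hXL, hXs, hXn, hXe⟩ := hk _ (h.mul_mem _ (hkG (φ m)) _ (h.star_mem _ hqG))
    (by rw [star_mul, star_star, mul_assoc, ← mul_assoc (star (k (φ m))), hku, one_mul, hqq]) hm
  have h4 := hX X v hXs hXn (hv X hXL)
  rw [hXe, mul_apply_eq_comp, hqv'] at h4
  exact absurd h4 (not_le.2 (hbad (φ m)))

end IsCoreGroup

end CoreGroup

section Laplace

open Filter Topology InnerProductSpace MeasureTheory

variable {K : Type*} [TopologicalSpace K] [CompactSpace K] [MeasurableSpace K]
  [BorelSpace K] {μ : Measure K} [IsProbabilityMeasure μ]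

theorem integrable_of_continuous_compactSpace {F : Type*} [NormedAddCommGroup F] {f : K → F}
    (hf : Continuous f) : Integrable f μ :=
  hf.integrable_of_hasCompactSupport (HasCompactSupport.of_compactSpace f)

theorem integral_polynomial_eq {f g : K → ℂ} (hf : Continuous f) (hg : Continuous g)
    (h : ∀ j : ℕ, ∫ k, f k ^ j ∂μ = ∫ k, g k ^ j ∂μ) (p : Polynomial ℂ) :
    ∫ k, p.eval (f k) ∂μ = ∫ k, p.eval (g k) ∂μ := by
  induction p using Polynomial.induction_on' with
  | add p q hp hq =>
    simp only [Polynomial.eval_add]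
    rw [integral_add, integral_add, hp, hq] <;>
      exact integrable_of_continuous_compactSpace (by fun_prop)
  | monomial j c =>
    simp only [Polynomial.eval_monomial]
    rw [integral_const_mul, integral_const_mul, h]

/-- Equality of moments implies equality of integrals of powers of resolvents. -/
theorem integral_resolvent_pow_eq {f g : K → ℂ} (hf : Continuous f) (hg : Continuous g)
    (h : ∀ j : ℕ, ∫ k, f k ^ j ∂μ = ∫ k, g k ^ j ∂μ) {a s : ℝ} (ha : 0 ≤ a) (hs : 0 < s)
    (hfa : ∀ k, ‖f k‖ ≤ a) (hga : ∀ k, ‖g k‖ ≤ a) (D : ℕ) :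
    ∫ k, ((a + s - f k : ℂ)⁻¹) ^ D ∂μ = ∫ k, ((a + s - g k : ℂ)⁻¹) ^ D ∂μ := by
  set c : ℂ := ((a + s : ℝ) : ℂ) with hc
  have hapos : 0 < a + s := by linarith
  have hc0 : c ≠ 0 := by rw [hc]; exact_mod_cast hapos.ne'
  have hcn : ‖c‖ = a + s := by rw [hc, Complex.norm_real, Real.norm_of_nonneg hapos.le]
  let P : ℕ → Polynomial ℂ := fun N =>
    (Polynomial.C c⁻¹ * ∑ j ∈ Finset.range N, (Polynomial.C c⁻¹ * Polynomial.X) ^ j) ^ D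
  have hPe : ∀ N z, (P N).eval z = (c⁻¹ * ∑ j ∈ Finset.range N, (c⁻¹ * z) ^ j) ^ D := by
    intro N z
    simp [P, Polynomial.eval_finsetSum]
  have hq : a / (a + s) < 1 := (div_lt_one hapos).2 (by linarith)
  have hq0 : 0 ≤ a / (a + s) := by positivity
  have hzn : ∀ z : ℂ, ‖z‖ ≤ a → ‖c⁻¹ * z‖ ≤ a / (a + s) := by
    intro z hz
    rw [norm_mul, norm_inv, hcn, div_eq_inv_mul]
    gcongr
  have key : ∀ φ : K → ℂ, Continuous φ → (∀ k, ‖φ k‖ ≤ a) →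
      Tendsto (fun N => ∫ k, (P N).eval (φ k) ∂μ) atTop
        (𝓝 (∫ k, ((a + s - φ k : ℂ)⁻¹) ^ D ∂μ)) := by
    intro φ hφ hφa
    refine tendsto_integral_of_dominated_convergence
      (fun _ => ((a + s)⁻¹ * (1 - a / (a + s))⁻¹) ^ D) ?_ (integrable_const _) ?_ ?_
    · intro N
      exact (integrable_of_continuous_compactSpace (by fun_prop)).aestronglyMeasurable
    · intro N
      refine Filter.Eventually.of_forall fun k => ?_
      rw [hPe, norm_pow, norm_mul, norm_inv, hcn]
      gcongr
      refine (norm_sum_le _ _).trans ?_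
      refine (Finset.sum_le_sum fun j _ => ?_ : _ ≤ ∑ j ∈ Finset.range N, (a / (a + s)) ^ j).trans ?_
      · rw [norm_pow]
        exact pow_le_pow_left₀ (norm_nonneg _) (hzn _ (hφa k)) _
      · rw [← tsum_geometric_of_lt_one hq0 hq]
        exact (summable_geometric_of_lt_one hq0 hq).sum_le_tsum _ fun i _ => pow_nonneg hq0 i
    · refine Filter.Eventually.of_forall fun k => ?_
      simp only [hPe]
      have h1 : Tendsto (fun N => ∑ j ∈ Finset.range N, (c⁻¹ * φ k) ^ j) atTop
          (𝓝 (1 - c⁻¹ * φ k)⁻¹) :=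
        (hasSum_geometric_of_norm_lt_one ((hzn _ (hφa k)).trans_lt hq)).tendsto_sum_nat
      have h2 : (a + s - φ k : ℂ)⁻¹ = c⁻¹ * (1 - c⁻¹ * φ k)⁻¹ := by
        rw [← mul_inv, mul_sub, mul_one, mul_inv_cancel_left₀ hc0, hc]
        push_cast
        rfl
      rw [h2]
      exact (h1.const_mul _).pow D
  refine tendsto_nhds_unique (key f hf hfa) ((key g hg hga).congr fun N => ?_)
  exact (integral_polynomial_eq hf hg h (P N)).symm

variable [Group K] [μ.IsMulLeftInvariant] [ContinuousMul K]
variable {E : Type*} [NormedAddCommGroup E] [InnerProductSpace ℂ E] [FiniteDimensional ℂ E]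
  [CompleteSpace E]

/-- Doubling property of the return-time sets of an isometric representation. -/
theorem exists_measure_le_mul (ρ : K →* (E →L[ℂ] E)) (hiso : ∀ k x, ‖ρ k x‖ = ‖x‖) (v : E) :
    ∃ N : ℕ, 0 < N ∧ ∀ t > 0, μ.real {k | ‖ρ k v - v‖ < t} ≤ N * μ.real {k | ‖ρ k v - v‖ < t / 2} := by
  have : ProperSpace E := FiniteDimensional.proper ℂ E
  obtain ⟨T, -, hT, hcov⟩ := (isCompact_closedBall (0 : E) 1).finite_cover_balls
    (e := 1 / 4) (by norm_num)
  lift T to Finset E using hT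
  refine ⟨T.card + 1, by omega, fun t ht => ?_⟩
  have hsub : {k | ‖ρ k v - v‖ < t} ⊆ ⋃ c ∈ T, {k | ‖ρ k v - (v + (t : ℂ) • c)‖ < t / 4} := by
    intro k hk
    have h1 : ((t : ℂ)⁻¹ • (ρ k v - v)) ∈ Metric.closedBall (0 : E) 1 := by
      rw [mem_closedBall_zero_iff, norm_smul, norm_inv, Complex.norm_real, Real.norm_of_nonneg ht.le,
        inv_mul_le_iff₀ ht, mul_one]
      exact le_of_lt hk
    obtain ⟨c, hc, hc2⟩ := Set.mem_iUnion₂.1 (hcov h1)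
    refine Set.mem_iUnion₂.2 ⟨c, hc, ?_⟩
    have ht0 : (t : ℂ) ≠ 0 := by exact_mod_cast ht.ne'
    have h2 : ρ k v - (v + (t : ℂ) • c) = (t : ℂ) • ((t : ℂ)⁻¹ • (ρ k v - v) - c) := by
      rw [smul_sub, smul_inv_smul₀ ht0]; abel
    rw [Metric.mem_ball, dist_eq_norm] at hc2
    rw [Set.mem_ofPred_eq, h2, norm_smul, Complex.norm_real, Real.norm_of_nonneg ht.le]
    nlinarith
  have hone : ∀ c : E, μ.real {k | ‖ρ k v - (v + (t : ℂ) • c)‖ < t / 4} ≤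
      μ.real {k | ‖ρ k v - v‖ < t / 2} := by
    intro c
    by_cases hne : {k | ‖ρ k v - (v + (t : ℂ) • c)‖ < t / 4}.Nonempty
    · obtain ⟨k0, hk0⟩ := hne
      have h1 : μ.real ((fun k => k0⁻¹ * k) ⁻¹' {k | ‖ρ k v - v‖ < t / 2}) =
          μ.real {k | ‖ρ k v - v‖ < t / 2} := by
        rw [measureReal_def, measureReal_def, measure_preimage_mul]
      rw [← h1]
      refine measureReal_mono fun k hk => ?_
      have h2 : ρ k0 (ρ (k0⁻¹ * k) v - v) = ρ k v - ρ k0 v := by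
        rw [map_sub, ← mul_apply_eq_comp, ← map_mul, mul_inv_cancel_left]
      rw [Set.mem_preimage, Set.mem_ofPred_eq, ← hiso k0, h2]
      have h3 := norm_sub_le_norm_sub_add_norm_sub (ρ k v) (v + (t : ℂ) • c) (ρ k0 v)
      rw [norm_sub_rev (v + (t : ℂ) • c)] at h3
      simp only [Set.mem_ofPred_eq] at hk hk0
      linarith
    · rw [Set.not_nonempty_iff_eq_empty.1 hne]
      simp
  calc μ.real {k | ‖ρ k v - v‖ < t}
      ≤ μ.real (⋃ c ∈ T, {k | ‖ρ k v - (v + (t : ℂ) • c)‖ < t / 4}) := measureReal_mono hsub (measure_ne_top _ _)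
    _ ≤ ∑ c ∈ T, μ.real {k | ‖ρ k v - (v + (t : ℂ) • c)‖ < t / 4} :=
        measureReal_biUnion_finset_le _ _
    _ ≤ ∑ c ∈ T, μ.real {k | ‖ρ k v - v‖ < t / 2} := Finset.sum_le_sum fun c _ => hone c
    _ = T.card * μ.real {k | ‖ρ k v - v‖ < t / 2} := by rw [Finset.sum_const, nsmul_eq_mul]
    _ ≤ (T.card + 1 : ℕ) * μ.real {k | ‖ρ k v - v‖ < t / 2} := by
        gcongr
        omega

theorem exists_inv_pow_le_measure (ρ : K →* (E →L[ℂ] E)) (hiso : ∀ k x, ‖ρ k x‖ = ‖x‖) (v : E) :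
    ∃ N : ℕ, 0 < N ∧ ∀ η > 0, ∃ c > 0, ∀ j : ℕ,
      c ≤ (N : ℝ) ^ j * μ.real {k | ‖ρ k v - v‖ < η / 2 ^ j} := by
  obtain ⟨N, hN, hdouble⟩ := exists_measure_le_mul (μ := μ) ρ hiso v
  have hiter : ∀ (j : ℕ) (t : ℝ), 0 < t → μ.real {k | ‖ρ k v - v‖ < t} ≤
      (N : ℝ) ^ j * μ.real {k | ‖ρ k v - v‖ < t / 2 ^ j} := by
    intro j
    induction j with
    | zero => intro t _; simp
    | succ j ih =>
      intro t ht
      refine (ih t ht).trans ?_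
      rw [pow_succ, mul_assoc, pow_succ, ← div_div]
      gcongr
      exact hdouble _ (by positivity)
  refine ⟨N, hN, fun η hη => ?_⟩
  obtain ⟨m, hm⟩ := pow_unbounded_of_one_lt (2 * ‖v‖ / η) (one_lt_two : (1 : ℝ) < 2)
  have hN' : (0 : ℝ) < N := by exact_mod_cast hN
  refine ⟨((N : ℝ) ^ m)⁻¹, by positivity, fun j => ?_⟩
  have h1 := hiter (m + j) (η * 2 ^ m) (by positivity)
  have h2 : {k | ‖ρ k v - v‖ < η * 2 ^ m} = Set.univ := by
    refine Set.eq_univ_of_forall fun k => ?_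
    have h3 := norm_sub_le (ρ k v) v
    rw [hiso] at h3
    rw [div_lt_iff₀ hη] at hm
    rw [Set.mem_ofPred_eq]
    linarith
  have h4 : η * 2 ^ m / 2 ^ (m + j) = η / 2 ^ j := by
    rw [pow_add]; field_simp
  rw [h2, probReal_univ, h4, pow_add, mul_assoc] at h1
  rwa [inv_le_iff_one_le_mul₀' (by positivity)]

/-- If the matrix coefficients `⟪v, ρ k v⟫` and `⟪v, ρ k w⟫` have the same moments, and the
imaginary part of the first is small near its maximum, then `v` lies in the orbit of `w`. -/
theorem exists_apply_eq_of_moments (ρ : K →* (E →L[ℂ] E)) (hρ : Continuous ρ)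
    (hiso : ∀ k x, ‖ρ k x‖ = ‖x‖) {v w : E}
    (him : ∀ ε > 0, ∃ η > 0, ∀ k, ‖ρ k v - v‖ < η →
      |Complex.im ⟪v, ρ k v⟫_ℂ| ≤ ε * ‖ρ k v - v‖ ^ 2)
    (hwv : ‖w‖ ≤ ‖v‖)
    (hmom : ∀ j : ℕ, ∫ k, ⟪v, ρ k v⟫_ℂ ^ j ∂μ = ∫ k, ⟪v, ρ k w⟫_ℂ ^ j ∂μ) :
    ∃ k, ρ k w = v := by
  by_contra! hno
  have hcx : ∀ x : E, Continuous fun k => ρ k x := fun x =>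
    (ContinuousLinearMap.apply ℂ E x).continuous.comp hρ
  obtain ⟨k0, -, hk0⟩ := isCompact_univ.exists_isMinOn (s := (Set.univ : Set K))
    ⟨1, Set.mem_univ _⟩ (f := fun k => ‖ρ k w - v‖) ((hcx w).sub continuous_const).norm.continuousOn
  set m := ‖ρ k0 w - v‖ with hm
  have hmpos : 0 < m := norm_pos_iff.2 (sub_ne_zero.2 (hno k0))
  have hmin : ∀ k, m ≤ ‖ρ k w - v‖ := fun k => hk0 (Set.mem_univ k)
  set δ := m ^ 2 / 2 with hδ
  have hδpos : 0 < δ := by positivity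
  have hre : ∀ x y : E, ‖x - y‖ ^ 2 = ‖x‖ ^ 2 + ‖y‖ ^ 2 - 2 * Complex.re ⟪y, x⟫_ℂ := by
    intro x y
    have h := norm_sub_sq (𝕜 := ℂ) y x
    rw [norm_sub_rev, h]
    simp only [RCLike.re_eq_complex_re]
    ring
  obtain ⟨N, hN, hmass⟩ := exists_inv_pow_le_measure (μ := μ) ρ hiso v
  have hN' : (0 : ℝ) < N := by exact_mod_cast hN
  set D := N with hD
  have hND : (N : ℝ) < 4 ^ D := by exact_mod_cast Nat.lt_pow_self (by norm_num : 1 < 4)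
  obtain ⟨τ₀, hτ₀, hτ⟩ : ∃ τ₀ > 0, ∀ τ : ℝ, |τ| ≤ τ₀ →
      1 / 2 ≤ Complex.re (((1 - τ * Complex.I : ℂ)⁻¹) ^ D) := by
    have h1 : ContinuousAt (fun τ : ℝ => Complex.re (((1 - τ * Complex.I : ℂ)⁻¹) ^ D)) 0 := by
      refine Complex.continuous_re.continuousAt.comp (ContinuousAt.pow (ContinuousAt.inv₀ ?_ ?_) D)
      · fun_prop
      · simp
    have h2 : ∀ᶠ τ : ℝ in 𝓝 0, 1 / 2 < Complex.re (((1 - τ * Complex.I : ℂ)⁻¹) ^ D) := by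
      refine h1.eventually (lt_mem_nhds ?_)
      norm_num
    obtain ⟨r, hr, h3⟩ := Metric.eventually_nhds_iff.1 h2
    refine ⟨r / 2, by positivity, fun τ hτ => (h3 ?_).le⟩
    rw [Real.dist_eq, sub_zero]
    linarith
  obtain ⟨η, hη, hηim⟩ := him (τ₀ / 2) (by positivity)
  obtain ⟨c, hc, hcj⟩ := hmass η hη
  have hbound : ∀ s : ℝ, 0 < s → ∫ k, Complex.re (((‖v‖ ^ 2 : ℝ) + s - ⟪v, ρ k v⟫_ℂ : ℂ)⁻¹ ^ D) ∂μ ≤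
      δ⁻¹ ^ D := by
    intro s hs
    have hz : ∀ x : E, ‖x‖ ≤ ‖v‖ → ∀ k, ‖⟪v, ρ k x⟫_ℂ‖ ≤ ‖v‖ ^ 2 := by
      intro x hx k
      refine (norm_inner_le_norm _ _).trans ?_
      rw [hiso, sq]
      gcongr
    have h1 := integral_resolvent_pow_eq (μ := μ) (continuous_const.inner (𝕜 := ℂ) (hcx v))
      (continuous_const.inner (𝕜 := ℂ) (hcx w)) hmom (sq_nonneg ‖v‖) hs (hz v le_rfl) (hz w hwv) D
    have hne : ∀ k, ((‖v‖ ^ 2 : ℝ) + s - ⟪v, ρ k v⟫_ℂ : ℂ) ≠ 0 := by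
      intro k h0
      have h2 := hre (ρ k v) v
      rw [hiso] at h2
      have h3 := congrArg Complex.re h0
      rw [Complex.sub_re, Complex.add_re, Complex.ofReal_re, Complex.ofReal_re, Complex.zero_re] at h3
      nlinarith [sq_nonneg ‖ρ k v - v‖]
    have hint : Integrable (fun k => ((‖v‖ ^ 2 : ℝ) + s - ⟪v, ρ k v⟫_ℂ : ℂ)⁻¹ ^ D) μ := by
      refine integrable_of_continuous_compactSpace (Continuous.pow (Continuous.inv₀ ?_ hne) D)
      exact continuous_const.sub (continuous_const.inner (hcx v))
    have h4 := integral_re hint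
    simp only [RCLike.re_eq_complex_re] at h4
    rw [h4, h1]
    refine (Complex.re_le_norm _).trans ?_
    have h5 := norm_integral_le_of_norm_le_const (μ := μ) (C := δ⁻¹ ^ D)
      (f := fun k => ((‖v‖ ^ 2 : ℝ) + s - ⟪v, ρ k w⟫_ℂ : ℂ)⁻¹ ^ D)
      (Filter.Eventually.of_forall fun k => ?_)
    · simpa using h5
    · rw [norm_pow, norm_inv]
      gcongr
      refine le_trans ?_ (Complex.re_le_norm _)
      rw [Complex.sub_re, Complex.add_re, Complex.ofReal_re, Complex.ofReal_re]
      have h2 := hre (ρ k w) v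
      rw [hiso] at h2
      have h6 : m ^ 2 ≤ ‖ρ k w - v‖ ^ 2 := by
        gcongr; exact hmin k
      have h7 : ‖w‖ ^ 2 ≤ ‖v‖ ^ 2 := by gcongr
      rw [hδ]
      linarith
  set C := (η ^ 2 / 2)⁻¹ ^ D with hC
  have hCpos : 0 < C := by positivity
  have hj : ∀ j : ℕ, c * (4 ^ D / N) ^ j ≤ 2 * (δ⁻¹ ^ D + C) * (η ^ 2) ^ D := by
    intro j
    set s := η ^ 2 / 4 ^ j / 2 with hs
    have hspos : 0 < s := by positivity
    set S := {k | ‖ρ k v - v‖ < η / 2 ^ j} with hS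
    have hSm : MeasurableSet S :=
      (isOpen_lt ((hcx v).sub continuous_const).norm continuous_const).measurableSet
    have hpt : ∀ k, S.indicator (fun _ => 1 / 2 * (2 * s)⁻¹ ^ D) k - C ≤
        Complex.re (((‖v‖ ^ 2 : ℝ) + s - ⟪v, ρ k v⟫_ℂ : ℂ)⁻¹ ^ D) := by
      intro k
      set r := ‖ρ k v - v‖ ^ 2 / 2 with hr
      have hr0 : 0 ≤ r := by positivity
      have hrs : 0 < r + s := by positivity
      have h2 := hre (ρ k v) v
      rw [hiso] at h2
      set y := Complex.im ⟪v, ρ k v⟫_ℂ with hy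
      have hu : ((‖v‖ ^ 2 : ℝ) + s - ⟪v, ρ k v⟫_ℂ : ℂ) = ((r + s : ℝ) : ℂ) - y * Complex.I := by
        apply Complex.ext
        · simp only [Complex.sub_re, Complex.add_re, Complex.ofReal_re, Complex.re_ofReal_mul,
            Complex.I_re, mul_zero, sub_zero]
          linarith
        · simp only [Complex.sub_im, Complex.add_im, Complex.ofReal_im, Complex.im_ofReal_mul,
            Complex.I_im, mul_one, add_zero, hy]
      rw [hu]
      by_cases hk : ‖ρ k v - v‖ < η
      · have h3 : |y| ≤ τ₀ * r := by
          have := hηim k hk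
          rw [hr]; linarith
        have h4 : ((r + s : ℝ) : ℂ) - y * Complex.I =
            ((r + s : ℝ) : ℂ) * (1 - (y / (r + s) : ℝ) * Complex.I) := by
          have : ((r + s : ℝ) : ℂ) ≠ 0 := by exact_mod_cast hrs.ne'
          rw [mul_sub, mul_one, ← mul_assoc, ← Complex.ofReal_mul, mul_div_cancel₀ _ hrs.ne']
        have h5 : 1 / 2 ≤ Complex.re (((1 - (y / (r + s) : ℝ) * Complex.I : ℂ)⁻¹) ^ D) := by
          apply hτ
          rw [abs_div, abs_of_pos hrs, div_le_iff₀ hrs]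
          nlinarith
        have h6 : Complex.re ((((r + s : ℝ) : ℂ) - y * Complex.I)⁻¹ ^ D) =
            (r + s)⁻¹ ^ D * Complex.re (((1 - (y / (r + s) : ℝ) * Complex.I : ℂ)⁻¹) ^ D) := by
          rw [h4, mul_inv, mul_pow, ← Complex.ofReal_inv, ← Complex.ofReal_pow, Complex.re_ofReal_mul]
        rw [h6]
        have h7 : 0 < (r + s)⁻¹ ^ D := by positivity
        by_cases hkS : k ∈ S
        · rw [Set.indicator_of_mem hkS]
          have h8 : r ≤ s := by
            rw [hr, hs]
            have : ‖ρ k v - v‖ ^ 2 ≤ (η / 2 ^ j) ^ 2 := by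
              gcongr; exact le_of_lt hkS
            rw [div_pow, ← pow_mul, mul_comm j, pow_mul] at this
            norm_num at this
            linarith
          have h9 : (2 * s)⁻¹ ^ D ≤ (r + s)⁻¹ ^ D := by
            gcongr; linarith
          nlinarith
        · rw [Set.indicator_of_notMem hkS]
          nlinarith
      · have hkS : k ∉ S := by
          intro hkS
          refine hk (lt_of_lt_of_le hkS ?_)
          exact div_le_self hη.le (one_le_pow₀ one_le_two)
        rw [Set.indicator_of_notMem hkS, zero_sub]
        refine le_trans (neg_le_neg ?_) (Complex.abs_re_le_norm _ |> abs_le.1 |>.1)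
        rw [norm_pow, norm_inv, hC]
        gcongr
        refine le_trans ?_ (Complex.re_le_norm _)
        simp only [Complex.sub_re, Complex.ofReal_re, Complex.re_ofReal_mul,
            Complex.I_re, mul_zero, sub_zero]
        have : η ^ 2 ≤ ‖ρ k v - v‖ ^ 2 := by
          gcongr; exact not_lt.1 hk
        rw [hr]
        linarith
    have hne : ∀ k, ((‖v‖ ^ 2 : ℝ) + s - ⟪v, ρ k v⟫_ℂ : ℂ) ≠ 0 := by
      intro k h0
      have h2 := hre (ρ k v) v
      rw [hiso] at h2
      have h3 := congrArg Complex.re h0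
      rw [Complex.sub_re, Complex.add_re, Complex.ofReal_re, Complex.ofReal_re, Complex.zero_re] at h3
      nlinarith [sq_nonneg ‖ρ k v - v‖]
    have hint : Integrable (fun k => Complex.re (((‖v‖ ^ 2 : ℝ) + s - ⟪v, ρ k v⟫_ℂ : ℂ)⁻¹ ^ D)) μ := by
      refine integrable_of_continuous_compactSpace
        (Complex.continuous_re.comp (Continuous.pow (Continuous.inv₀ ?_ hne) D))
      exact continuous_const.sub (continuous_const.inner (hcx v))
    have h3 := integral_mono (μ := μ) (((integrable_const _).indicator hSm).sub (integrable_const C))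
      hint hpt
    have h4 := h3.trans (hbound s hspos)
    simp only [Pi.sub_apply] at h4
    rw [integral_sub ((integrable_const _).indicator hSm) (integrable_const C),
      integral_indicator hSm, setIntegral_const, integral_const, probReal_univ, one_smul,
      smul_eq_mul] at h4
    have h5 := hcj j
    have h6 : c / N ^ j ≤ μ.real S := by
      rw [div_le_iff₀ (by positivity), mul_comm]; exact h5
    have h7 : (2 * s)⁻¹ ^ D = (4 ^ D) ^ j / (η ^ 2) ^ D := by
      have : (2 * s)⁻¹ = 4 ^ j / η ^ 2 := by
        rw [hs]; field_simp
      rw [this, div_pow, ← pow_mul, ← pow_mul 4 D, mul_comm j]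
    have h8 : c / N ^ j * (2 * s)⁻¹ ^ D ≤ 2 * (δ⁻¹ ^ D + C) := by
      have : c / N ^ j * (2 * s)⁻¹ ^ D ≤ μ.real S * (2 * s)⁻¹ ^ D := by gcongr
      linarith
    rw [h7] at h8
    have h9 : c / N ^ j * ((4 ^ D) ^ j / (η ^ 2) ^ D) = c * (4 ^ D / N) ^ j / (η ^ 2) ^ D := by
      rw [div_pow]; field_simp
    rw [h9, div_le_iff₀ (by positivity)] at h8
    exact h8
  obtain ⟨j, hjj⟩ := pow_unbounded_of_one_lt (2 * (δ⁻¹ ^ D + C) * (η ^ 2) ^ D / c)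
    ((one_lt_div hN').2 hND)
  rw [div_lt_iff₀ hc] at hjj
  linarith [hj j]

end Laplace

section SliceToOrbit

open Filter Topology InnerProductSpace NormedSpace

variable {E : Type*} [NormedAddCommGroup E] [InnerProductSpace ℂ E] [FiniteDimensional ℂ E]
  [CompleteSpace E]

/-- Strict derivative of `(t, y) ↦ exp (M t) y` at `(0, v)`. -/
theorem hasStrictFDerivAt_exp_apply {V : Type*} [NormedAddCommGroup V] [NormedSpace ℝ V]
    (M : V →L[ℝ] (E →L[ℂ] E)) (v : E) :
    HasStrictFDerivAt (fun p : V × E => exp (M p.1) p.2)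
      ((((ContinuousLinearMap.apply ℂ E v).restrictScalars ℝ).comp M).comp
        (ContinuousLinearMap.fst ℝ V E) + ContinuousLinearMap.snd ℝ V E) (0, v) := by
  have h1 : HasStrictFDerivAt (fun p : V × E => exp (M p.1))
      (M.comp (ContinuousLinearMap.fst ℝ V E)) (0, v) := by
    have h2 : HasStrictFDerivAt (exp : (E →L[ℂ] E) → (E →L[ℂ] E))
        (1 : (E →L[ℂ] E) →L[ℝ] (E →L[ℂ] E)) (M ((0 : V), v).1) := by
      simpa using hasStrictFDerivAt_exp_zero (𝕂 := ℝ) (𝔸 := E →L[ℂ] E)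
    exact h2.comp (0, v) (M.comp (ContinuousLinearMap.fst ℝ V E)).hasStrictFDerivAt
  have h3 := ((ContinuousLinearMap.restrictScalarsL ℂ E E ℝ ℝ).hasStrictFDerivAt.comp _ h1).clm_apply
    (ContinuousLinearMap.snd ℝ V E).hasStrictFDerivAt
  refine h3.congr_fderiv ?_
  ext p <;> simp

namespace IsCoreGroup

variable {𝒢 : Set (E →L[ℂ] E)} {L : Submodule ℂ (E →L[ℂ] E)}

/-- The vector `v` is in the closure of every orbit in its fiber. -/
theorem mem_closure_orbit (h : IsCoreGroup 𝒢 L) {v : E} {F : Set E} (hFc : IsClosed F)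
    (hFs : ∀ g ∈ 𝒢, ∀ u ∈ F, g u ∈ F) (hFk : ∀ w ∈ F, IsCritical L w → ∃ k ∈ 𝒢, k w = v)
    {u : E} (hu : u ∈ F) : v ∈ closure ((fun g : E →L[ℂ] E => g u) '' 𝒢) := by
  have : ProperSpace E := FiniteDimensional.proper ℂ E
  set O := (fun g : E →L[ℂ] E => g u) '' 𝒢 with hO
  have hstab : ∀ g ∈ 𝒢, ∀ x ∈ closure O, g x ∈ closure O := by
    intro g hg x hx
    refine closure_mono ?_ (image_closure_subset_closure_image g.continuous ⟨x, hx, rfl⟩)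
    rintro _ ⟨_, ⟨k, hk, rfl⟩, rfl⟩
    exact ⟨g * k, h.mul_mem _ hg _ hk, rfl⟩
  obtain ⟨w, hw, hwmin⟩ := isClosed_closure.exists_infDist_eq_dist
    (⟨u, subset_closure ⟨1, h.one_mem, rfl⟩⟩ : (closure O).Nonempty) (0 : E)
  have hcrit : IsCritical L w := by
    refine h.isCritical_of_forall_norm_le fun g hg => ?_
    have := Metric.infDist_le_dist_of_mem (x := (0 : E)) (hstab g hg w hw)
    rwa [hwmin, dist_zero_left, dist_zero_left] at this
  have hOF : closure O ⊆ F := by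
    refine closure_minimal ?_ hFc
    rintro _ ⟨g, hg, rfl⟩
    exact hFs g hg u hu
  obtain ⟨k, hk, rfl⟩ := hFk w (hOF hw) hcrit
  exact hstab k hk w hw

/-- If the isotropy algebra acts trivially on a complement of the tangent space, orbit dimensions
do not jump near `v`. -/
theorem eventually_finrank_orbTan_le (h : IsCoreGroup 𝒢 L) {v : E} {N : Submodule ℂ E}
    (hN : orbTan L v ⊔ N = ⊤) (hN0 : ∀ A ∈ L, A v = 0 → ∀ x ∈ N, A x = 0) :
    ∀ᶠ y in 𝓝 v, Module.finrank ℂ (orbTan L y) ≤ Module.finrank ℂ (orbTan L v) := by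
  have : CompleteSpace L := FiniteDimensional.complete ℂ L
  have : CompleteSpace N := FiniteDimensional.complete ℂ N
  let M : L →L[ℝ] (E →L[ℂ] E) := L.subtypeL.restrictScalars ℝ
  have h1 := hasStrictFDerivAt_exp_apply M v
  have h2 : HasStrictFDerivAt (fun p : L × N => ((p.1, v + (p.2 : E)) : L × E))
      ((ContinuousLinearMap.fst ℝ L N).prod
        ((N.subtypeL.restrictScalars ℝ).comp (ContinuousLinearMap.snd ℝ L N))) (0, 0) :=
    (ContinuousLinearMap.fst ℝ L N).hasStrictFDerivAt.prodMk
      (((N.subtypeL.restrictScalars ℝ).comp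
        (ContinuousLinearMap.snd ℝ L N)).hasStrictFDerivAt.const_add v)
  have h3 : HasStrictFDerivAt (fun p : L × N => exp (p.1 : E →L[ℂ] E) (v + p.2)) _ (0, 0) :=
    HasStrictFDerivAt.comp (0, 0) (g := fun p : L × E => exp (M p.1) p.2) (by simpa using h1) h2
  have h4 := h3.map_nhds_eq_of_surj (by
    rw [LinearMap.range_eq_top]
    intro y
    have hy : y ∈ orbTan L v ⊔ N := hN ▸ Submodule.mem_top
    obtain ⟨a, ha, b, hb, rfl⟩ := Submodule.mem_sup.1 hy
    obtain ⟨A, hA, rfl⟩ := mem_orbTan.1 ha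
    exact ⟨(⟨A, hA⟩, ⟨b, hb⟩), by simp [M]⟩)
  simp only [ZeroMemClass.coe_zero, exp_zero, add_zero, one_apply_eq_self] at h4
  rw [← h4, Filter.eventually_map]
  refine Filter.Eventually.of_forall fun p => ?_
  rw [h.finrank_orbTan (h.exp_mem p.1.2)]
  let e : E → (L →ₗ[ℂ] E) := fun x =>
    (ContinuousLinearMap.apply ℂ E x).toLinearMap.comp L.subtype
  have he : ∀ x, (e x).range = orbTan L x := by
    intro x
    rw [LinearMap.range_comp, Submodule.range_subtype]
    rfl
  have hker : (e v).ker ≤ (e (v + p.2)).ker := by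
    intro A hA
    rw [LinearMap.mem_ker] at hA ⊢
    have hA' : (A : E →L[ℂ] E) v = 0 := hA
    change (A : E →L[ℂ] E) (v + p.2) = 0
    rw [map_add, hA', hN0 A A.2 hA' _ p.2.2, add_zero]
  have h5 := (e v).finrank_range_add_finrank_ker
  have h6 := (e (v + p.2)).finrank_range_add_finrank_ker
  have h7 := Submodule.finrank_mono hker
  rw [he] at h5 h6
  omega

/-- The self-adjoint part of `L`, as a real subspace. -/
def selfAdjointPart (L : Submodule ℂ (E →L[ℂ] E)) : Submodule ℝ (E →L[ℂ] E) where
  carrier := {A | A ∈ L ∧ star A = A}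
  add_mem' := fun ha hb => ⟨L.add_mem ha.1 hb.1, by rw [star_add, ha.2, hb.2]⟩
  zero_mem' := ⟨L.zero_mem, star_zero _⟩
  smul_mem' := fun c A hA => ⟨by
    have := L.smul_mem (c : ℂ) hA.1
    rwa [Complex.coe_smul] at this, by
    rw [star_smul, hA.2, star_trivial]⟩

/-- A vector whose isotropy algebra acts trivially on a complement to the tangent space has
orbit equal to its whole fiber. -/
theorem mem_orbit_of_trivial_slice (h : IsCoreGroup 𝒢 L) {v : E} (hv : IsCritical L v)
    {N : Submodule ℂ E} (hN : orbTan L v ⊔ N = ⊤)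
    (hN0 : ∀ A ∈ L, A v = 0 → ∀ x ∈ N, A x = 0) {F : Set E} (hFc : IsClosed F)
    (hFs : ∀ g ∈ 𝒢, ∀ u ∈ F, g u ∈ F) (hFk : ∀ w ∈ F, IsCritical L w → ∃ k ∈ 𝒢, k w = v)
    {u : E} (hu : u ∈ F) : ∃ g ∈ 𝒢, g v = u := by
  let ev : (E →L[ℂ] E) →ₗ[ℝ] E := ((ContinuousLinearMap.apply ℂ E v).restrictScalars ℝ).toLinearMap
  have : FiniteDimensional ℝ E := FiniteDimensional.complexToReal E
  set W := (selfAdjointPart L).map ev with hW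
  let m := Module.finrank ℝ W
  let b : Module.Basis (Fin m) ℝ W := Module.finBasis ℝ W
  have hbA : ∀ i, ∃ A ∈ selfAdjointPart L, A v = (b i : E) := fun i => (b i).2
  choose A hAp hAb using hbA
  have hAL : ∀ i, A i ∈ L := fun i => (hAp i).1
  have hAs : ∀ i, star (A i) = A i := fun i => (hAp i).2
  have hspan : Submodule.span ℂ (Set.range fun i => A i v) = orbTan L v := by
    refine le_antisymm (Submodule.span_le.2 ?_) ?_
    · rintro _ ⟨i, rfl⟩
      exact mem_orbTan.2 ⟨A i, hAL i, rfl⟩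
    · intro x hx
      have hsa : ∀ B ∈ L, star B = B → B v ∈ Submodule.span ℂ (Set.range fun i => A i v) := by
        intro B hB hBs
        have hBW : B v ∈ W := ⟨B, ⟨hB, hBs⟩, rfl⟩
        have h1 := congrArg (Subtype.val) (b.sum_repr ⟨B v, hBW⟩)
        rw [← show _ = B v from h1, AddSubmonoidClass.coe_finsetSum]
        refine Submodule.sum_mem _ fun i _ => ?_
        rw [Submodule.coe_smul, ← hAb, ← Complex.coe_smul]
        exact Submodule.smul_mem _ _ (Submodule.subset_span ⟨i, rfl⟩)
      obtain ⟨X, hX, rfl⟩ := mem_orbTan.1 hx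
      obtain ⟨B, hB, C, hC, hBs, hCs, rfl⟩ := h.exists_re_im hX
      rw [add_apply, smul_apply]
      exact Submodule.add_mem _ (hsa B hB hBs) (Submodule.smul_mem _ _ (hsa C hC hCs))
  obtain ⟨f, hf, -, hfi⟩ := Submodule.exists_fun_fin_finrank_span_eq ℂ (Set.range fun i => A i v)
  choose σ hσ using hf
  -- vectors near `v` that are critical for the `A i` are critical
  have hev : ∀ᶠ w in 𝓝 v, (∀ i, Complex.re ⟪w, A i w⟫_ℂ = 0) → IsCritical L w := by
    have h1 : ∀ᶠ w in 𝓝 v, LinearIndependent ℂ fun j => A (σ j) w := by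
      have hc : Continuous fun w : E => fun j => A (σ j) w := by fun_prop
      refine hc.continuousAt.eventually (isOpen_setOfPred_linearIndependent.mem_nhds ?_)
      have : (fun j => A (σ j) v) = f := funext hσ
      change LinearIndependent ℂ fun j => A (σ j) v
      rw [this]
      exact hfi
    filter_upwards [h1, h.eventually_finrank_orbTan_le hN hN0] with w hw1 hw2 hw3
    have hle : Submodule.span ℂ (Set.range fun j => A (σ j) w) ≤ orbTan L w := by
      refine Submodule.span_le.2 ?_
      rintro _ ⟨j, rfl⟩
      exact mem_orbTan.2 ⟨_, hAL _, rfl⟩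
    have heq := Submodule.eq_of_le_of_finrank_le hle (by
      rw [finrank_span_eq_card hw1, Fintype.card_fin, hspan]
      exact hw2)
    intro B hB
    have hBw : B w ∈ Submodule.span ℂ (Set.range fun j => A (σ j) w) :=
      heq ▸ mem_orbTan.2 ⟨B, hB, rfl⟩
    refine Submodule.span_induction (p := fun x _ => ⟪w, x⟫_ℂ = 0) ?_ (inner_zero_right _) ?_ ?_ hBw
    · rintro _ ⟨j, rfl⟩
      rw [inner_eq_re_of_selfAdjoint (hAs _), hw3, Complex.ofReal_zero]
    · intro x y _ _ hx hy
      rw [inner_add_right, hx, hy, add_zero]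
    · intro c x _ hx
      rw [inner_smul_right, hx, mul_zero]
  let M : (Fin m → ℝ) →L[ℝ] (E →L[ℂ] E) :=
    ∑ i, (ContinuousLinearMap.proj (R := ℝ) (φ := fun _ : Fin m => ℝ) i).smulRight (A i)
  have hM : ∀ t, M t = ∑ i, t i • A i := by
    intro t
    simp [M]
  have hML : ∀ t, M t ∈ L := by
    intro t
    rw [hM]
    refine L.sum_mem fun i _ => ?_
    rw [← Complex.coe_smul]
    exact L.smul_mem _ (hAL i)
  have hMs : ∀ t, star (M t) = M t := by
    intro t
    rw [hM, star_sum]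
    refine Finset.sum_congr rfl fun i _ => ?_
    rw [star_smul, hAs, star_trivial]
  have hd1 := hasStrictFDerivAt_exp_apply M v
  have hd2 : ∀ i, HasStrictFDerivAt (fun w : E => Complex.re ⟪w, A i w⟫_ℂ)
      (Complex.reCLM.comp ((fderivInnerCLM ℂ (v, A i v)).comp
        ((ContinuousLinearMap.id ℝ E).prod ((A i).restrictScalars ℝ)))) v := by
    intro i
    have h1 : ContDiff ℝ 1 (fun w : E => ⟪w, A i w⟫_ℂ) :=
      contDiff_id.inner ℂ ((A i).restrictScalars ℝ).contDiff
    have h2 := (hasFDerivAt_id (𝕜 := ℝ) v).inner ℂ ((A i).restrictScalars ℝ).hasFDerivAt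
    exact Complex.reCLM.hasStrictFDerivAt.comp v
      (h1.contDiffAt.hasStrictFDerivAt' h2 one_ne_zero)
  have hd3 : ∀ i, HasStrictFDerivAt
      (fun p : (Fin m → ℝ) × E => Complex.re ⟪exp (M p.1) p.2, A i (exp (M p.1) p.2)⟫_ℂ) _ (0, v) :=
    fun i => HasStrictFDerivAt.comp (0, v)
      (g := fun w : E => Complex.re ⟪w, A i w⟫_ℂ) (by simpa using hd2 i) hd1
  have hd4 := (hasStrictFDerivAt_pi.2 hd3).prodMk
    (ContinuousLinearMap.snd ℝ (Fin m → ℝ) E).hasStrictFDerivAt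
  let T : (Fin m → ℝ) →ₗ[ℝ] (Fin m → ℝ) :=
    LinearMap.pi fun i => (Complex.reCLM.comp ((fderivInnerCLM ℂ (v, A i v)).comp
        (((ContinuousLinearMap.id ℝ E).prod ((A i).restrictScalars ℝ)).comp
          (((ContinuousLinearMap.apply ℂ E v).restrictScalars ℝ).comp M)))).toLinearMap
  have hT : ∀ t i, T t i = 2 * Complex.re ⟪A i v, M t v⟫_ℂ := by
    intro t i
    have h1 : ⟪v, A i (M t v)⟫_ℂ = ⟪A i v, M t v⟫_ℂ := by
      conv_rhs => rw [← hAs i, ContinuousLinearMap.star_eq_adjoint]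
      rw [ContinuousLinearMap.adjoint_inner_left]
    have h2 : Complex.re ⟪M t v, A i v⟫_ℂ = Complex.re ⟪A i v, M t v⟫_ℂ := by
      rw [← inner_conj_symm, Complex.conj_re]
    have h3 : T t i = Complex.re (⟪v, A i (M t v)⟫_ℂ + ⟪M t v, A i v⟫_ℂ) := rfl
    rw [h3, Complex.add_re, h1, h2]
    ring
  have hTinj : Function.Injective T := by
    rw [← LinearMap.ker_eq_bot, LinearMap.ker_eq_bot']
    intro t ht
    have h1 : ∑ i, t i * T t i = 2 * Complex.re ⟪M t v, M t v⟫_ℂ := by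
      conv_rhs => rw [hM t]
      simp only [hT, sum_apply, smul_apply, sum_inner, Complex.re_sum, Finset.mul_sum]
      refine Finset.sum_congr rfl fun i _ => ?_
      rw [← Complex.coe_smul, inner_smul_left, Complex.conj_ofReal, Complex.re_ofReal_mul, hM]
      simp only [sum_apply, smul_apply]
      ring
    rw [ht] at h1
    simp only [Pi.zero_apply, mul_zero, Finset.sum_const_zero] at h1
    have h2 : M t v = 0 := by
      have h3 := inner_self_eq_norm_sq_to_K (𝕜 := ℂ) (M t v)
      rw [h3] at h1
      have h4 : Complex.re ((‖M t v‖ : ℂ) ^ 2) = ‖M t v‖ ^ 2 := by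
        rw [← Complex.ofReal_pow, Complex.ofReal_re]
      have h5 : ‖M t v‖ ^ 2 = 0 := by
        rw [← h4]
        have : (0 : ℝ) = 2 * Complex.re ((‖M t v‖ : ℂ) ^ 2) := h1
        linarith
      simpa using h5
    have h6 : ∑ i, t i • b i = 0 := by
      refine Subtype.ext ?_
      rw [AddSubmonoidClass.coe_finsetSum]
      simp only [Submodule.coe_smul, ← hAb]
      rw [hM] at h2
      simpa [sum_apply] using h2
    exact funext (Fintype.linearIndependent_iff.1 b.linearIndependent t h6)
  have hTsurj : Function.Surjective T := LinearMap.injective_iff_surjective.1 hTinj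
  have hmap := hd4.map_nhds_eq_of_surj (by
    rw [LinearMap.range_eq_top]
    rintro ⟨φ, y⟩
    set ψ : Fin m → ℝ := fun i => Complex.re (fderivInnerCLM ℂ (v, A i v) (y, A i y)) with hψ
    obtain ⟨t, ht⟩ := hTsurj (φ - ψ)
    refine ⟨(t, y), Prod.ext (funext fun i => ?_) rfl⟩
    have h1 : T t i = Complex.re (fderivInnerCLM ℂ (v, A i v) (M t v, A i (M t v))) := rfl
    have h2 := congrFun ht i
    rw [h1, Pi.sub_apply] at h2
    change Complex.re (fderivInnerCLM ℂ (v, A i v) (M t v + y, A i (M t v + y))) = φ i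
    rw [map_add, show ((M t v + y, A i (M t v) + A i y) : E × E) =
      (M t v, A i (M t v)) + (y, A i y) from rfl, map_add, Complex.add_re, h2]
    simp [hψ])
  have hval : (fun i => Complex.re ⟪exp (M (0 : Fin m → ℝ)) v, A i (exp (M (0 : Fin m → ℝ)) v)⟫_ℂ) =
      (0 : Fin m → ℝ) := by
    funext i
    rw [map_zero, exp_zero, one_apply_eq_self, hv _ (hAL i)]
    rfl
  have hcont : ∀ᶠ p : (Fin m → ℝ) × E in 𝓝 (0, v),
      (∀ i, Complex.re ⟪exp (M p.1) p.2, A i (exp (M p.1) p.2)⟫_ℂ = 0) →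
        IsCritical L (exp (M p.1) p.2) := by
    have h1 := hd1.continuousAt
    have h2 : exp (M (0 : Fin m → ℝ)) v = v := by simp
    rw [ContinuousAt] at h1
    simp only [h2] at h1
    exact h1.eventually hev
  have himg := Filter.image_mem_map (m := fun p : (Fin m → ℝ) × E =>
    ((fun i => Complex.re ⟪exp (M p.1) p.2, A i (exp (M p.1) p.2)⟫_ℂ), p.2)) hcont
  have hnhds := (show _ = _ from hmap) ▸ himg
  change _ ∈ 𝓝 ((fun i => Complex.re ⟪exp (M (0 : Fin m → ℝ)) v, A i (exp (M (0 : Fin m → ℝ)) v)⟫_ℂ), v)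
    at hnhds
  rw [hval] at hnhds
  have hy : ∀ᶠ y in 𝓝 v, ∃ t, IsCritical L (exp (M t) y) := by
    have hc : Continuous fun y : E => ((0 : Fin m → ℝ), y) := by fun_prop
    filter_upwards [hc.continuousAt.eventually hnhds] with y hy
    obtain ⟨⟨t, y'⟩, h1, h2⟩ := hy
    rw [Prod.mk.injEq] at h2
    obtain ⟨h2, rfl⟩ := h2
    exact ⟨t, h1 fun i => congrFun h2 i⟩
  have hcl := h.mem_closure_orbit hFc hFs hFk hu
  obtain ⟨_, ⟨t, ht⟩, ⟨g, hg, rfl⟩⟩ := mem_closure_iff_nhds.1 hcl _ hy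
  have hgM : exp (M t) * g ∈ 𝒢 := h.mul_mem _ (h.exp_mem (hML t)) _ hg
  obtain ⟨k, hk, hkv⟩ := hFk ((exp (M t) * g) u) (hFs _ hgM _ hu) ht
  obtain ⟨q, hq, hq1, -⟩ := h.inv_mem _ (h.mul_mem _ hk _ hgM)
  refine ⟨q, hq, ?_⟩
  rw [← hkv, ← mul_apply_eq_comp, ← mul_apply_eq_comp, mul_assoc, hq1, one_apply_eq_self]

end IsCoreGroup

end SliceToOrbit

section OrbitToSlice

open Filter Topology InnerProductSpace NormedSpace

variable {E : Type*} [NormedAddCommGroup E] [InnerProductSpace ℂ E] [FiniteDimensional ℂ E]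
  [CompleteSpace E]

theorem opNorm_le_one_of_star_mul_self {k : E →L[ℂ] E} (hk : star k * k = 1) : ‖k‖ ≤ 1 :=
  ContinuousLinearMap.opNorm_le_bound _ zero_le_one fun x => by
    rw [norm_apply_of_star_mul_self hk, one_mul]

theorem exp_apply_of_apply_eq_zero {X : E →L[ℂ] E} {x : E} (hx : X x = 0) : exp X x = x := by
  simpa using exp_apply_of_eigenvector X 0 x (by simpa using hx)

theorem eq_apply_star_of_unitary {k : E →L[ℂ] E} (hk : star k * k = 1) {v : E} (hv : k v = v) :
    star k v = v := by
  conv_lhs => rw [← hv]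
  rw [← mul_apply_eq_comp, hk, one_apply_eq_self]

/-- A small skew operator annihilates the fixed vectors of its exponential. -/
theorem apply_eq_zero_of_exp_apply_eq {X : E →L[ℂ] E} (hX : star X = -X) (hn : ‖X‖ < 1) {v : E}
    (hv : exp X v = v) : X v = 0 := by
  set A : E →L[ℂ] E := (-Complex.I) • X with hAdef
  have hXA : X = Complex.I • A := by simp [hAdef, smul_smul]
  have hA : IsSelfAdjoint A := by
    rw [IsSelfAdjoint, hAdef, star_smul, hX]
    simp
  have hAn : ‖A‖ = ‖X‖ := by simp [hAdef, norm_smul]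
  obtain ⟨b, l, hl, -, hAr, hexp⟩ := exists_eigenbasis A hA
  have h0 : A v = 0 := by
    refine b.repr.injective ?_
    ext i
    rw [hAr, map_zero]
    have h1 := hexp Complex.I v i
    rw [← hXA, hv] at h1
    by_cases hb : b.repr v i = 0
    · simp [hb]
    · have h2 : Complex.exp (Complex.I * l i) = 1 := by
        have := mul_right_cancel₀ hb (h1.symm.trans (one_mul _).symm)
        exact this
      obtain ⟨m, hm⟩ := Complex.exp_eq_one_iff.1 h2
      have h3 : l i = m * (2 * Real.pi) := by
        have h4 : Complex.I * l i = Complex.I * ((m * (2 * Real.pi) : ℝ) : ℂ) := by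
          rw [hm]; push_cast; ring
        exact_mod_cast mul_left_cancel₀ Complex.I_ne_zero h4
      have h5 : |l i| < 1 := lt_of_le_of_lt (hl i) (hAn ▸ hn)
      have h6 : m = 0 := by
        by_contra hm0
        have h7 : (1 : ℝ) ≤ |(m : ℝ)| := by exact_mod_cast Int.one_le_abs hm0
        rw [h3, abs_mul, abs_of_pos Real.two_pi_pos] at h5
        nlinarith [Real.pi_gt_three]
      simp [h3, h6]
  rw [hXA, smul_apply, h0, smul_zero]

namespace IsCoreGroup

variable {𝒢 : Set (E →L[ℂ] E)} {L : Submodule ℂ (E →L[ℂ] E)}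

theorem exp_real_mem (h : IsCoreGroup 𝒢 L) {A : E →L[ℂ] E} (hA : A ∈ L) (t : ℝ) :
    exp (t • A) ∈ 𝒢 := by
  have := (h.mem_lie A).1 hA (t : ℂ)
  rwa [Complex.coe_smul] at this

/-- Polar decomposition inside the isotropy group of a critical vector. -/
theorem polar_isotropy (h : IsCoreGroup 𝒢 L) {v : E} (hv : IsCritical L v) {g : E →L[ℂ] E}
    (hg : g ∈ 𝒢) (hgv : g v = v) : ∃ k ∈ 𝒢, ∃ A ∈ L, star k * k = 1 ∧ star A = A ∧
      g = k * exp A ∧ k v = v ∧ A v = 0 := by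
  obtain ⟨k, hk, A, hA, hku, hAs, rfl⟩ := h.polar g hg
  have h1 : A v = 0 := by
    refine (norm_le_norm_exp A hAs v (hv A hA)).2 (le_of_eq ?_)
    rw [mul_apply_eq_comp] at hgv
    conv_rhs => rw [← hgv]
    rw [norm_apply_of_star_mul_self hku]
  refine ⟨k, hk, A, hA, hku, hAs, rfl, ?_, h1⟩
  rwa [mul_apply_eq_comp, exp_apply_of_apply_eq_zero h1] at hgv

theorem star_isotropy (h : IsCoreGroup 𝒢 L) {v : E} (hv : IsCritical L v) {g : E →L[ℂ] E}
    (hg : g ∈ 𝒢) (hgv : g v = v) : star g v = v := by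
  obtain ⟨k, -, A, -, hku, hAs, rfl, hkv, hAv⟩ := h.polar_isotropy hv hg hgv
  rw [star_mul, NormedSpace.star_exp, hAs, mul_apply_eq_comp, eq_apply_star_of_unitary hku hkv,
    exp_apply_of_apply_eq_zero hAv]

/-- The orthogonal complement of the tangent space is stable under the isotropy group. -/
theorem isotropy_mem_orthogonal (h : IsCoreGroup 𝒢 L) {v : E} (hv : IsCritical L v)
    {g : E →L[ℂ] E} (hg : g ∈ 𝒢) (hgv : g v = v) {x : E} (hx : x ∈ (orbTan L v)ᗮ) :
    g x ∈ (orbTan L v)ᗮ := by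
  rw [Submodule.mem_orthogonal] at hx ⊢
  intro y hy
  obtain ⟨B, hB, rfl⟩ := mem_orbTan.1 hy
  have hs := h.star_mem g hg
  obtain ⟨q, hq, hq1, hq2⟩ := h.inv_mem _ hs
  have hqv : q v = v := by
    conv_lhs => rw [← h.star_isotropy hv hg hgv]
    rw [← mul_apply_eq_comp, hq1, one_apply_eq_self]
  have h1 := hx _ (mem_orbTan.2 ⟨_, h.conj_mem_lie hB hs hq hq1 hq2, rfl⟩)
  rwa [mul_apply_eq_comp, hqv, mul_apply_eq_comp, ContinuousLinearMap.star_eq_adjoint,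
    ContinuousLinearMap.adjoint_inner_left] at h1

theorem star_apply_eq_zero (h : IsCoreGroup 𝒢 L) {v : E} (hv : IsCritical L v)
    {A : E →L[ℂ] E} (hA : A ∈ L) (hAv : A v = 0) : star A v = 0 := by
  have h1 := hasDerivAt_exp_smul_apply (star A) v
  have h2 : (fun t : ℝ => exp (t • star A) v) = fun _ => v := by
    funext t
    have h3 := h.star_isotropy hv (h.exp_real_mem hA t)
      (exp_apply_of_apply_eq_zero (by rw [smul_apply, hAv, smul_zero]))
    rwa [NormedSpace.star_exp, star_smul, star_trivial] at h3
  rw [h2] at h1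
  exact h1.unique (hasDerivAt_const _ _)

theorem apply_mem_orthogonal (h : IsCoreGroup 𝒢 L) {v : E} (hv : IsCritical L v)
    {A : E →L[ℂ] E} (hA : A ∈ L) (hAv : A v = 0) {x : E} (hx : x ∈ (orbTan L v)ᗮ) :
    A x ∈ (orbTan L v)ᗮ := by
  rw [Submodule.mem_orthogonal]
  intro y hy
  have h1 := ((innerSL ℂ y).restrictScalars ℝ).hasFDerivAt.comp_hasDerivAt (0 : ℝ)
    (hasDerivAt_exp_smul_apply A x)
  have h2 : (((innerSL ℂ y).restrictScalars ℝ) ∘ fun t : ℝ => exp (t • A) x) = fun _ => 0 := by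
    funext t
    exact (Submodule.mem_orthogonal _ _).1 (h.isotropy_mem_orthogonal hv (h.exp_real_mem hA t)
      (exp_apply_of_apply_eq_zero (by rw [smul_apply, hAv, smul_zero])) hx) y hy
  rw [h2] at h1
  exact h1.unique (hasDerivAt_const _ _)

/-- If the fiber through `v` is its orbit, then no self-adjoint element of the isotropy algebra has
an eigenvector with negative eigenvalue normal to the orbit. -/
theorem eigenvector_nonneg (h : IsCoreGroup 𝒢 L) {v : E} {F : Set E}
    (hFl : ∀ u, v ∈ closure ((fun g : E →L[ℂ] E => g u) '' 𝒢) → u ∈ F)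
    (hF : ∀ u ∈ F, ∃ g ∈ 𝒢, g v = u)
    {A : E →L[ℂ] E} (hA : A ∈ L) (hAv : A v = 0) {x : E} (hx : x ∈ (orbTan L v)ᗮ) (hx0 : x ≠ 0)
    {c : ℝ} (hc : A x = (c : ℂ) • x) : 0 ≤ c := by
  by_contra! hcneg
  have hmem : ∀ s : ℂ, v + s • x ∈ F := by
    intro s
    refine hFl _ (mem_closure_of_tendsto (f := fun t : ℝ => exp (t • A) (v + s • x)) (b := atTop)
      ?_ (Filter.Eventually.of_forall fun t => ⟨_, h.exp_real_mem hA t, rfl⟩))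
    have h1 : ∀ t : ℝ, exp (t • A) (v + s • x) = v + s • ((Real.exp (t * c) : ℂ) • x) := by
      intro t
      rw [map_add, map_smul, exp_apply_of_apply_eq_zero (by rw [smul_apply, hAv, smul_zero]),
        exp_apply_of_eigenvector (t • A) ((t * c : ℝ) : ℂ) x
          (by rw [smul_apply, hc, ← Complex.coe_smul, smul_smul, Complex.ofReal_mul]),
        Complex.ofReal_exp]
    simp only [h1]
    have h2 : Tendsto (fun t : ℝ => Real.exp (t * c)) atTop (𝓝 0) :=
      Real.tendsto_exp_atBot.comp (tendsto_id.atTop_mul_const_of_neg hcneg)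
    have h3 := (Complex.continuous_ofReal.tendsto 0).comp h2
    have h4 := ((h3.smul_const x).const_smul s).const_add v
    simpa using h4
  have hdim : ∀ s : ℂ, Module.finrank ℂ (orbTan L (v + s • x)) = Module.finrank ℂ (orbTan L v) := by
    intro s
    obtain ⟨g, hg, hgv⟩ := hF _ (hmem s)
    rw [← hgv, h.finrank_orbTan hg]
  let d := Module.finrank ℂ (orbTan L v)
  let b : Module.Basis (Fin d) ℂ (orbTan L v) := Module.finBasis ℂ _
  have hB : ∀ i, ∃ B ∈ L, B v = (b i : E) := fun i => mem_orbTan.1 (b i).2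
  choose B hBL hBv using hB
  have hli0 : LinearIndependent ℂ fun o : Option (Fin d) => (o.casesOn' x fun i => (b i : E)) := by
    refine LinearIndependent.option (b.linearIndependent.map' (orbTan L v).subtype
      (Submodule.ker_subtype _)) ?_
    intro hmem'
    have h1 : Submodule.span ℂ (Set.range ((orbTan L v).subtype ∘ b)) ≤ orbTan L v := by
      refine Submodule.span_le.2 ?_
      rintro _ ⟨i, rfl⟩
      exact (b i).2
    exact hx0 (inner_self_eq_zero.1 ((Submodule.mem_orthogonal _ _).1 hx x (h1 hmem')))
  have hev : ∀ᶠ s : ℂ in 𝓝 0, LinearIndependent ℂ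
      fun o : Option (Fin d) => (o.casesOn' x fun i => B i (v + s • x)) := by
    have hcont : Continuous fun s : ℂ =>
        fun o : Option (Fin d) => (o.casesOn' x fun i => B i (v + s • x) : E) := by
      refine continuous_pi fun o => ?_
      cases o with
      | none => exact continuous_const
      | some i => exact (B i).continuous.comp (continuous_const.add (continuous_id.smul continuous_const))
    refine hcont.continuousAt.eventually (isOpen_setOfPred_linearIndependent.mem_nhds ?_)
    change LinearIndependent ℂ fun o : Option (Fin d) => (o.casesOn' x fun i => B i (v + (0 : ℂ) • x))
    simpa [hBv] using hli0
  obtain ⟨s, hs, hs0⟩ := ((hev.filter_mono nhdsWithin_le_nhds).and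
    (eventually_mem_nhdsWithin (a := (0 : ℂ)) (s := {0}ᶜ))).exists
  have hs0' : s ≠ 0 := hs0
  have hle : Submodule.span ℂ (Set.range
      fun o : Option (Fin d) => (o.casesOn' x fun i => B i (v + s • x))) ≤ orbTan L (v + s • x) := by
    refine Submodule.span_le.2 ?_
    rintro _ ⟨o, rfl⟩
    cases o with
    | none =>
      refine mem_orbTan.2 ⟨(s * c)⁻¹ • A, L.smul_mem _ hA, ?_⟩
      have hc0 : (c : ℂ) ≠ 0 := by exact_mod_cast hcneg.ne
      rw [smul_apply, map_add, hAv, zero_add, map_smul, hc, smul_smul s, smul_smul,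
        inv_mul_cancel₀ (mul_ne_zero hs0' hc0), one_smul]
      rfl
    | some i => exact mem_orbTan.2 ⟨B i, hBL i, rfl⟩
  have h1 := Submodule.finrank_mono hle
  rw [finrank_span_eq_card hs, hdim, Fintype.card_option, Fintype.card_fin] at h1
  exact absurd h1 (by simp [d])

/-- If the fiber through `v` is its orbit, the isotropy algebra acts trivially on the slice. -/
theorem lie_isotropy_trivial (h : IsCoreGroup 𝒢 L) {v : E} (hv : IsCritical L v) {F : Set E}
    (hFl : ∀ u, v ∈ closure ((fun g : E →L[ℂ] E => g u) '' 𝒢) → u ∈ F)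
    (hF : ∀ u ∈ F, ∃ g ∈ 𝒢, g v = u)
    {A : E →L[ℂ] E} (hA : A ∈ L) (hAv : A v = 0) {x : E} (hx : x ∈ (orbTan L v)ᗮ) : A x = 0 := by
  have hsa : ∀ B ∈ L, star B = B → B v = 0 → ∀ y ∈ (orbTan L v)ᗮ, B y = 0 := by
    intro B hB hBs hBv
    have hst : ∀ y ∈ (orbTan L v)ᗮ, B.toLinearMap y ∈ (orbTan L v)ᗮ := fun y hy =>
      h.apply_mem_orthogonal hv hB hBv hy
    have hsym : (B.toLinearMap.restrict hst).IsSymmetric :=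
      (IsSelfAdjoint.isSymmetric (show IsSelfAdjoint B from hBs)).restrict_invariant hst
    set e := hsym.eigenvectorBasis rfl
    have he : ∀ i, B.toLinearMap.restrict hst (e i) = 0 := by
      intro i
      have h1 := hsym.apply_eigenvectorBasis rfl i
      set c := hsym.eigenvalues rfl i
      have h2 : B (e i : E) = (c : ℂ) • (e i : E) := congrArg Subtype.val h1
      have h3 : (e i : E) ≠ 0 := fun h0 => e.orthonormal.ne_zero i (Subtype.ext h0)
      have h4 := h.eigenvector_nonneg hFl hF hB hBv (e i).2 h3 h2
      have h5 := h.eigenvector_nonneg hFl hF (L.neg_mem hB) (by simp [hBv]) (e i).2 h3 (c := -c)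
        (by simp [h2])
      have h6 : c = 0 := by linarith
      rw [h1]
      simp [c, h6]
    have h0 : B.toLinearMap.restrict hst = 0 := by
      refine e.toBasis.ext fun i => ?_
      simpa using he i
    intro y hy
    exact congrArg Subtype.val (LinearMap.congr_fun h0 ⟨y, hy⟩)
  have hsv := h.star_apply_eq_zero hv hA hAv
  obtain ⟨B, hB, C, hC, hBs, hCs, rfl⟩ := h.exists_re_im hA
  rw [star_add, star_smul, hBs, hCs, add_apply, smul_apply] at hsv
  rw [add_apply, smul_apply] at hAv ⊢
  have h1 : (star Complex.I) • C v = -(Complex.I • C v) := by simp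
  rw [h1, ← sub_eq_add_neg, sub_eq_zero] at hsv
  rw [hsv, ← two_smul ℂ, smul_smul] at hAv
  have hCv : C v = 0 := by simpa using hAv
  have hBv : B v = 0 := by rw [hsv, hCv, smul_zero]
  rw [hsa B hB hBs hBv x hx, hsa C hC hCs hCv x hx, smul_zero, add_zero]

/-- If the isotropy algebra acts trivially on the slice, the isotropy group acts through a finite
group. -/
theorem finite_image_isotropy (h : IsCoreGroup 𝒢 L) {v : E} (hv : IsCritical L v)
    (hlie : ∀ A ∈ L, A v = 0 → ∀ x ∈ (orbTan L v)ᗮ, A x = 0) :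
    Set.Finite ((fun g : E →L[ℂ] E => fun x : (orbTan L v)ᗮ => g (x : E)) '' {g | g ∈ 𝒢 ∧ g v = v}) := by
  obtain ⟨δ, hδ, hone⟩ := h.near_one 1 one_pos
  set Kv := {k | k ∈ 𝒢 ∧ star k * k = 1} ∩ {k : E →L[ℂ] E | k v = v} with hKv
  have hcomp : IsCompact Kv := (isCompact_unitaryPart h).inter_right
    (isClosed_eq (ContinuousLinearMap.apply ℂ E v).continuous continuous_const)
  obtain ⟨T, hTK, hT, hcov⟩ := hcomp.finite_cover_balls hδ
  refine (hT.image fun g : E →L[ℂ] E => fun x : (orbTan L v)ᗮ => g (x : E)).subset ?_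
  rintro _ ⟨g, ⟨hg, hgv⟩, rfl⟩
  obtain ⟨k, hk, A, hA, hku, -, rfl, hkv, hAv⟩ := h.polar_isotropy hv hg hgv
  obtain ⟨c, hcT, hc⟩ := Set.mem_iUnion₂.1 (hcov (show k ∈ Kv from ⟨⟨hk, hku⟩, hkv⟩))
  obtain ⟨⟨hcG, hcu⟩, hcv⟩ := hTK hcT
  refine ⟨c, hcT, funext fun x => ?_⟩
  have hcc := mul_star_self_of_star_mul_self hcu
  have hkk := mul_star_self_of_star_mul_self hku
  obtain ⟨X, hX, hXs, hXn, hXe⟩ := hone (star c * k) (h.mul_mem _ (h.star_mem _ hcG) _ hk)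
    (by rw [star_mul, star_star, mul_assoc, ← mul_assoc c, hcc, one_mul, hku]) (by
      have h1 : star c * k - 1 = star c * (k - c) := by rw [mul_sub, hcu]
      rw [h1]
      refine lt_of_le_of_lt (norm_mul_le _ _) ?_
      rw [Metric.mem_ball, dist_eq_norm] at hc
      have h2 : ‖star c‖ ≤ 1 := by
        rw [norm_star]; exact opNorm_le_one_of_star_mul_self hcu
      exact lt_of_le_of_lt (mul_le_of_le_one_left (norm_nonneg _) h2) hc)
  have hXv : X v = 0 := by
    refine apply_eq_zero_of_exp_apply_eq hXs hXn ?_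
    rw [hXe, mul_apply_eq_comp, hkv, eq_apply_star_of_unitary hcu hcv]
  have h3 := exp_apply_of_apply_eq_zero (hlie X hX hXv x x.2)
  rw [hXe, mul_apply_eq_comp] at h3
  change c (x : E) = (k * exp A) (x : E)
  rw [mul_apply_eq_comp, exp_apply_of_apply_eq_zero (hlie A hA hAv x x.2)]
  conv_lhs => rw [← h3]
  rw [← mul_apply_eq_comp, hcc, one_apply_eq_self]

end IsCoreGroup

end OrbitToSlice

theorem sum_exp_eq_zero_of_nat {ι : Type*} (s : Finset ι) (c w : ι → ℂ)
    (hinj : ∀ a ∈ s, ∀ b ∈ s, Complex.exp (w a) = Complex.exp (w b) → w a = w b)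
    (h0 : ∀ m : ℕ, ∑ a ∈ s, c a * Complex.exp (m * w a) = 0) (t : ℂ) :
    ∑ a ∈ s, c a * Complex.exp (t * w a) = 0 := by
  classical
  have hF : ∃ F : ℂ → ℂ, ∀ a ∈ s, F (Complex.exp (w a)) = Complex.exp (t * w a) := by
    refine ⟨fun y => if h : ∃ a ∈ s, Complex.exp (w a) = y then Complex.exp (t * w h.choose)
      else 0, fun a ha => ?_⟩
    have h : ∃ b ∈ s, Complex.exp (w b) = Complex.exp (w a) := ⟨a, ha, rfl⟩
    change dite _ _ _ = _
    rw [dif_pos h, hinj _ h.choose_spec.1 a ha h.choose_spec.2]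
  obtain ⟨F, hF⟩ := hF
  set r : Polynomial ℂ :=
    Lagrange.interpolate (s.image fun a => Complex.exp (w a)) id F with hr
  have hev : ∀ a ∈ s, r.eval (Complex.exp (w a)) = Complex.exp (t * w a) := by
    intro a ha
    have h1 := Lagrange.eval_interpolate_at_node (s := s.image fun a => Complex.exp (w a))
      (v := id) F Function.injective_id.injOn (Finset.mem_image_of_mem _ ha)
    rw [← hF a ha, ← h1]
    rfl
  calc ∑ a ∈ s, c a * Complex.exp (t * w a)
      = ∑ a ∈ s, c a * r.eval (Complex.exp (w a)) :=
        Finset.sum_congr rfl fun a ha => by rw [hev a ha]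
    _ = ∑ a ∈ s, ∑ m ∈ r.support, r.coeff m * (c a * Complex.exp (m * w a)) := by
        refine Finset.sum_congr rfl fun a _ => ?_
        rw [Polynomial.eval_eq_sum, Polynomial.sum, Finset.mul_sum]
        refine Finset.sum_congr rfl fun m _ => ?_
        rw [Complex.exp_nat_mul]
        ring
    _ = 0 := by
        rw [Finset.sum_comm]
        refine Finset.sum_eq_zero fun m _ => ?_
        rw [← Finset.mul_sum, h0, mul_zero]

section AlgebraicGroup

open NormedSpace

open scoped Matrix.Norms.L2Operator

variable {n : ℕ} {G : Set (Matrix (Fin n) (Fin n) ℂ)}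

theorem mexp_eq_exp (A : Matrix (Fin n) (Fin n) ℂ) : mexp ℂ n A = exp A := by
  rw [exp_eq_tsum ℂ]
  rfl

/-- Evaluation of a polynomial in the entries of a matrix. -/
abbrev evalMat (g : Matrix (Fin n) (Fin n) ℂ) (p : MvPolynomial (Fin n × Fin n) ℂ) : ℂ :=
  eval (fun ij => g ij.1 ij.2) p

theorem continuous_evalMat (p : MvPolynomial (Fin n × Fin n) ℂ) :
    Continuous fun g : Matrix (Fin n) (Fin n) ℂ => evalMat g p := by
  have : Continuous fun g : Matrix (Fin n) (Fin n) ℂ => fun ij : Fin n × Fin n => g ij.1 ij.2 :=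
    continuous_pi fun ij => continuous_id.matrix_elem ij.1 ij.2
  exact (MvPolynomial.continuous_eval p).comp this

/-- The polynomial `x ↦ p (a x b)`. -/
def mulPoly (a b : Matrix (Fin n) (Fin n) ℂ) (p : MvPolynomial (Fin n × Fin n) ℂ) :
    MvPolynomial (Fin n × Fin n) ℂ :=
  bind₁ (fun ij => ∑ k, ∑ l, C (a ij.1 k * b l ij.2) * X (k, l)) p

theorem evalMat_mulPoly (a b g : Matrix (Fin n) (Fin n) ℂ)
    (p : MvPolynomial (Fin n × Fin n) ℂ) :
    evalMat g (mulPoly a b p) = evalMat (a * g * b) p := by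
  rw [evalMat, evalMat, mulPoly, ← coe_aeval_eq_eval, ← coe_aeval_eq_eval, RingHom.coe_coe,
    RingHom.coe_coe, aeval_bind₁]
  congr 2
  funext ij
  simp only [map_sum, map_mul, aeval_X, aeval_C, Algebra.algebraMap_self, RingHom.id_apply,
    Matrix.mul_apply, Finset.sum_mul]
  rw [Finset.sum_comm]
  exact Finset.sum_congr rfl fun l _ => Finset.sum_congr rfl fun k _ => by ring

/-- The derivation of `ℂ[M_n]` given by the left invariant vector field of `A`. -/
def leftInvDeriv (A : Matrix (Fin n) (Fin n) ℂ) :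
    Derivation ℂ (MvPolynomial (Fin n × Fin n) ℂ) (MvPolynomial (Fin n × Fin n) ℂ) :=
  mkDerivation ℂ fun ij => ∑ k, X (ij.1, k) * C (A k ij.2)

theorem leftInvDeriv_add (A B : Matrix (Fin n) (Fin n) ℂ) :
    leftInvDeriv (A + B) = leftInvDeriv A + leftInvDeriv B := by
  refine derivation_ext fun ij => ?_
  simp [leftInvDeriv, mkDerivation_X, mul_add, Finset.sum_add_distrib]

theorem leftInvDeriv_smul (c : ℂ) (A : Matrix (Fin n) (Fin n) ℂ) :
    leftInvDeriv (c • A) = c • leftInvDeriv A := by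
  refine derivation_ext fun ij => ?_
  simp only [leftInvDeriv, mkDerivation_X, Derivation.smul_apply, Matrix.smul_apply, smul_eq_mul,
    Finset.smul_sum, C_mul, smul_eq_C_mul]
  exact Finset.sum_congr rfl fun k _ => by ring

theorem hasDerivAt_evalMat_exp (g A : Matrix (Fin n) (Fin n) ℂ)
    (p : MvPolynomial (Fin n × Fin n) ℂ) (t : ℂ) :
    HasDerivAt (fun t : ℂ => evalMat (g * exp (t • A)) p)
      (evalMat (g * exp (t • A)) (leftInvDeriv A p)) t := by
  induction p using MvPolynomial.induction_on with
  | C a => simpa [evalMat] using hasDerivAt_const t a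
  | add p q hp hq =>
    simp only [evalMat, map_add] at hp hq ⊢
    exact hp.add hq
  | mul_X p ij hp =>
    have h1 : HasDerivAt (fun t : ℂ => g * exp (t • A)) (g * (exp (t • A) * A)) t :=
      (hasDerivAt_exp_smul_const A t).const_mul g
    have h2 : HasDerivAt (fun t : ℂ => (g * exp (t • A)) ij.1 ij.2)
        ((g * (exp (t • A) * A)) ij.1 ij.2) t :=
      (hasDerivAt_pi.1 ((hasDerivAt_pi.1 h1) ij.1)) ij.2
    have h3 := hp.mul h2
    simp only [evalMat, map_mul, eval_X, Derivation.leibniz, smul_eq_mul, map_add]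
    refine h3.congr_deriv ?_
    simp only [leftInvDeriv, mkDerivation_X, map_sum, map_mul, eval_X, eval_C, evalMat]
    rw [← mul_assoc g, Matrix.mul_apply (M := g * _)]
    ring

/-- The Zariski tangent space of `G` at `1`. -/
def tangentAtOne (G : Set (Matrix (Fin n) (Fin n) ℂ)) :
    Submodule ℂ (Matrix (Fin n) (Fin n) ℂ) where
  carrier := {A | ∀ p : MvPolynomial (Fin n × Fin n) ℂ, (∀ g ∈ G, evalMat g p = 0) →
    evalMat 1 (leftInvDeriv A p) = 0}
  zero_mem' := by
    intro p _
    have : leftInvDeriv (0 : Matrix (Fin n) (Fin n) ℂ) = 0 := by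
      simpa using leftInvDeriv_smul 0 (0 : Matrix (Fin n) (Fin n) ℂ)
    simp [this, evalMat]
  add_mem' := by
    intro A B hA hB p hp
    have h1 := hA p hp
    have h2 := hB p hp
    simp only [evalMat] at h1 h2
    simp [leftInvDeriv_add, evalMat, h1, h2]
  smul_mem' := by
    intro c A hA p hp
    have h1 := hA p hp
    simp only [evalMat] at h1
    simp [leftInvDeriv_smul, evalMat, h1, smul_eq_C_mul]

theorem mem_of_isZClosedInGL (hZ : IsZClosedInGL ℂ n G) {g : Matrix (Fin n) (Fin n) ℂ}
    (hg : IsUnit g) (h : ∀ p, (∀ x ∈ G, evalMat x p = 0) → evalMat g p = 0) : g ∈ G := by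
  obtain ⟨P, rfl⟩ := hZ
  exact ⟨hg, fun p hp => h p fun x hx => hx.2 p hp⟩

theorem mem_tangentAtOne (hS : IsMatSubgroup ℂ n G) (hZ : IsZClosedInGL ℂ n G)
    {A : Matrix (Fin n) (Fin n) ℂ} :
    A ∈ tangentAtOne G ↔ ∀ t : ℂ, exp (t • A) ∈ G := by
  constructor
  · intro hA t
    have hderiv : ∀ p, (∀ g ∈ G, evalMat g p = 0) → ∀ g ∈ G, evalMat g (leftInvDeriv A p) = 0 := by
      intro p hp g hg
      have h1 := hA (mulPoly g 1 p) fun x hx => by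
        rw [evalMat_mulPoly, mul_one]
        exact hp _ (hS.2.1 g hg x hx)
      have h2 := hasDerivAt_evalMat_exp 1 A (mulPoly g 1 p) 0
      have h3 := hasDerivAt_evalMat_exp g A p 0
      simp only [evalMat_mulPoly, mul_one, one_mul, zero_smul, exp_zero] at h2 h3
      rw [h3.unique h2]
      exact h1
    refine mem_of_isZClosedInGL hZ (Matrix.isUnit_exp _) fun p hp => ?_
    have hiter : ∀ k, ∀ g ∈ G, evalMat g ((leftInvDeriv A)^[k] p) = 0 := by
      intro k
      induction k with
      | zero => exact hp
      | succ k ih =>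
        rw [Function.iterate_succ_apply']
        exact hderiv _ ih
    set f : ℂ → ℂ := fun t => evalMat (1 * exp (t • A)) p with hf
    have hder : ∀ k, iteratedDeriv k f =
        fun t => evalMat (1 * exp (t • A)) ((leftInvDeriv A)^[k] p) := by
      intro k
      induction k with
      | zero => simp [hf]
      | succ k ih =>
        rw [iteratedDeriv_succ, ih]
        funext t
        rw [(hasDerivAt_evalMat_exp 1 A _ t).deriv, Function.iterate_succ_apply']
    have hdiff : Differentiable ℂ f := fun t =>
      (hasDerivAt_evalMat_exp 1 A p t).differentiableAt
    have := Complex.taylorSeries_eq_of_entire' (c := 0) (z := t) hdiff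
    have h0 : f t = 0 := by
      rw [← this]
      refine (tsum_congr fun k => ?_).trans tsum_zero
      rw [hder k]
      simp [hiter k 1 hS.1]
    simpa [hf] using h0
  · intro h p hp
    have h1 := hasDerivAt_evalMat_exp 1 A p 0
    have h2 : (fun t : ℂ => evalMat (1 * exp (t • A)) p) = fun _ => 0 := by
      funext t
      rw [one_mul]
      exact hp _ (h t)
    rw [h2] at h1
    simpa using h1.unique (hasDerivAt_const _ _)

theorem mem_lieAlgebra_iff (hS : IsMatSubgroup ℂ n G) (hZ : IsZClosedInGL ℂ n G)
    {A : Matrix (Fin n) (Fin n) ℂ} : A ∈ lieAlgebra ℂ n G ↔ A ∈ tangentAtOne G := by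
  rw [mem_tangentAtOne hS hZ]
  simp [lieAlgebra, mexp_eq_exp]

end AlgebraicGroup

section UnitaryForm

open NormedSpace Filter Topology

open scoped Matrix.Norms.L2Operator

variable {n : ℕ} {G : Set (Matrix (Fin n) (Fin n) ℂ)}

/-- The polynomial `z ↦ p (S * diagonal z * S')`. -/
def diagPoly (S S' : Matrix (Fin n) (Fin n) ℂ) (p : MvPolynomial (Fin n × Fin n) ℂ) :
    MvPolynomial (Fin n) ℂ :=
  bind₁ (fun ij => ∑ k, C (S ij.1 k * S' k ij.2) * X k) p

theorem eval_diagPoly (S S' : Matrix (Fin n) (Fin n) ℂ) (p : MvPolynomial (Fin n × Fin n) ℂ)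
    (z : Fin n → ℂ) : eval z (diagPoly S S' p) = evalMat (S * Matrix.diagonal z * S') p := by
  rw [evalMat, diagPoly, ← coe_aeval_eq_eval, ← coe_aeval_eq_eval, RingHom.coe_coe,
    RingHom.coe_coe, aeval_bind₁]
  congr 2
  funext ij
  simp only [map_sum, map_mul, aeval_X, aeval_C, Algebra.algebraMap_self, RingHom.id_apply,
    Matrix.mul_apply (M := S * _), Matrix.mul_diagonal]
  exact Finset.sum_congr rfl fun k _ => by ring

theorem totalDegree_diagPoly_le (S S' : Matrix (Fin n) (Fin n) ℂ)
    (p : MvPolynomial (Fin n × Fin n) ℂ) : (diagPoly S S' p).totalDegree ≤ p.totalDegree := by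
  have hlin : ∀ ij : Fin n × Fin n,
      (∑ k, C (S ij.1 k * S' k ij.2) * X k : MvPolynomial (Fin n) ℂ).totalDegree ≤ 1 := by
    intro ij
    refine totalDegree_finsetSum_le fun k _ => (totalDegree_mul _ _).trans ?_
    rw [totalDegree_C, totalDegree_X]
  rw [diagPoly, bind₁, aeval_def, eval₂_eq']
  refine totalDegree_finsetSum_le fun d hd => (totalDegree_mul _ _).trans ?_
  refine (add_le_add (totalDegree_C _).le (totalDegree_finsetProd _ _)).trans ?_
  rw [zero_add]
  refine (Finset.sum_le_sum fun ij _ => (totalDegree_pow _ _).trans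
    (Nat.mul_le_mul_left _ (hlin ij))).trans ?_
  refine le_trans (le_of_eq ?_) (le_totalDegree hd)
  simp [Finsupp.sum_fintype]

theorem exp_smul_conj_diagonal {S : Matrix (Fin n) (Fin n) ℂ} (hS : IsUnit S) (d : Fin n → ℂ)
    (t : ℂ) : exp (t • (S * Matrix.diagonal d * S⁻¹)) =
      S * Matrix.diagonal (fun i => Complex.exp (t * d i)) * S⁻¹ := by
  have h : t • (S * Matrix.diagonal d * S⁻¹) = S * Matrix.diagonal (t • d) * S⁻¹ := by
    rw [Matrix.diagonal_smul]
    simp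
  rw [h, Matrix.exp_conj _ _ hS, Matrix.exp_diagonal]
  congr 3
  funext i
  rw [Pi.coe_exp]
  simp [Complex.exp_eq_exp_ℂ]

/-- A one-parameter group with integral points in `G` lies in `G`, if its eigenvalues admit no
extra multiplicative relations of bounded degree. -/
theorem evalMat_exp_eq_zero {S : Matrix (Fin n) (Fin n) ℂ} (hS : IsUnit S) {d : Fin n → ℂ}
    {p : MvPolynomial (Fin n × Fin n) ℂ}
    (hd : ∀ α β : Fin n →₀ ℕ, (α.sum fun _ e => e) ≤ p.totalDegree →
      (β.sum fun _ e => e) ≤ p.totalDegree →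
      Complex.exp (∑ i, α i * d i) = Complex.exp (∑ i, β i * d i) →
      ∑ i, α i * d i = ∑ i, β i * d i)
    (h : ∀ m : ℕ, evalMat (exp ((m : ℂ) • (S * Matrix.diagonal d * S⁻¹))) p = 0) (t : ℂ) :
    evalMat (exp (t • (S * Matrix.diagonal d * S⁻¹))) p = 0 := by
  have key : ∀ t : ℂ, evalMat (exp (t • (S * Matrix.diagonal d * S⁻¹))) p =
      ∑ α ∈ (diagPoly S S⁻¹ p).support,
        coeff α (diagPoly S S⁻¹ p) * Complex.exp (t * ∑ i, α i * d i) := by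
    intro t
    rw [exp_smul_conj_diagonal hS, ← eval_diagPoly, eval_eq']
    refine Finset.sum_congr rfl fun α _ => ?_
    simp_rw [← Complex.exp_nat_mul]
    rw [← Complex.exp_sum, Finset.mul_sum]
    congr 2
    exact Finset.sum_congr rfl fun i _ => by ring
  rw [key]
  refine sum_exp_eq_zero_of_nat _ _ (fun α : Fin n →₀ ℕ => ∑ i, α i * d i) (fun α hα β hβ => ?_)
    (fun m => ?_) t
  · exact hd α β ((le_totalDegree hα).trans (totalDegree_diagPoly_le _ _ _))
      ((le_totalDegree hβ).trans (totalDegree_diagPoly_le _ _ _))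
  · rw [← key]
    exact h m

open scoped ComplexOrder in
theorem exists_unitary_diagonalization {A : Matrix (Fin n) (Fin n) ℂ} (hA : A.IsHermitian) :
    ∃ (U : Matrix (Fin n) (Fin n) ℂ) (d : Fin n → ℝ), IsUnit U ∧ star U = U⁻¹ ∧
      A = U * Matrix.diagonal (fun i => (d i : ℂ)) * U⁻¹ ∧ (∀ i, |d i| ≤ ‖A‖) ∧
      (A.PosDef → ∀ i, 0 < d i) := by
  set U := hA.eigenvectorUnitary
  have h1 : star (U : Matrix (Fin n) (Fin n) ℂ) * U = 1 := Unitary.coe_star_mul_self U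
  have h2 : (U : Matrix (Fin n) (Fin n) ℂ)⁻¹ = star (U : Matrix (Fin n) (Fin n) ℂ) :=
    Matrix.inv_eq_left_inv h1
  have h3 := hA.spectral_theorem
  rw [Unitary.conjStarAlgAut_apply] at h3
  have h4 : ‖A‖ = ‖Matrix.diagonal (fun i => (hA.eigenvalues i : ℂ))‖ := by
    conv_lhs => rw [h3]
    rw [← Unitary.coe_star, CStarRing.norm_mul_coe_unitary, CStarRing.norm_coe_unitary_mul]
    rfl
  refine ⟨U, hA.eigenvalues, ⟨Unitary.toUnits U, rfl⟩, h2.symm, ?_, fun i => ?_,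
    fun h i => h.eigenvalues_pos i⟩
  · rw [h2]
    exact h3
  · rw [h4, Matrix.l2_opNorm_diagonal]
    simpa using norm_le_pi_norm (fun i => (hA.eigenvalues i : ℂ)) i

/-- A Zariski closed matrix group in which the unitary elements of some subgroup are dense. -/
structure IsUnitaryForm (G : Set (Matrix (Fin n) (Fin n) ℂ)) : Prop where
  isMatSubgroup : IsMatSubgroup ℂ n G
  isZClosedInGL : IsZClosedInGL ℂ n G
  exists_dense : ∃ K ⊆ G, IsMatSubgroup ℂ n K ∧ (∀ k ∈ K, star k * k = 1) ∧
    ∀ p : MvPolynomial (Fin n × Fin n) ℂ, (∀ k ∈ K, evalMat k p = 0) → ∀ g ∈ G, evalMat g p = 0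

theorem IsUnitaryForm.star_mem (h : IsUnitaryForm G) {g : Matrix (Fin n) (Fin n) ℂ} (hg : g ∈ G) :
    star g ∈ G := by
  refine mem_of_isZClosedInGL h.isZClosedInGL ((h.isMatSubgroup.2.2 g hg).1.star) fun p hp => ?_
  obtain ⟨K, hKG, hK, hKu, hdense⟩ := h.exists_dense
  set q : MvPolynomial (Fin n × Fin n) ℂ := map (starRingEnd ℂ) (rename Prod.swap p) with hq
  have hev : ∀ x : Matrix (Fin n) (Fin n) ℂ, evalMat x q = star (evalMat (star x) p) := by
    intro x
    simp only [hq, evalMat]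
    clear hq q hp
    induction p using MvPolynomial.induction_on with
    | C a => simp
    | add p q hp hq => simp [hp, hq]
    | mul_X p ij hp => simp [hp, Matrix.star_apply]
  have hq0 := hdense q (fun k hk => ?_) g hg
  · rw [hev] at hq0
    exact star_eq_zero.1 hq0
  · rw [hev, star_eq_zero]
    have : star k = k⁻¹ := (Matrix.inv_eq_left_inv (hKu k hk)).symm
    rw [this]
    exact hp _ (hKG (hK.2.2 k hk).2)

theorem IsUnitaryForm.mem_tangentAtOne (h : IsUnitaryForm G) {A : Matrix (Fin n) (Fin n) ℂ} :
    A ∈ tangentAtOne G ↔ ∀ t : ℂ, exp (t • A) ∈ G :=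
  ZPaper.mem_tangentAtOne h.isMatSubgroup h.isZClosedInGL

theorem pow_mem_of_isMatSubgroup (h : IsMatSubgroup ℂ n G) {g : Matrix (Fin n) (Fin n) ℂ}
    (hg : g ∈ G) (m : ℕ) : g ^ m ∈ G := by
  induction m with
  | zero => simpa using h.1
  | succ m ih => rw [pow_succ]; exact h.2.1 _ ih _ hg

open scoped ComplexOrder in
theorem IsUnitaryForm.polar (h : IsUnitaryForm G) {g : Matrix (Fin n) (Fin n) ℂ} (hg : g ∈ G) :
    ∃ k ∈ G, ∃ A ∈ tangentAtOne G, star k * k = 1 ∧ star A = A ∧ g = k * exp A := by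
  set H := star g * g with hH
  have hHG : H ∈ G := h.isMatSubgroup.2.1 _ (h.star_mem hg) _ hg
  have hgu : IsUnit g := (h.isMatSubgroup.2.2 g hg).1
  have hpos : H.PosDef :=
    Matrix.PosDef.conjTranspose_mul_self g (Matrix.mulVec_injective_of_isUnit hgu)
  obtain ⟨U, d, hU, hUs, hHU, -, hd⟩ := exists_unitary_diagonalization hpos.1
  have hd := hd hpos
  set M : Matrix (Fin n) (Fin n) ℂ :=
    U * Matrix.diagonal (fun i => (Real.log (d i) : ℂ)) * U⁻¹ with hM
  have hexpM : exp M = H := by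
    have := exp_smul_conj_diagonal hU (fun i => (Real.log (d i) : ℂ)) 1
    rw [one_smul] at this
    rw [hM, this, hHU]
    congr 3
    funext i
    rw [one_mul, ← Complex.ofReal_exp, Real.exp_log (hd i)]
  have hMstar : star M = M := by
    rw [hM, star_mul, star_mul, ← hUs, star_star, Matrix.star_eq_conjTranspose (Matrix.diagonal _),
      Matrix.diagonal_conjTranspose, mul_assoc]
    congr 3
    funext i
    simp
  have hML : M ∈ tangentAtOne G := by
    rw [h.mem_tangentAtOne]
    intro t
    refine mem_of_isZClosedInGL h.isZClosedInGL (Matrix.isUnit_exp _) fun p hp => ?_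
    refine evalMat_exp_eq_zero hU (fun α β _ _ hαβ => ?_) (fun m => ?_) t
    · have hα : ∀ γ : Fin n →₀ ℕ, ∑ i, (γ i : ℂ) * (Real.log (d i) : ℂ) =
          ((∑ i, γ i * Real.log (d i) : ℝ) : ℂ) := by
        intro γ
        push_cast
        rfl
      rw [hα, hα] at hαβ ⊢
      rw [← Complex.ofReal_exp, ← Complex.ofReal_exp] at hαβ
      rw [Real.exp_injective (Complex.ofReal_injective hαβ)]
    · rw [← hM, Nat.cast_smul_eq_nsmul, Matrix.exp_nsmul, hexpM]
      exact hp _ (pow_mem_of_isMatSubgroup h.isMatSubgroup hHG m)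
  set A : Matrix (Fin n) (Fin n) ℂ := (1 / 2 : ℂ) • M with hA
  have hAL : A ∈ tangentAtOne G := Submodule.smul_mem _ _ hML
  have hAs : star A = A := by
    rw [hA, star_smul, hMstar]
    simp
  have hneg : exp (-A) ∈ G := by
    have := h.mem_tangentAtOne.1 hAL (-1)
    rwa [neg_one_smul] at this
  have h1 : exp (-A) * exp A = 1 := by
    rw [← Matrix.exp_add_of_commute _ _ (Commute.refl A).neg_left, neg_add_cancel, exp_zero]
  have h2 : H = exp A * exp A := by
    rw [← Matrix.exp_add_of_commute _ _ (Commute.refl A), ← hexpM, hA, ← add_smul]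
    norm_num
  refine ⟨g * exp (-A), h.isMatSubgroup.2.1 _ hg _ hneg, A, hAL, ?_, hAs, ?_⟩
  · have h3 : exp A * exp (-A) = 1 := mul_eq_one_comm.1 h1
    rw [star_mul, star_exp, star_neg, hAs]
    calc exp (-A) * star g * (g * exp (-A)) = exp (-A) * H * exp (-A) := by
          rw [hH]; simp only [mul_assoc]
      _ = (exp (-A) * exp A) * (exp A * exp (-A)) := by rw [h2]; simp only [mul_assoc]
      _ = 1 := by rw [h1, h3, one_mul]
  · rw [mul_assoc, h1, mul_one]

theorem exists_totalDegree_le (hZ : IsZClosedInGL ℂ n G) :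
    ∃ (P : Set (MvPolynomial (Fin n × Fin n) ℂ)) (D : ℕ), (∀ p ∈ P, p.totalDegree ≤ D) ∧
      G = {g | IsUnit g ∧ ∀ p ∈ P, evalMat g p = 0} := by
  obtain ⟨P, hP⟩ := hZ
  obtain ⟨s, hs⟩ := (isNoetherianRing_iff_ideal_fg _).1
    (inferInstance : IsNoetherianRing (MvPolynomial (Fin n × Fin n) ℂ)) (Ideal.span P)
  refine ⟨s, s.sup totalDegree, fun p hp => Finset.le_sup (f := totalDegree) hp, ?_⟩
  have key : ∀ (g : Matrix (Fin n) (Fin n) ℂ) (Q : Set (MvPolynomial (Fin n × Fin n) ℂ)),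
      (∀ p ∈ Q, evalMat g p = 0) ↔
        Ideal.span Q ≤ RingHom.ker (eval fun ij : Fin n × Fin n => g ij.1 ij.2) := by
    intro g Q
    rw [Ideal.span_le]
    rfl
  rw [hP]
  ext g
  refine and_congr_right fun _ => ?_
  rw [key, key, hs]

theorem IsUnitaryForm.near_one (h : IsUnitaryForm G) {ε : ℝ} (hε : 0 < ε) :
    ∃ δ > 0, ∀ k ∈ G, star k * k = 1 → ‖k - 1‖ < δ →
      ∃ X ∈ tangentAtOne G, star X = -X ∧ ‖X‖ < ε ∧ exp X = k := by
  obtain ⟨P, D, hPD, hGP⟩ := exists_totalDegree_le h.isZClosedInGL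
  have hder : HasStrictFDerivAt (exp : Matrix (Fin n) (Fin n) ℂ → Matrix (Fin n) (Fin n) ℂ)
      ((ContinuousLinearEquiv.refl ℂ (Matrix (Fin n) (Fin n) ℂ) :
        Matrix (Fin n) (Fin n) ℂ →L[ℂ] Matrix (Fin n) (Fin n) ℂ)) 0 :=
    hasStrictFDerivAt_exp_zero
  set F := hder.localInverse with hF
  have hleft := hder.eventually_left_inverse
  have hright := hder.eventually_right_inverse
  have htend := hder.localInverse_tendsto
  rw [exp_zero] at hright htend
  obtain ⟨r, hr, hrF⟩ := Metric.eventually_nhds_iff.1 hleft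
  set η := min (min ε r) (1 / (D + 1)) with hη
  have hη0 : 0 < η := by positivity
  have hev : ∀ᶠ k in 𝓝 (1 : Matrix (Fin n) (Fin n) ℂ), exp (F k) = k ∧ ‖F k‖ < η := by
    refine hright.and ?_
    have := htend.eventually (Metric.ball_mem_nhds (0 : Matrix (Fin n) (Fin n) ℂ) hη0)
    simpa using this
  obtain ⟨δ, hδ, hδk⟩ := Metric.eventually_nhds_iff.1 hev
  refine ⟨δ, hδ, fun k hk hku hk1 => ?_⟩
  obtain ⟨hX, hXη⟩ := hδk (y := k) (by rwa [dist_eq_norm])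
  set X := F k with hXdef
  have hXr : ‖X‖ < r := hXη.trans_le ((min_le_left _ _).trans (min_le_right _ _))
  have hXs : star X = -X := by
    have h1 : exp (-star X) = k := by
      rw [Matrix.exp_neg, ← star_exp, hX]
      exact Matrix.inv_eq_right_inv hku
    have h2 := hrF (y := -star X) (by simpa using hXr)
    have h3 : F k = -star X := by rw [← h1]; exact h2
    rw [← hXdef] at h3
    exact (neg_eq_iff_eq_neg.2 h3).symm
  refine ⟨X, h.mem_tangentAtOne.2 fun t => ?_, hXs,
    hXη.trans_le ((min_le_left _ _).trans (min_le_left _ _)), hX⟩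
  set A : Matrix (Fin n) (Fin n) ℂ := (-Complex.I) • X with hAdef
  have hAn : ‖A‖ = ‖X‖ := by simp [hAdef, norm_smul]
  have hAH : A.IsHermitian := by
    change star A = A
    rw [hAdef, star_smul, hXs]
    simp
  obtain ⟨U, d, hU, -, hAU, hdA, -⟩ := exists_unitary_diagonalization hAH
  have hXU : X = U * Matrix.diagonal (fun i => Complex.I * (d i : ℂ)) * U⁻¹ := by
    have h1 : X = Complex.I • A := by simp [hAdef, smul_smul]
    have h2 : (fun i => Complex.I * (d i : ℂ)) = Complex.I • fun i => (d i : ℂ) := rfl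
    rw [h1, h2, Matrix.diagonal_smul, mul_smul_comm, smul_mul_assoc, ← hAU]
  rw [hGP]
  refine ⟨Matrix.isUnit_exp _, fun p hp => ?_⟩
  rw [hXU]
  refine evalMat_exp_eq_zero hU (fun α β hα hβ hαβ => ?_) (fun m => ?_) t
  · have hsum : ∀ γ : Fin n →₀ ℕ, ∑ i, (γ i : ℂ) * (Complex.I * (d i : ℂ)) =
        ((∑ i, γ i * d i : ℝ) : ℂ) * Complex.I := by
      intro γ
      push_cast
      rw [Finset.sum_mul]
      exact Finset.sum_congr rfl fun i _ => by ring
    have hbd : ∀ γ : Fin n →₀ ℕ, (γ.sum fun _ e => e) ≤ p.totalDegree →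
        |∑ i, γ i * d i| ≤ 1 := by
      intro γ hγ
      have hγ' : (∑ i, (γ i : ℝ)) ≤ D := by
        rw [Finsupp.sum_fintype _ _ fun _ => rfl] at hγ
        exact_mod_cast hγ.trans (hPD p hp)
      calc |∑ i, γ i * d i| ≤ ∑ i, |γ i * d i| := Finset.abs_sum_le_sum_abs _ _
        _ ≤ ∑ i, (γ i : ℝ) * (1 / (D + 1)) := by
            refine Finset.sum_le_sum fun i _ => ?_
            rw [abs_mul, Nat.abs_cast]
            refine mul_le_mul_of_nonneg_left ?_ (Nat.cast_nonneg _)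
            exact (hdA i).trans (hAn.le.trans (hXη.le.trans (min_le_right _ _)))
        _ = (∑ i, (γ i : ℝ)) * (1 / (D + 1)) := (Finset.sum_mul _ _ _).symm
        _ ≤ D * (1 / (D + 1)) := by gcongr
        _ ≤ 1 := by
            rw [mul_one_div, div_le_one (by positivity)]
            linarith
    rw [hsum, hsum] at hαβ ⊢
    obtain ⟨m, hm⟩ := Complex.exp_eq_exp_iff_exists_int.1 hαβ
    set a : ℝ := ∑ i, α i * d i
    set b : ℝ := ∑ i, β i * d i
    have hab : a = b + m * (2 * Real.pi) := by
      have h1 : (a : ℂ) * Complex.I = ((b + m * (2 * Real.pi) : ℝ) : ℂ) * Complex.I := by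
        rw [hm]; push_cast; ring
      exact_mod_cast mul_right_cancel₀ Complex.I_ne_zero h1
    have hm0 : m = 0 := by
      by_contra hm0
      have h1 : (1 : ℝ) ≤ |(m : ℝ)| := by exact_mod_cast Int.one_le_abs hm0
      have h2 : |a - b| ≤ 2 := (abs_sub a b).trans (by linarith [hbd α hα, hbd β hβ])
      have h3 : a - b = m * (2 * Real.pi) := by rw [hab]; ring
      rw [h3, abs_mul, abs_of_pos (by positivity : (0 : ℝ) < 2 * Real.pi)] at h2
      nlinarith [Real.pi_gt_three]
    rw [hab, hm0]
    simp
  · rw [← hXU, Nat.cast_smul_eq_nsmul, Matrix.exp_nsmul, hX]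
    have := pow_mem_of_isMatSubgroup h.isMatSubgroup hk m
    rw [hGP] at this
    exact this.2 p hp

end UnitaryForm

section UnitaryFormCore

open NormedSpace Filter Topology

open scoped Matrix.Norms.L2Operator

variable {n : ℕ} {G : Set (Matrix (Fin n) (Fin n) ℂ)}

/-- The operator on Euclidean space defined by a matrix. -/
abbrev euclOp (g : Matrix (Fin n) (Fin n) ℂ) :
    EuclideanSpace ℂ (Fin n) →L[ℂ] EuclideanSpace ℂ (Fin n) :=
  Matrix.toEuclideanCLM (𝕜 := ℂ) g

theorem norm_euclOp (g : Matrix (Fin n) (Fin n) ℂ) : ‖euclOp g‖ = ‖g‖ := rfl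

theorem continuous_euclOp :
    Continuous (euclOp : Matrix (Fin n) (Fin n) ℂ → _) := by
  refine Isometry.continuous (isometry_iff_dist_eq.2 fun a b => ?_)
  rw [dist_eq_norm, dist_eq_norm, ← norm_euclOp (a - b)]
  simp [euclOp]

theorem continuous_euclOp_symm :
    Continuous fun T : EuclideanSpace ℂ (Fin n) →L[ℂ] EuclideanSpace ℂ (Fin n) =>
      (Matrix.toEuclideanCLM (𝕜 := ℂ) (n := Fin n)).symm T := by
  refine Isometry.continuous (isometry_iff_dist_eq.2 fun a b => ?_)
  rw [dist_eq_norm, dist_eq_norm, ← norm_euclOp]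
  simp [euclOp]

theorem euclOp_exp (A : Matrix (Fin n) (Fin n) ℂ) : euclOp (exp A) = exp (euclOp A) :=
  map_exp_of_mem_ball (𝕂 := ℂ) (Matrix.toEuclideanCLM (𝕜 := ℂ) (n := Fin n)) continuous_euclOp A <|
    (expSeries_radius_eq_top ℂ (Matrix (Fin n) (Fin n) ℂ)).symm ▸ edist_lt_top _ _

theorem euclOp_injective : Function.Injective (euclOp (n := n)) :=
  (Matrix.toEuclideanCLM (𝕜 := ℂ) (n := Fin n)).injective

theorem euclOp_mul (a b : Matrix (Fin n) (Fin n) ℂ) : euclOp (a * b) = euclOp a * euclOp b :=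
  map_mul _ a b

theorem euclOp_one : euclOp (1 : Matrix (Fin n) (Fin n) ℂ) = 1 := map_one _

theorem euclOp_star (a : Matrix (Fin n) (Fin n) ℂ) : euclOp (star a) = star (euclOp a) :=
  map_star _ a

theorem euclOp_smul (t : ℂ) (a : Matrix (Fin n) (Fin n) ℂ) : euclOp (t • a) = t • euclOp a :=
  map_smul _ t a

/-- The Lie algebra of the group of operators defined by `G`. -/
def euclLie (G : Set (Matrix (Fin n) (Fin n) ℂ)) :
    Submodule ℂ (EuclideanSpace ℂ (Fin n) →L[ℂ] EuclideanSpace ℂ (Fin n)) :=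
  (tangentAtOne G).map (Matrix.toEuclideanCLM (𝕜 := ℂ) (n := Fin n)).toAlgEquiv.toLinearMap

theorem euclOp_mem_euclLie {A : Matrix (Fin n) (Fin n) ℂ} :
    euclOp A ∈ euclLie G ↔ A ∈ tangentAtOne G := by
  constructor
  · rintro ⟨B, hB, h⟩
    exact euclOp_injective h ▸ hB
  · exact fun h => ⟨A, h, rfl⟩

theorem exists_euclOp_eq (T : EuclideanSpace ℂ (Fin n) →L[ℂ] EuclideanSpace ℂ (Fin n)) :
    ∃ A, euclOp A = T :=
  (Matrix.toEuclideanCLM (𝕜 := ℂ) (n := Fin n)).surjective T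

theorem isClosed_unitary_inter (hZ : IsZClosedInGL ℂ n G) :
    IsClosed {k : Matrix (Fin n) (Fin n) ℂ | k ∈ G ∧ star k * k = 1} := by
  obtain ⟨P, hP⟩ := hZ
  have : {k : Matrix (Fin n) (Fin n) ℂ | k ∈ G ∧ star k * k = 1} =
      {k | star k * k = 1} ∩ ⋂ p ∈ P, {k | evalMat k p = 0} := by
    ext k
    simp only [hP, Set.mem_ofPred_eq, Set.mem_inter_iff, Set.mem_iInter]
    constructor
    · rintro ⟨⟨_, h⟩, hk⟩
      exact ⟨hk, h⟩
    · rintro ⟨hk, h⟩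
      exact ⟨⟨IsUnit.of_mul_eq_one_right _ hk, h⟩, hk⟩
  rw [this]
  refine IsClosed.inter (isClosed_eq (by fun_prop) continuous_const) ?_
  exact isClosed_biInter fun p _ => isClosed_eq (continuous_evalMat p) continuous_const

theorem IsUnitaryForm.isCoreGroup (h : IsUnitaryForm G) :
    IsCoreGroup (euclOp '' G) (euclLie G) where
  one_mem := ⟨1, h.isMatSubgroup.1, euclOp_one⟩
  mul_mem := by
    rintro _ ⟨a, ha, rfl⟩ _ ⟨b, hb, rfl⟩
    exact ⟨a * b, h.isMatSubgroup.2.1 a ha b hb, euclOp_mul a b⟩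
  inv_mem := by
    rintro _ ⟨a, ha, rfl⟩
    obtain ⟨hu, hi⟩ := h.isMatSubgroup.2.2 a ha
    have hd := (Matrix.isUnit_iff_isUnit_det a).1 hu
    refine ⟨_, ⟨a⁻¹, hi, rfl⟩, ?_, ?_⟩
    · rw [← euclOp_mul, Matrix.nonsing_inv_mul _ hd, euclOp_one]
    · rw [← euclOp_mul, Matrix.mul_nonsing_inv _ hd, euclOp_one]
  star_mem := by
    rintro _ ⟨a, ha, rfl⟩
    exact ⟨star a, h.star_mem ha, euclOp_star a⟩
  mem_lie := by
    intro X
    obtain ⟨A, rfl⟩ := exists_euclOp_eq X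
    rw [euclOp_mem_euclLie, h.mem_tangentAtOne]
    refine forall_congr' fun t => ?_
    rw [← euclOp_smul, ← euclOp_exp, euclOp_injective.mem_set_image]
  near_one := by
    intro ε hε
    obtain ⟨δ, hδ, H⟩ := h.near_one hε
    refine ⟨δ, hδ, ?_⟩
    rintro _ ⟨k, hk, rfl⟩ hku hkn
    rw [← euclOp_star, ← euclOp_mul, ← euclOp_one] at hku
    have hkn' : ‖k - 1‖ < δ := by
      rw [← norm_euclOp]
      simpa [euclOp] using hkn
    obtain ⟨X, hX, hs, hn, he⟩ := H k hk (euclOp_injective hku) hkn'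
    refine ⟨euclOp X, euclOp_mem_euclLie.2 hX, ?_, hn, ?_⟩
    · rw [← euclOp_star, hs]
      exact map_neg _ X
    · rw [← euclOp_exp, he]
  polar := by
    rintro _ ⟨g, hg, rfl⟩
    obtain ⟨k, hk, A, hA, h1, h2, h3⟩ := h.polar hg
    refine ⟨_, ⟨k, hk, rfl⟩, euclOp A, euclOp_mem_euclLie.2 hA, ?_, ?_, ?_⟩
    · rw [← euclOp_star, ← euclOp_mul, h1, euclOp_one]
    · rw [← euclOp_star, h2]
    · rw [h3, euclOp_mul, euclOp_exp]
  closed := by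
    have := (isClosed_unitary_inter h.isZClosedInGL).preimage (continuous_euclOp_symm (n := n))
    convert this using 1
    ext T
    obtain ⟨A, rfl⟩ := exists_euclOp_eq T
    simp only [Set.mem_ofPred_eq, Set.mem_preimage, euclOp_injective.mem_set_image,
      StarAlgEquiv.symm_apply_apply]
    rw [← euclOp_star, ← euclOp_mul, ← euclOp_one, euclOp_injective.eq_iff]

end UnitaryFormCore

section Averaging

open MeasureTheory Filter Topology

open scoped Matrix.Norms.L2Operator ComplexOrder MatrixOrder

variable {n : ℕ} {K : Type*} [TopologicalSpace K] [CompactSpace K] [MeasurableSpace K]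
  [BorelSpace K] {μ : Measure K} [IsProbabilityMeasure μ] [Group K] [ContinuousMul K]
  [μ.IsMulRightInvariant]

theorem exists_unitarizer (ρ : K →* Matrix (Fin n) (Fin n) ℂ) (hρ : Continuous ρ)
    (μ : Measure K) [IsProbabilityMeasure μ] [μ.IsMulRightInvariant] :
    ∃ T : Matrix (Fin n) (Fin n) ℂ, IsUnit T ∧
      ∀ k, star (T * ρ k * T⁻¹) * (T * ρ k * T⁻¹) = 1 := by
  set Q : Matrix (Fin n) (Fin n) ℂ := ∫ k, star (ρ k) * ρ k ∂μ with hQ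
  have hint : Integrable (fun k => star (ρ k) * ρ k) μ :=
    integrable_of_continuous_compactSpace (hρ.star.mul hρ)
  have hinv : ∀ h, star (ρ h) * Q * ρ h = Q := by
    intro h
    have h1 : ∫ k, star (ρ (k * h)) * ρ (k * h) ∂μ = Q :=
      integral_mul_right_eq_self (μ := μ) (fun k => star (ρ k) * ρ k) h
    let ℓ : Matrix (Fin n) (Fin n) ℂ →L[ℂ] Matrix (Fin n) (Fin n) ℂ :=
      LinearMap.toContinuousLinearMap
        { toFun := fun A => star (ρ h) * A * ρ h
          map_add' := fun a b => by rw [mul_add, add_mul]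
          map_smul' := fun c a => by simp }
    have h2 : ∫ k, ℓ (star (ρ k) * ρ k) ∂μ = ℓ Q := ℓ.integral_comp_comm hint
    refine Eq.trans (h2.symm.trans (integral_congr_ae (Eventually.of_forall fun k => ?_))) h1
    simp [ℓ, map_mul, mul_assoc, star_mul]
  have hform : ∀ x : Fin n → ℂ, star x ⬝ᵥ (Q.mulVec x) =
      ((∫ k, ‖WithLp.toLp 2 ((ρ k).mulVec x)‖ ^ 2 ∂μ : ℝ) : ℂ) := by
    intro x
    let ℓ : Matrix (Fin n) (Fin n) ℂ →L[ℂ] ℂ :=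
      LinearMap.toContinuousLinearMap
        { toFun := fun A => star x ⬝ᵥ (A.mulVec x)
          map_add' := fun a b => by simp [Matrix.add_mulVec]
          map_smul' := fun c a => by simp [Matrix.smul_mulVec] }
    have h2 : ∫ k, ℓ (star (ρ k) * ρ k) ∂μ = ℓ Q := ℓ.integral_comp_comm hint
    refine h2.symm.trans ?_
    rw [← integral_complex_ofReal]
    refine integral_congr_ae (Eventually.of_forall fun k => ?_)
    have h3 : ℓ (star (ρ k) * ρ k) = star ((ρ k).mulVec x) ⬝ᵥ ((ρ k).mulVec x) := by
      simp [ℓ, Matrix.star_mulVec, Matrix.star_eq_conjTranspose, Matrix.dotProduct_mulVec,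
        Matrix.vecMul_vecMul]
    simp only [h3]
    rw [EuclideanSpace.norm_sq_eq]
    simp [dotProduct, Complex.mul_conj, mul_comm, Complex.normSq_eq_norm_sq]
  have hpos : Q.PosDef := by
    refine Matrix.PosDef.of_dotProduct_mulVec_pos ?_ fun x hx => ?_
    · have h2 : ∫ k, starL' ℝ (A := Matrix (Fin n) (Fin n) ℂ) (star (ρ k) * ρ k) ∂μ = starL' ℝ Q :=
        (starL' ℝ (A := Matrix (Fin n) (Fin n) ℂ)).toContinuousLinearMap.integral_comp_comm hint
      refine h2.symm.trans ?_
      simp [hQ]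
    · rw [hform]
      have hc : Continuous fun k => ‖WithLp.toLp 2 ((ρ k).mulVec x)‖ ^ 2 := by fun_prop
      obtain ⟨k₀, -, hk₀⟩ := isCompact_univ.exists_isMinOn (Set.univ_nonempty (α := K)) hc.continuousOn
      have hne : (ρ k₀).mulVec x ≠ 0 := by
        intro h0
        apply hx
        have : (ρ k₀⁻¹).mulVec ((ρ k₀).mulVec x) = x := by
          rw [Matrix.mulVec_mulVec, ← map_mul]
          simp
        rw [← this, h0, Matrix.mulVec_zero]
      have h0 : 0 < ‖WithLp.toLp 2 ((ρ k₀).mulVec x)‖ ^ 2 := by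
        have : WithLp.toLp 2 ((ρ k₀).mulVec x) ≠ 0 := by simpa using hne
        positivity
      have h4 : ∫ _k, ‖WithLp.toLp 2 ((ρ k₀).mulVec x)‖ ^ 2 ∂μ ≤
          ∫ k, ‖WithLp.toLp 2 ((ρ k).mulVec x)‖ ^ 2 ∂μ :=
        integral_mono (integrable_const _) (integrable_of_continuous_compactSpace hc)
          fun k => hk₀ (Set.mem_univ k)
      rw [integral_const] at h4
      simp only [probReal_univ, one_smul] at h4
      exact_mod_cast h0.trans_le h4
  obtain ⟨T, hT⟩ := CStarAlgebra.nonneg_iff_eq_star_mul_self.1 hpos.posSemidef.nonneg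
  have hTu : IsUnit T := by
    have hq := hpos.isUnit
    rw [hT] at hq
    exact isUnit_of_mul_isUnit_right hq
  have hd := (Matrix.isUnit_iff_isUnit_det T).1 hTu
  refine ⟨T, hTu, fun k => ?_⟩
  have h5 := hinv k
  rw [hT] at h5
  have hst : star T⁻¹ * star T = 1 := by rw [← star_mul, Matrix.mul_nonsing_inv _ hd, star_one]
  calc star (T * ρ k * T⁻¹) * (T * ρ k * T⁻¹)
      = star T⁻¹ * (star (ρ k) * (star T * T) * ρ k) * T⁻¹ := by simp only [star_mul, mul_assoc]
    _ = (star T⁻¹ * star T) * (T * T⁻¹) := by rw [h5]; simp only [mul_assoc]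
    _ = 1 := by rw [hst, Matrix.mul_nonsing_inv _ hd, one_mul]

/-- The polynomial `v ↦ f (ρ k v)` with coefficients continuous functions of `k`. -/
def genericTranslate (ρ : K →* Matrix (Fin n) (Fin n) ℂ) (hρ : Continuous ρ)
    (f : MvPolynomial (Fin n) ℂ) : MvPolynomial (Fin n) C(K, ℂ) :=
  aeval (fun j => ∑ i, C (⟨fun k => ρ k j i, by fun_prop⟩ : C(K, ℂ)) * X i) f

theorem eval_genericTranslate (ρ : K →* Matrix (Fin n) (Fin n) ℂ) (hρ : Continuous ρ)
    (f : MvPolynomial (Fin n) ℂ) (k : K) (v : Fin n → ℂ) :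
    eval₂ (ContinuousMap.evalAlgHom ℂ ℂ k : C(K, ℂ) →+* ℂ) v (genericTranslate ρ hρ f) =
      eval ((ρ k).mulVec v) f := by
  unfold genericTranslate
  induction f using MvPolynomial.induction_on with
  | C a =>
    simp only [algHom_C, eval_C]
    rw [MvPolynomial.algebraMap_apply, eval₂_C]
    rfl
  | add p q hp hq => rw [map_add, eval₂_add, hp, hq, map_add]
  | mul_X p j hp =>
    rw [map_mul, eval₂_mul, hp, map_mul, aeval_X, eval_X]
    simp only [eval₂_sum, eval₂_mul, eval₂_C, eval₂_X, Matrix.mulVec, dotProduct]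
    rfl

theorem exists_average (ρ : K →* Matrix (Fin n) (Fin n) ℂ) (hρ : Continuous ρ)
    (μ : Measure K) [IsProbabilityMeasure μ] (f : MvPolynomial (Fin n) ℂ) :
    ∃ p : MvPolynomial (Fin n) ℂ, ∀ v, eval v p = ∫ k, eval ((ρ k).mulVec v) f ∂μ := by
  set P := genericTranslate ρ hρ f with hP
  refine ⟨∑ m ∈ P.support, monomial m (∫ k, P.coeff m k ∂μ), fun v => ?_⟩
  simp only [map_sum, eval_monomial, ← eval_genericTranslate ρ hρ f]
  simp only [eval₂_eq, ← hP]
  rw [integral_finsetSum]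
  · refine Finset.sum_congr rfl fun m _ => ?_
    rw [← integral_mul_const]
    rfl
  · intro m _
    exact (integrable_of_continuous_compactSpace (P.coeff m).continuous).mul_const _

end Averaging

section CompactMatrixGroup

open MeasureTheory Filter Topology InnerProductSpace

open scoped Matrix.Norms.L2Operator

variable {n : ℕ} {G K : Set (Matrix (Fin n) (Fin n) ℂ)}

theorem invariant_of_dense (hKG : ∀ p : MvPolynomial (Fin n × Fin n) ℂ,
      (∀ k ∈ K, evalMat k p = 0) → ∀ g ∈ G, evalMat g p = 0)
    {p : MvPolynomial (Fin n) ℂ} (hp : Invariant ℂ n K p) : Invariant ℂ n G p := by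
  intro g hg v
  set q : MvPolynomial (Fin n × Fin n) ℂ :=
    bind₁ (fun i => ∑ j, C (v j) * X (i, j)) p - C (eval v p) with hq
  have hev : ∀ x : Matrix (Fin n) (Fin n) ℂ,
      evalMat x q = eval (x.mulVec v) p - eval v p := by
    intro x
    rw [hq, evalMat, map_sub, eval_C]
    congr 1
    rw [← MvPolynomial.coe_aeval_eq_eval, ← MvPolynomial.coe_aeval_eq_eval]
    simp only [RingHom.coe_coe, aeval_bind₁]
    congr 2
    ext i
    simp [Matrix.mulVec, dotProduct, mul_comm]
  have := hKG q (fun k hk => by rw [hev, hp k hk v, sub_self]) g hg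
  rwa [hev, sub_eq_zero] at this

/-- The group structure on a subgroup of the general linear group. -/
abbrev matGroup (hK : IsMatSubgroup ℂ n K) : Group K :=
  letI : Mul K := ⟨fun a b => ⟨a * b, hK.2.1 a a.2 b b.2⟩⟩
  letI : One K := ⟨⟨1, hK.1⟩⟩
  letI : Inv K := ⟨fun a => ⟨(a : Matrix (Fin n) (Fin n) ℂ)⁻¹, (hK.2.2 a a.2).2⟩⟩
  Group.ofLeftAxioms (fun a b c => Subtype.ext (mul_assoc a.1 b.1 c.1))
    (fun a => Subtype.ext (one_mul a.1))
    fun a => Subtype.ext (Matrix.nonsing_inv_mul _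
      ((Matrix.isUnit_iff_isUnit_det _).1 (hK.2.2 a a.2).1))

/-- The inclusion of a subgroup of the general linear group. -/
def matGroupHom (hK : IsMatSubgroup ℂ n K) :
    letI := matGroup hK
    K →* Matrix (Fin n) (Fin n) ℂ :=
  letI := matGroup hK
  { toFun := Subtype.val
    map_one' := rfl
    map_mul' := fun _ _ => rfl }

theorem isTopologicalGroup_matGroup (hK : IsMatSubgroup ℂ n K) :
    let := matGroup hK
    IsTopologicalGroup K := by
  let := matGroup hK
  refine { continuous_mul := ?_, continuous_inv := ?_ }
  · exact Continuous.subtype_mk ((continuous_subtype_val.comp continuous_fst).mul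
      (continuous_subtype_val.comp continuous_snd)) _
  · refine Continuous.subtype_mk (f := fun a : K => (a : Matrix (Fin n) (Fin n) ℂ)⁻¹) ?_ _
    refine continuous_iff_continuousAt.2 fun a => ?_
    obtain ⟨u, hu⟩ := (hK.2.2 a a.2).1
    have h1 := NormedRing.inverse_continuousAt u
    rw [hu] at h1
    have h2 : (fun a : K => (a : Matrix (Fin n) (Fin n) ℂ)⁻¹) =
        fun a : K => Ring.inverse (a : Matrix (Fin n) (Fin n) ℂ) := by
      ext1 a
      exact Matrix.nonsing_inv_eq_ringInverse _
    rw [h2]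
    exact ContinuousAt.comp (f := (Subtype.val : K → _)) h1 continuous_subtype_val.continuousAt

theorem exists_invariant_measure {K : Type*} [TopologicalSpace K] [CompactSpace K] [Group K]
    [IsTopologicalGroup K] [MeasurableSpace K] [BorelSpace K] :
    ∃ μ : Measure K, IsProbabilityMeasure μ ∧ μ.IsMulLeftInvariant ∧ μ.IsMulRightInvariant := by
  set μ : Measure K := Measure.haarMeasure ⊤ with hμ
  have hp : IsProbabilityMeasure μ := ⟨Measure.haarMeasure_self (K₀ := ⊤)⟩
  refine ⟨μ, hp, inferInstance, ⟨fun g => ?_⟩⟩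
  have : IsProbabilityMeasure (μ.map (· * g)) :=
    Measure.isProbabilityMeasure_map (continuous_mul_const g).measurable.aemeasurable
  exact Measure.isHaarMeasure_eq_of_isProbabilityMeasure _ _

theorem exists_unitarizer_of_isCompact (hK : IsMatSubgroup ℂ n K) (hKc : IsCompact K) :
    ∃ T : Matrix (Fin n) (Fin n) ℂ, IsUnit T ∧
      ∀ k ∈ K, star (T * k * T⁻¹) * (T * k * T⁻¹) = 1 := by
  let := matGroup hK
  have := isTopologicalGroup_matGroup hK
  have := isCompact_iff_compactSpace.1 hKc
  let : MeasurableSpace K := borel K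
  have : BorelSpace K := ⟨rfl⟩
  obtain ⟨μ, h1, h2, h3⟩ := exists_invariant_measure (K := K)
  obtain ⟨T, hT, h⟩ := exists_unitarizer (matGroupHom hK) continuous_subtype_val μ
  exact ⟨T, hT, fun k hk => h ⟨k, hk⟩⟩

theorem exists_mulVec_eq_of_invariants (hK : IsMatSubgroup ℂ n K) (hKc : IsCompact K)
    {T : Matrix (Fin n) (Fin n) ℂ} (hT : IsUnit T)
    (hTK : ∀ k ∈ K, star (T * k * T⁻¹) * (T * k * T⁻¹) = 1) {v w : Fin n → ℂ}
    (hinv : ∀ p, Invariant ℂ n K p → eval w p = eval v p)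
    (him : ∀ ε > 0, ∃ η > 0, ∀ k ∈ K,
      ‖euclOp (T * k * T⁻¹) (WithLp.toLp 2 (T.mulVec v)) - WithLp.toLp 2 (T.mulVec v)‖ < η →
      |Complex.im ⟪WithLp.toLp 2 (T.mulVec v),
        euclOp (T * k * T⁻¹) (WithLp.toLp 2 (T.mulVec v))⟫_ℂ| ≤
      ε * ‖euclOp (T * k * T⁻¹) (WithLp.toLp 2 (T.mulVec v)) -
        WithLp.toLp 2 (T.mulVec v)‖ ^ 2)
    (hwv : ‖WithLp.toLp 2 (T.mulVec w)‖ ≤ ‖WithLp.toLp 2 (T.mulVec v)‖) :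
    ∃ k ∈ K, k.mulVec w = v := by
  let := matGroup hK
  have := isTopologicalGroup_matGroup hK
  have := isCompact_iff_compactSpace.1 hKc
  let : MeasurableSpace K := borel K
  have : BorelSpace K := ⟨rfl⟩
  obtain ⟨μ, h1, h2, h3⟩ := exists_invariant_measure (K := K)
  have hd := (Matrix.isUnit_iff_isUnit_det T).1 hT
  have hT1 : T⁻¹ * T = 1 := Matrix.nonsing_inv_mul _ hd
  have hT2 : T * T⁻¹ = 1 := Matrix.mul_nonsing_inv _ hd
  let ρ : K →* (EuclideanSpace ℂ (Fin n) →L[ℂ] EuclideanSpace ℂ (Fin n)) :=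
    { toFun := fun k => euclOp (T * k * T⁻¹)
      map_one' := by
        rw [← euclOp_one]
        congr 1
        exact (congrArg (· * T⁻¹) (mul_one T)).trans hT2
      map_mul' := fun a b => by
        rw [← euclOp_mul]
        congr 1
        calc T * (a.1 * b.1) * T⁻¹ = T * a.1 * 1 * b.1 * T⁻¹ := by simp only [mul_assoc, one_mul]
          _ = _ := by rw [← hT1]; simp only [mul_assoc] }
  have hρk : ∀ k : K, ρ k = euclOp (T * (k : Matrix (Fin n) (Fin n) ℂ) * T⁻¹) := fun _ => rfl
  have hρ : Continuous fun k => ρ k := by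
    simp only [hρk]
    have h : Continuous fun k : K => T * (k : Matrix (Fin n) (Fin n) ℂ) * T⁻¹ :=
      (continuous_const.mul continuous_subtype_val).mul continuous_const
    exact continuous_euclOp.comp h
  have hρT : ∀ (k : K) (u : Fin n → ℂ), ρ k (WithLp.toLp 2 (T.mulVec u)) =
      WithLp.toLp 2 (T.mulVec (k.1.mulVec u)) := by
    intro k u
    rw [hρk, euclOp, Matrix.toEuclideanCLM_toLp, Matrix.mulVec_mulVec, Matrix.mulVec_mulVec, mul_assoc,
      hT1, mul_one]
  have hiso : ∀ k x, ‖ρ k x‖ = ‖x‖ := by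
    intro k x
    refine norm_apply_of_star_mul_self ?_ x
    rw [hρk, ← euclOp_star, ← euclOp_mul, hTK k k.2, euclOp_one]
  set V : EuclideanSpace ℂ (Fin n) := WithLp.toLp 2 (T.mulVec v) with hV
  have hmom : ∀ j : ℕ, ∫ k, ⟪V, ρ k V⟫_ℂ ^ j ∂μ =
      ∫ k, ⟪V, ρ k (WithLp.toLp 2 (T.mulVec w))⟫_ℂ ^ j ∂μ := by
    intro j
    set f : MvPolynomial (Fin n) ℂ :=
      (∑ i, C (star (V i)) * ∑ l, C (T i l) * X l) ^ j with hf
    have hfe : ∀ u : Fin n → ℂ, eval u f = ⟪V, WithLp.toLp 2 (T.mulVec u)⟫_ℂ ^ j := by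
      intro u
      simp [hf, PiLp.inner_apply, Matrix.mulVec, dotProduct, mul_comm]
    obtain ⟨p, hp⟩ := exists_average (matGroupHom hK) continuous_subtype_val μ f
    have hpe : ∀ u, eval u p = ∫ k, ⟪V, ρ k (WithLp.toLp 2 (T.mulVec u))⟫_ℂ ^ j ∂μ := by
      intro u
      rw [hp u]
      refine integral_congr_ae (Eventually.of_forall fun k => ?_)
      simp only [hfe, hρT]
      rfl
    have hpi : Invariant ℂ n K p := by
      intro g hg u
      rw [hp, hp]
      rw [← integral_mul_right_eq_self (μ := μ)
        (fun k => eval ((matGroupHom hK k).mulVec u) f) (⟨g, hg⟩ : K)]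
      refine integral_congr_ae (Eventually.of_forall fun k => ?_)
      simp only [map_mul]
      rw [← Matrix.mulVec_mulVec]
      rfl
    rw [← hpe, hV, ← hpe, hinv p hpi]
  obtain ⟨k, hk⟩ := exists_apply_eq_of_moments (μ := μ) ρ hρ hiso
    (fun ε hε => (him ε hε).imp fun η h => ⟨h.1, fun k => h.2 k k.2⟩) hwv hmom
  refine ⟨k, k.2, ?_⟩
  rw [hρT] at hk
  exact Matrix.mulVec_injective_of_isUnit hT (WithLp.toLp_injective 2 hk)

end CompactMatrixGroup

section UnitaryFrame

open Filter Topology InnerProductSpace NormedSpace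

open scoped Matrix.Norms.L2Operator

variable {n : ℕ} {G K : Set (Matrix (Fin n) (Fin n) ℂ)} {T : Matrix (Fin n) (Fin n) ℂ}

/-- The linear map `u ↦ T u` into Euclidean space. -/
def toFrame (T : Matrix (Fin n) (Fin n) ℂ) : (Fin n → ℂ) →ₗ[ℂ] EuclideanSpace ℂ (Fin n) :=
  (WithLp.linearEquiv 2 ℂ (Fin n → ℂ)).symm.toLinearMap ∘ₗ T.mulVecLin

theorem toFrame_apply (T : Matrix (Fin n) (Fin n) ℂ) (u : Fin n → ℂ) :
    toFrame T u = WithLp.toLp 2 (T.mulVec u) := rfl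

theorem euclOp_toFrame (g : Matrix (Fin n) (Fin n) ℂ) (u : Fin n → ℂ) :
    euclOp g (toFrame T u) = toFrame (g * T) u := by
  rw [toFrame_apply, toFrame_apply, euclOp, Matrix.toEuclideanCLM_toLp, Matrix.mulVec_mulVec]

theorem toFrame_mul (g : Matrix (Fin n) (Fin n) ℂ) (u : Fin n → ℂ) :
    toFrame (T * g) u = toFrame T (g.mulVec u) := by
  rw [toFrame_apply, toFrame_apply, Matrix.mulVec_mulVec]

/-- The group conjugate to `G` by `T`. -/
def conjSet (T : Matrix (Fin n) (Fin n) ℂ) (G : Set (Matrix (Fin n) (Fin n) ℂ)) :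
    Set (Matrix (Fin n) (Fin n) ℂ) :=
  (fun g => T * g * T⁻¹) '' G

theorem inv_conj_mul (hT : IsUnit T) (a : Matrix (Fin n) (Fin n) ℂ) :
    T⁻¹ * (T * a * T⁻¹) * T = a := by
  have hd := (Matrix.isUnit_iff_isUnit_det T).1 hT
  have h1 : T⁻¹ * T = 1 := Matrix.nonsing_inv_mul _ hd
  calc T⁻¹ * (T * a * T⁻¹) * T = (T⁻¹ * T) * a * (T⁻¹ * T) := by simp only [mul_assoc]
    _ = a := by rw [h1, one_mul, mul_one]

theorem conj_inv_mul (hT : IsUnit T) (a : Matrix (Fin n) (Fin n) ℂ) :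
    T * (T⁻¹ * a * T) * T⁻¹ = a := by
  have hd := (Matrix.isUnit_iff_isUnit_det T).1 hT
  have h1 : T * T⁻¹ = 1 := Matrix.mul_nonsing_inv _ hd
  calc T * (T⁻¹ * a * T) * T⁻¹ = (T * T⁻¹) * a * (T * T⁻¹) := by simp only [mul_assoc]
    _ = a := by rw [h1, one_mul, mul_one]

theorem conj_mul_conj (hT : IsUnit T) (a b : Matrix (Fin n) (Fin n) ℂ) :
    (T * a * T⁻¹) * (T * b * T⁻¹) = T * (a * b) * T⁻¹ := by
  have hd := (Matrix.isUnit_iff_isUnit_det T).1 hT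
  have h1 : T⁻¹ * T = 1 := Matrix.nonsing_inv_mul _ hd
  calc (T * a * T⁻¹) * (T * b * T⁻¹) = T * a * (T⁻¹ * T) * b * T⁻¹ := by simp only [mul_assoc]
    _ = _ := by rw [h1, mul_one]; simp only [mul_assoc]

theorem conj_inv (hT : IsUnit T) (a : Matrix (Fin n) (Fin n) ℂ) :
    (T * a * T⁻¹)⁻¹ = T * a⁻¹ * T⁻¹ := by
  rw [Matrix.mul_inv_rev, Matrix.mul_inv_rev, Matrix.nonsing_inv_nonsing_inv _
    ((Matrix.isUnit_iff_isUnit_det T).1 hT), mul_assoc]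

theorem mem_conjSet (hT : IsUnit T) {a : Matrix (Fin n) (Fin n) ℂ} :
    T * a * T⁻¹ ∈ conjSet T G ↔ a ∈ G := by
  constructor
  · rintro ⟨b, hb, h⟩
    have := congrArg (fun x => T⁻¹ * x * T) h
    simp only [inv_conj_mul hT] at this
    exact this ▸ hb
  · exact fun h => ⟨a, h, rfl⟩

theorem isMatSubgroup_conjSet (hT : IsUnit T) (h : IsMatSubgroup ℂ n G) :
    IsMatSubgroup ℂ n (conjSet T G) := by
  have hd := (Matrix.isUnit_iff_isUnit_det T).1 hT
  refine ⟨⟨1, h.1, by simp [Matrix.mul_nonsing_inv _ hd]⟩, ?_, ?_⟩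
  · rintro _ ⟨a, ha, rfl⟩ _ ⟨b, hb, rfl⟩
    exact ⟨a * b, h.2.1 a ha b hb, (conj_mul_conj hT a b).symm⟩
  · rintro _ ⟨a, ha, rfl⟩
    obtain ⟨h1, h2⟩ := h.2.2 a ha
    exact ⟨(hT.mul h1).mul ((Matrix.isUnit_nonsing_inv_iff).2 hT), a⁻¹, h2, (conj_inv hT a).symm⟩

theorem isZClosedInGL_conjSet (hT : IsUnit T) (h : IsZClosedInGL ℂ n G) :
    IsZClosedInGL ℂ n (conjSet T G) := by
  obtain ⟨P, hP⟩ := h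
  refine ⟨mulPoly T⁻¹ T '' P, ?_⟩
  ext x
  have hx : x ∈ conjSet T G ↔ T⁻¹ * x * T ∈ G := by
    rw [← mem_conjSet hT (a := T⁻¹ * x * T), conj_inv_mul hT]
  rw [hx, hP]
  simp only [Set.mem_ofPred_eq, Set.forall_mem_image]
  have hTi : IsUnit T⁻¹ := Matrix.isUnit_nonsing_inv_iff.2 hT
  refine and_congr ⟨fun hu => ?_, fun hu => (hTi.mul hu).mul hT⟩
    (forall₂_congr fun p _ => by
      have := evalMat_mulPoly T⁻¹ T x p
      unfold evalMat at this
      rw [this])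
  rw [← conj_inv_mul hT x]
  exact (hT.mul hu).mul hTi

/-- `K` is a compact Zariski dense subgroup of `G`, unitary in the frame `T`. -/
structure IsUnitaryFrame (G K : Set (Matrix (Fin n) (Fin n) ℂ)) (T : Matrix (Fin n) (Fin n) ℂ) :
    Prop where
  isMatSubgroup : IsMatSubgroup ℂ n G
  isZClosedInGL : IsZClosedInGL ℂ n G
  subset : K ⊆ G
  isCompact : IsCompact K
  isMatSubgroup_compact : IsMatSubgroup ℂ n K
  dense : ∀ p : MvPolynomial (Fin n × Fin n) ℂ,
    (∀ k ∈ K, evalMat k p = 0) → ∀ g ∈ G, evalMat g p = 0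
  isUnit : IsUnit T
  unitary : ∀ k ∈ K, star (T * k * T⁻¹) * (T * k * T⁻¹) = 1

theorem exists_isUnitaryFrame (hG : IsReductiveGroup ℂ n G) : ∃ K T, IsUnitaryFrame G K T := by
  obtain ⟨h1, h2, K, hKG, hKc, hK, hd⟩ := hG
  obtain ⟨T, hT, hu⟩ := exists_unitarizer_of_isCompact hK hKc
  exact ⟨K, T, h1, h2, hKG, hKc, hK, hd, hT, hu⟩

theorem IsUnitaryFrame.mul (h : IsUnitaryFrame G K T) {g : Matrix (Fin n) (Fin n) ℂ}
    (hg : g ∈ G) : IsUnitaryFrame G (conjSet g⁻¹ K) (T * g) := by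
  obtain ⟨hgu, hgi⟩ := h.isMatSubgroup.2.2 g hg
  have hgiu : IsUnit g⁻¹ := Matrix.isUnit_nonsing_inv_iff.2 hgu
  have hgd := (Matrix.isUnit_iff_isUnit_det g).1 hgu
  have hii : g⁻¹⁻¹ = g := Matrix.nonsing_inv_nonsing_inv _ hgd
  refine ⟨h.isMatSubgroup, h.isZClosedInGL, ?_, ?_, isMatSubgroup_conjSet hgiu
    h.isMatSubgroup_compact, ?_, h.isUnit.mul hgu, ?_⟩
  · rintro _ ⟨k, hk, rfl⟩
    change g⁻¹ * k * g⁻¹⁻¹ ∈ G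
    rw [hii]
    exact h.isMatSubgroup.2.1 _ (h.isMatSubgroup.2.1 _ hgi _ (h.subset hk)) _ hg
  · exact h.isCompact.image (by fun_prop)
  · intro p hp x hx
    have h1 := h.dense (mulPoly g⁻¹ g p)
      (fun k hk => by
        rw [evalMat_mulPoly]
        refine hp _ ⟨k, hk, ?_⟩
        change g⁻¹ * k * g⁻¹⁻¹ = _
        rw [hii])
      (g * x * g⁻¹) (h.isMatSubgroup.2.1 _ (h.isMatSubgroup.2.1 _ hg _ hx) _ hgi)
    rwa [evalMat_mulPoly, inv_conj_mul hgu] at h1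
  · rintro _ ⟨k, hk, rfl⟩
    have : T * g * (g⁻¹ * k * g⁻¹⁻¹) * (T * g)⁻¹ = T * k * T⁻¹ := by
      rw [hii, Matrix.mul_inv_rev]
      have h1 : g * g⁻¹ = 1 := Matrix.mul_nonsing_inv _ hgd
      calc T * g * (g⁻¹ * k * g) * (g⁻¹ * T⁻¹) = T * (g * g⁻¹) * k * (g * g⁻¹) * T⁻¹ := by
            simp only [mul_assoc]
        _ = _ := by rw [h1, mul_one, mul_one]
    simp only [this]
    exact h.unitary k hk

theorem IsUnitaryFrame.isUnitaryForm (h : IsUnitaryFrame G K T) : IsUnitaryForm (conjSet T G) where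
  isMatSubgroup := isMatSubgroup_conjSet h.isUnit h.isMatSubgroup
  isZClosedInGL := isZClosedInGL_conjSet h.isUnit h.isZClosedInGL
  exists_dense := by
    refine ⟨conjSet T K, Set.image_mono h.subset,
      isMatSubgroup_conjSet h.isUnit h.isMatSubgroup_compact, ?_, ?_⟩
    · rintro _ ⟨k, hk, rfl⟩
      exact h.unitary k hk
    · rintro p hp _ ⟨g, hg, rfl⟩
      have := h.dense (mulPoly T T⁻¹ p) (fun k hk => by
        rw [evalMat_mulPoly]
        exact hp _ ⟨k, hk, rfl⟩) g hg
      rwa [evalMat_mulPoly] at this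

/-- The group of operators defined by `G` in the frame `T`. -/
abbrev frameGroup (G : Set (Matrix (Fin n) (Fin n) ℂ)) (T : Matrix (Fin n) (Fin n) ℂ) :
    Set (EuclideanSpace ℂ (Fin n) →L[ℂ] EuclideanSpace ℂ (Fin n)) :=
  euclOp '' conjSet T G

/-- The Lie algebra of `frameGroup G T`. -/
abbrev frameLie (G : Set (Matrix (Fin n) (Fin n) ℂ)) (T : Matrix (Fin n) (Fin n) ℂ) :
    Submodule ℂ (EuclideanSpace ℂ (Fin n) →L[ℂ] EuclideanSpace ℂ (Fin n)) :=
  euclLie (conjSet T G)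

namespace IsUnitaryFrame

theorem isCoreGroup (h : IsUnitaryFrame G K T) : IsCoreGroup (frameGroup G T) (frameLie G T) :=
  h.isUnitaryForm.isCoreGroup

theorem euclOp_conj_toFrame (h : IsUnitaryFrame G K T) (g : Matrix (Fin n) (Fin n) ℂ)
    (u : Fin n → ℂ) : euclOp (T * g * T⁻¹) (toFrame T u) = toFrame T (g.mulVec u) := by
  rw [euclOp_toFrame, mul_assoc, Matrix.nonsing_inv_mul _
    ((Matrix.isUnit_iff_isUnit_det T).1 h.isUnit), mul_one, toFrame_mul]

theorem toFrame_injective (h : IsUnitaryFrame G K T) : Function.Injective (toFrame T) :=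
  (WithLp.toLp_injective 2).comp (Matrix.mulVec_injective_of_isUnit h.isUnit)

/-- The frame as a linear equivalence. -/
def equiv (h : IsUnitaryFrame G K T) : (Fin n → ℂ) ≃ₗ[ℂ] EuclideanSpace ℂ (Fin n) :=
  LinearEquiv.ofInjectiveOfFinrankEq (toFrame T) h.toFrame_injective (by simp)

theorem equiv_apply (h : IsUnitaryFrame G K T) (u : Fin n → ℂ) : h.equiv u = toFrame T u := rfl

theorem conj_mem_frameGroup (h : IsUnitaryFrame G K T) {g : Matrix (Fin n) (Fin n) ℂ} :
    euclOp (T * g * T⁻¹) ∈ frameGroup G T ↔ g ∈ G := by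
  rw [euclOp_injective.mem_set_image, mem_conjSet h.isUnit]

theorem conj_mem_frameLie (h : IsUnitaryFrame G K T) {A : Matrix (Fin n) (Fin n) ℂ} :
    euclOp (T * A * T⁻¹) ∈ frameLie G T ↔ A ∈ lieAlgebra ℂ n G := by
  rw [euclOp_mem_euclLie, h.isUnitaryForm.mem_tangentAtOne,
    mem_lieAlgebra_iff h.isMatSubgroup h.isZClosedInGL,
    mem_tangentAtOne h.isMatSubgroup h.isZClosedInGL]
  refine forall_congr' fun t => ?_
  have : t • (T * A * T⁻¹) = T * (t • A) * T⁻¹ := by simp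
  rw [this, Matrix.exp_conj _ _ h.isUnit, mem_conjSet h.isUnit]

theorem toFrame_mem_orbTan (h : IsUnitaryFrame G K T) {v x : Fin n → ℂ} :
    toFrame T x ∈ orbTan (frameLie G T) (toFrame T v) ↔ x ∈ orbitTangent ℂ n G v := by
  have hx : x ∈ orbitTangent ℂ n G v ↔ ∃ A ∈ lieAlgebra ℂ n G, A.mulVec v = x := by
    constructor
    · intro hx
      have hle : orbitTangent ℂ n G v ≤
          (tangentAtOne G).map (LinearMap.flip (Matrix.mulVecBilin ℂ ℂ) v) := by
        refine Submodule.span_le.2 ?_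
        rintro _ ⟨A, hA, rfl⟩
        exact ⟨A, (mem_lieAlgebra_iff h.isMatSubgroup h.isZClosedInGL).1 hA, rfl⟩
      obtain ⟨A, hA, rfl⟩ := hle hx
      exact ⟨A, (mem_lieAlgebra_iff h.isMatSubgroup h.isZClosedInGL).2 hA, rfl⟩
    · rintro ⟨A, hA, rfl⟩
      exact Submodule.subset_span ⟨A, hA, rfl⟩
  rw [mem_orbTan, hx]
  constructor
  · rintro ⟨B, hB, hBx⟩
    obtain ⟨b, rfl⟩ := exists_euclOp_eq B
    rw [← conj_inv_mul h.isUnit b] at hB hBx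
    rw [h.euclOp_conj_toFrame] at hBx
    exact ⟨_, h.conj_mem_frameLie.1 hB, h.toFrame_injective hBx⟩
  · rintro ⟨A, hA, rfl⟩
    exact ⟨_, h.conj_mem_frameLie.2 hA, h.euclOp_conj_toFrame A v⟩

theorem map_orbitTangent (h : IsUnitaryFrame G K T) (v : Fin n → ℂ) :
    (orbitTangent ℂ n G v).map (h.equiv : (Fin n → ℂ) →ₗ[ℂ] EuclideanSpace ℂ (Fin n)) =
      orbTan (frameLie G T) (toFrame T v) := by
  ext x
  obtain ⟨y, rfl⟩ := h.equiv.surjective x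
  rw [h.equiv_apply, h.toFrame_mem_orbTan]
  constructor
  · rintro ⟨z, hz, hzy⟩
    exact h.toFrame_injective hzy ▸ hz
  · exact fun hy => ⟨y, hy, rfl⟩

end IsUnitaryFrame

end UnitaryFrame

section Saturation

open Filter Topology InnerProductSpace NormedSpace

open scoped Matrix.Norms.L2Operator

variable {n : ℕ} {G K : Set (Matrix (Fin n) (Fin n) ℂ)} {T : Matrix (Fin n) (Fin n) ℂ}
  {v : Fin n → ℂ}

theorem isClosed_of_hasClosedOrbit (hv : HasClosedOrbit ℂ n G v) : IsClosed (orbit ℂ n G v) := by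
  have : orbit ℂ n G v = ⋂ p ∈ vanishingIdeal ℂ n (orbit ℂ n G v), {x | eval x p = 0} := by
    ext x
    simp only [Set.mem_iInter]
    exact ⟨fun hx p hp => hp x hx, fun hx => hv hx⟩
  rw [this]
  exact isClosed_biInter fun p _ => isClosed_eq (MvPolynomial.continuous_eval p) continuous_const

theorem isClosed_piFiber : IsClosed (piFiber ℂ n G v) := by
  have : piFiber ℂ n G v = ⋂ p ∈ {p | Invariant ℂ n G p}, {x | eval x p = eval v p} := by
    ext x
    simp only [Set.mem_iInter]
    rfl
  rw [this]
  exact isClosed_biInter fun p _ => isClosed_eq (MvPolynomial.continuous_eval p) continuous_const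

theorem orbit_subset_piFiber : orbit ℂ n G v ⊆ piFiber ℂ n G v := by
  rintro _ ⟨g, hg, rfl⟩ p hp
  exact hp g hg v

theorem mulVec_mem_piFiber {g : Matrix (Fin n) (Fin n) ℂ} (hg : g ∈ G) {u : Fin n → ℂ}
    (hu : u ∈ piFiber ℂ n G v) : g.mulVec u ∈ piFiber ℂ n G v :=
  fun p hp => (hp g hg u).trans (hu p hp)

namespace IsUnitaryFrame

theorem continuous_equiv_symm (h : IsUnitaryFrame G K T) : Continuous h.equiv.symm :=
  h.equiv.symm.toLinearMap.continuous_of_finiteDimensional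

theorem equiv_symm_toFrame (h : IsUnitaryFrame G K T) (u : Fin n → ℂ) :
    h.equiv.symm (toFrame T u) = u :=
  h.equiv.symm_apply_apply u

theorem exists_toFrame_eq (h : IsUnitaryFrame G K T) (x : EuclideanSpace ℂ (Fin n)) :
    ∃ u, toFrame T u = x :=
  h.equiv.surjective x

theorem exists_isCritical (h : IsUnitaryFrame G K T) (hv : HasClosedOrbit ℂ n G v) :
    ∃ K' T', IsUnitaryFrame G K' T' ∧ IsCritical (frameLie G T') (toFrame T' v) := by
  have hc : IsClosed (h.equiv.symm ⁻¹' orbit ℂ n G v) :=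
    (isClosed_of_hasClosedOrbit hv).preimage h.continuous_equiv_symm
  have hne : (h.equiv.symm ⁻¹' orbit ℂ n G v).Nonempty :=
    ⟨toFrame T v, 1, h.isMatSubgroup.1, by simp [h.equiv_symm_toFrame]⟩
  obtain ⟨y, hy, hyd⟩ := hc.exists_infDist_eq_dist hne 0
  obtain ⟨x, rfl⟩ := h.exists_toFrame_eq y
  rw [Set.mem_preimage, h.equiv_symm_toFrame] at hy
  obtain ⟨g, hg, rfl⟩ := hy
  have hF := h.mul hg
  refine ⟨_, _, hF, hF.isCoreGroup.isCritical_of_forall_norm_le ?_⟩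
  rintro _ ⟨_, ⟨a, ha, rfl⟩, rfl⟩
  rw [hF.euclOp_conj_toFrame, toFrame_mul, toFrame_mul, ← dist_zero_left, ← dist_zero_left,
    ← hyd]
  refine Metric.infDist_le_dist_of_mem ?_
  rw [Set.mem_preimage, h.equiv_symm_toFrame]
  exact ⟨g * a, h.isMatSubgroup.2.1 g hg a ha, (Matrix.mulVec_mulVec _ _ _).symm⟩

theorem exists_mulVec_eq_of_norm_le (h : IsUnitaryFrame G K T)
    (hv : IsCritical (frameLie G T) (toFrame T v)) {w : Fin n → ℂ}
    (hinv : ∀ p, Invariant ℂ n G p → eval w p = eval v p)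
    (hwv : ‖toFrame T w‖ ≤ ‖toFrame T v‖) : ∃ k ∈ K, k.mulVec w = v := by
  refine exists_mulVec_eq_of_invariants h.isMatSubgroup_compact h.isCompact h.isUnit h.unitary
    (fun p hp => hinv p (invariant_of_dense h.dense hp)) (fun ε hε => ?_) hwv
  obtain ⟨η, hη, H⟩ := h.isCoreGroup.abs_im_inner_le hv hε
  refine ⟨η, hη, fun k hk => H _ (h.conj_mem_frameGroup.2 (h.subset hk)) ?_⟩
  rw [← euclOp_star, ← euclOp_mul, h.unitary k hk, euclOp_one]

theorem exists_mem_apply_eq (h : IsUnitaryFrame G K T)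
    (hv : IsCritical (frameLie G T) (toFrame T v)) {w : EuclideanSpace ℂ (Fin n)}
    (hw : IsCritical (frameLie G T) w) (hwF : h.equiv.symm w ∈ piFiber ℂ n G v) :
    ∃ k ∈ frameGroup G T, k w = toFrame T v := by
  obtain ⟨u, rfl⟩ := h.exists_toFrame_eq w
  rw [h.equiv_symm_toFrame] at hwF
  suffices ∃ g ∈ G, g.mulVec u = v by
    obtain ⟨g, hg, rfl⟩ := this
    exact ⟨_, h.conj_mem_frameGroup.2 hg, h.euclOp_conj_toFrame g u⟩
  rcases le_total ‖toFrame T u‖ ‖toFrame T v‖ with hle | hle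
  · obtain ⟨k, hk, hku⟩ := h.exists_mulVec_eq_of_norm_le hv hwF hle
    exact ⟨k, h.subset hk, hku⟩
  · obtain ⟨k, hk, rfl⟩ := h.exists_mulVec_eq_of_norm_le hw (fun p hp => (hwF p hp).symm) hle
    obtain ⟨hu, hi⟩ := h.isMatSubgroup.2.2 k (h.subset hk)
    refine ⟨k⁻¹, hi, ?_⟩
    rw [Matrix.mulVec_mulVec, Matrix.nonsing_inv_mul _ ((Matrix.isUnit_iff_isUnit_det k).1 hu),
      Matrix.one_mulVec]

theorem apply_eq_zero_of_finite (h : IsUnitaryFrame G K T) {N : Submodule ℂ (Fin n → ℂ)}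
    (hN : HasFiniteImageOn ℂ n (isotropy ℂ n G v) N)
    {B : EuclideanSpace ℂ (Fin n) →L[ℂ] EuclideanSpace ℂ (Fin n)} (hB : B ∈ frameLie G T)
    (hBv : B (toFrame T v) = 0) {y : Fin n → ℂ} (hy : y ∈ N) : B (toFrame T y) = 0 := by
  set φ : ℝ → EuclideanSpace ℂ (Fin n) := fun t => exp (t • B) (toFrame T y) with hφ
  have hrange : (Set.range φ).Finite := by
    refine ((hN.image fun f => toFrame T (f ⟨y, hy⟩))).subset ?_
    rintro _ ⟨t, rfl⟩
    have hmem := h.isCoreGroup.exp_real_mem hB t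
    obtain ⟨_, ⟨g, hg, rfl⟩, hgt⟩ := hmem
    refine ⟨_, ⟨g, ⟨hg, ?_⟩, rfl⟩, ?_⟩
    · apply h.toFrame_injective
      rw [← h.euclOp_conj_toFrame g v]
      simp only at hgt
      rw [hgt]
      exact exp_apply_of_apply_eq_zero (by simp [hBv])
    · simp only at hgt
      simp only [hφ]
      rw [← h.euclOp_conj_toFrame g y, hgt]
  have hcont : Continuous φ := by
    let : NormedAlgebra ℚ (EuclideanSpace ℂ (Fin n) →L[ℂ] EuclideanSpace ℂ (Fin n)) :=
      NormedAlgebra.restrictScalars ℚ ℂ _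
    have : Continuous fun t : ℝ => exp (t • B) := exp_continuous.comp (by fun_prop)
    exact this.clm_apply continuous_const
  have hsub : (Set.range φ).Subsingleton := by
    by_contra hs
    exact (isPreconnected_range hcont).infinite_of_nontrivial
      (Set.not_subsingleton_iff.1 hs) hrange
  have hconst : φ = fun _ => φ 0 :=
    funext fun t => hsub (Set.mem_range_self t) (Set.mem_range_self 0)
  have hd := hasDerivAt_exp_smul_apply B (toFrame T y)
  change HasDerivAt φ _ 0 at hd
  rw [hconst] at hd
  exact hd.unique (hasDerivAt_const 0 (φ 0))

theorem frameGroup_apply_mem (h : IsUnitaryFrame G K T)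
    {g : EuclideanSpace ℂ (Fin n) →L[ℂ] EuclideanSpace ℂ (Fin n)} (hg : g ∈ frameGroup G T)
    {x : EuclideanSpace ℂ (Fin n)} (hx : h.equiv.symm x ∈ piFiber ℂ n G v) :
    h.equiv.symm (g x) ∈ piFiber ℂ n G v := by
  obtain ⟨_, ⟨a, ha, rfl⟩, rfl⟩ := hg
  obtain ⟨u, rfl⟩ := h.exists_toFrame_eq x
  rw [h.equiv_symm_toFrame] at hx
  simp only [h.euclOp_conj_toFrame, h.equiv_symm_toFrame]
  exact mulVec_mem_piFiber ha hx

end IsUnitaryFrame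

theorem piFiber_eq_orbit_of_isAlmostPrincipalPt (hG : IsReductiveGroup ℂ n G)
    (hv : IsAlmostPrincipalPt ℂ n G v) : piFiber ℂ n G v = orbit ℂ n G v := by
  obtain ⟨hvc, N, ⟨hcompl, -⟩, hfin⟩ := hv
  obtain ⟨K₀, T₀, h₀⟩ := exists_isUnitaryFrame hG
  obtain ⟨K, T, h, hcrit⟩ := h₀.exists_isCritical hvc
  refine Set.Subset.antisymm (fun u hu => ?_) orbit_subset_piFiber
  set N' := N.map (h.equiv : (Fin n → ℂ) →ₗ[ℂ] EuclideanSpace ℂ (Fin n)) with hN'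
  have hsup : orbTan (frameLie G T) (toFrame T v) ⊔ N' = ⊤ := by
    rw [hN', ← h.map_orbitTangent, ← Submodule.map_sup, hcompl.sup_eq_top, Submodule.map_top]
    exact LinearEquiv.range _
  obtain ⟨_, ⟨_, ⟨g, hg, rfl⟩, rfl⟩, hgu⟩ := h.isCoreGroup.mem_orbit_of_trivial_slice hcrit hsup
    (F := h.equiv.symm ⁻¹' piFiber ℂ n G v) (u := toFrame T u)
    (by
      rintro B hB hBv _ ⟨y, hy, rfl⟩
      exact h.apply_eq_zero_of_finite hfin hB hBv hy)
    (isClosed_piFiber.preimage h.continuous_equiv_symm)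
    (fun g hg x hx => h.frameGroup_apply_mem hg hx)
    (fun w hwF hw => h.exists_mem_apply_eq hcrit hw hwF)
    (by rwa [Set.mem_preimage, h.equiv_symm_toFrame])
  rw [h.euclOp_conj_toFrame] at hgu
  exact ⟨g, hg, h.toFrame_injective hgu⟩

theorem isAlmostPrincipalPt_of_piFiber_eq_orbit (hG : IsReductiveGroup ℂ n G)
    (hvc : HasClosedOrbit ℂ n G v) (hfib : piFiber ℂ n G v ⊆ orbit ℂ n G v) :
    IsAlmostPrincipalPt ℂ n G v := by
  obtain ⟨K₀, T₀, h₀⟩ := exists_isUnitaryFrame hG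
  obtain ⟨K, T, h, hcrit⟩ := h₀.exists_isCritical hvc
  have hlie := fun A (hA : A ∈ frameLie G T) hAv x hx =>
    h.isCoreGroup.lie_isotropy_trivial hcrit (F := h.equiv.symm ⁻¹' piFiber ℂ n G v)
      (by
        intro x hx p hp
        obtain ⟨u, rfl⟩ := h.exists_toFrame_eq x
        have hcl : IsClosed {y | eval (h.equiv.symm y) p = eval u p} :=
          isClosed_eq ((MvPolynomial.continuous_eval p).comp h.continuous_equiv_symm)
            continuous_const
        have hsub : (fun g : EuclideanSpace ℂ (Fin n) →L[ℂ] EuclideanSpace ℂ (Fin n) =>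
            g (toFrame T u)) '' frameGroup G T ⊆ {y | eval (h.equiv.symm y) p = eval u p} := by
          rintro _ ⟨_, ⟨_, ⟨g, hg, rfl⟩, rfl⟩, rfl⟩
          simp only [Set.mem_ofPred_eq, h.euclOp_conj_toFrame, h.equiv_symm_toFrame]
          exact hp g hg u
        have := closure_minimal hsub hcl hx
        simp only [Set.mem_ofPred_eq, h.equiv_symm_toFrame] at this
        rw [h.equiv_symm_toFrame, this])
      (by
        intro x hx
        obtain ⟨u, rfl⟩ := h.exists_toFrame_eq x
        rw [Set.mem_preimage, h.equiv_symm_toFrame] at hx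
        obtain ⟨g, hg, rfl⟩ := hfib hx
        exact ⟨_, h.conj_mem_frameGroup.2 hg, h.euclOp_conj_toFrame g v⟩)
      hA hAv (x := x) hx
  have hfin := h.isCoreGroup.finite_image_isotropy hcrit hlie
  set O := (orbTan (frameLie G T) (toFrame T v))ᗮ with hO
  have hiso : ∀ g ∈ isotropy ℂ n G v, euclOp (T * g * T⁻¹) ∈ frameGroup G T ∧
      euclOp (T * g * T⁻¹) (toFrame T v) = toFrame T v := by
    rintro g ⟨hg, hgv⟩
    exact ⟨h.conj_mem_frameGroup.2 hg, by rw [h.euclOp_conj_toFrame, hgv]⟩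
  refine ⟨hvc, O.comap (h.equiv : (Fin n → ℂ) →ₗ[ℂ] EuclideanSpace ℂ (Fin n)), ⟨?_, ?_⟩, ?_⟩
  · have h1 : orbitTangent ℂ n G v = (orbTan (frameLie G T) (toFrame T v)).comap
        (h.equiv : (Fin n → ℂ) →ₗ[ℂ] EuclideanSpace ℂ (Fin n)) := by
      rw [← h.map_orbitTangent, Submodule.comap_map_eq_of_injective h.equiv.injective]
    rw [h1]
    exact (Submodule.orderIsoMapComap h.equiv).symm.isCompl
      (Submodule.isCompl_orthogonal _)
  · intro g hg x hx
    have := h.isCoreGroup.isotropy_mem_orthogonal hcrit (hiso g hg).1 (hiso g hg).2 hx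
    rw [LinearEquiv.coe_coe, h.equiv_apply, h.euclOp_conj_toFrame] at this
    exact this
  · refine (hfin.image fun f x => h.equiv.symm (f ⟨h.equiv x.1, x.2⟩)).subset ?_
    rintro _ ⟨g, hg, rfl⟩
    refine ⟨_, ⟨_, hiso g hg, rfl⟩, ?_⟩
    ext1 x
    simp only [h.equiv_apply, h.euclOp_conj_toFrame, h.equiv_symm_toFrame]

end Saturation

/-- **Proposition 3.1(1).** Let `G` be a complex reductive group and `V = ℂⁿ` a stable
`G`-module.  If a `G`-stable algebraic subset `Y ⊆ V` satisfies `Y = Y_apr`, then `Y` is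
`G`-saturated.  In particular a closed orbit `Gv` is `G`-saturated if and only if it is
almost principal. -/
theorem saturated_of_all_apr
    (n : ℕ) (G : Set (Matrix (Fin n) (Fin n) ℂ)) (hG : IsReductiveGroup ℂ n G)
    (hstab : IsStableModule ℂ n G) :
    (∀ Y : Set (Fin n → ℂ), IsAlgebraicSet ℂ n Y → Stabilizes ℂ n G Y →
      Y ⊆ aprPoints ℂ n G → IsSaturated ℂ n G Y) ∧
    (∀ v : Fin n → ℂ, HasClosedOrbit ℂ n G v →
      (IsSaturated ℂ n G (orbit ℂ n G v) ↔ IsAlmostPrincipalPt ℂ n G v)) := by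
  refine ⟨fun Y _ hYs hY => ?_, fun v hv => ⟨fun hs => ?_, fun hv => ?_⟩⟩
  · refine Set.Subset.antisymm (fun y hy => ⟨y, hy, fun _ _ => rfl⟩) ?_
    rintro u ⟨y, hy, hu⟩
    have huy : u ∈ piFiber ℂ n G y := hu
    rw [piFiber_eq_orbit_of_isAlmostPrincipalPt hG (hY hy)] at huy
    obtain ⟨g, hg, rfl⟩ := huy
    exact hYs g hg y hy
  · refine isAlmostPrincipalPt_of_piFiber_eq_orbit hG hv fun u hu => ?_
    rw [hs]
    exact ⟨v, ⟨1, hG.1.1, Matrix.one_mulVec v⟩, hu⟩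
  · refine Set.Subset.antisymm (fun y hy => ⟨y, hy, fun _ _ => rfl⟩) ?_
    rintro u ⟨_, ⟨g, hg, rfl⟩, hu⟩
    rw [← piFiber_eq_orbit_of_isAlmostPrincipalPt hG hv]
    exact fun p hp => (hu p hp).trans (hp g hg v)

end ZPaper
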